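/- arXiv:1912.04745 — 2 statements merged into one kernel-verified Lean document; each statement's English description precedes it below -/
import Mathlib

section
/- Assume gcd(s+l,2l) = 2·gcd(s,l), and write d = gcd(s,l). Then the number of quadruples (a,b,c,h) ∈ F_{p^s} × F_q × F_q × F_p for which the codeword c(a,b,c,h) has Hamming weight p^{s+2d−1}(p−1)(p^{s−2d} + 1) equals p^{m−4d}(p^{s−d} − 1)(p^m − 1)/((p^d+1)(p^{2d}−1)). -/
/-- `trp p r z = z + z^p + ⋯ + z^(p^(r-1))`, the trace form used for `Tr_r`. -/
def trp (p r : ℕ) {F : Type} [Field F] (z : F) : F :=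
  ∑ i ∈ Finset.range r, z ^ p ^ i

/-- The codeword `c(a,b,c,h)` of the code `C`, viewed as a function on `F_q = F`;
its value at `x` is `Tr_s(a x^(p^s+1)) + Tr_m(b x^(p^l+1) + c x) + h` (the values
lie in the prime field `F_p ⊆ F`). Here `m = 2s`. -/
def cword (p s l : ℕ) {F : Type} [Field F] (a b c : F) (h : ZMod p) : F → F :=
  fun x => trp p s (a * x ^ (p ^ s + 1)) + trp p (2 * s) (b * x ^ (p ^ l + 1) + c * x)
    + ZMod.cast h

/-- The support of the codeword `c(a,b,c,h)`; its cardinality is the Hamming weight. -/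
def suppw (p s l : ℕ) {F : Type} [Field F] [Fintype F] [DecidableEq F]
    (a b c : F) (h : ZMod p) : Finset F :=
  Finset.univ.filter fun x => cword p s l a b c h x ≠ 0

theorem exists_isPrimitiveRoot_of_dvd {F : Type} [Field F] [Fintype F] {n : ℕ}
    (hn : n ∣ Fintype.card F - 1) : ∃ ζ : F, IsPrimitiveRoot ζ n := by
  classical
  obtain ⟨g, hg⟩ := IsCyclic.exists_ofOrder_eq_natCard (α := Fˣ)
  have h1 : IsPrimitiveRoot (g : F) (Fintype.card F - 1) := by
    have := (IsPrimitiveRoot.orderOf g).map_of_injective (f := Units.coeHom F) Units.val_injective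
    rwa [hg, Nat.card_eq_fintype_card, Fintype.card_units] at this
  obtain ⟨k, hk⟩ := hn
  have hpos : 0 < Fintype.card F - 1 := Nat.sub_pos_of_lt Fintype.one_lt_card
  exact ⟨_, h1.pow hpos (by rw [hk, mul_comm])⟩

theorem card_filter_pow_eq {F : Type} [Field F] [Fintype F] [DecidableEq F] {n : ℕ}
    (hn : n ∣ Fintype.card F - 1) {y : F} (hy : y ≠ 0) :
    (Finset.univ.filter fun x : F => x ^ n = y ^ n).card = n := by
  obtain ⟨ζ, hζ⟩ := exists_isPrimitiveRoot_of_dvd hn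
  have hpos : 0 < n := Nat.pos_of_dvd_of_pos hn (Nat.sub_pos_of_lt Fintype.one_lt_card)
  have h1 := hζ.card_nthRoots (y ^ n)
  rw [if_pos ⟨y, rfl⟩] at h1
  refine Eq.trans ?_ h1
  rw [← Multiset.toFinset_card_of_nodup (hζ.nthRoots_nodup (pow_ne_zero n hy))]
  congr 1
  ext x
  simp [Polynomial.mem_nthRoots hpos]

theorem dvd_card_of_invariant {F : Type} [Field F] [Fintype F] [DecidableEq F] {n : ℕ}
    (hn : n ∣ Fintype.card F - 1) (P : F → Prop) [DecidablePred P]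
    (hP : ∀ w x : F, w ^ n = 1 → P x → P (w * x)) :
    n ∣ (Finset.univ.filter fun x : F => x ≠ 0 ∧ P x).card := by
  have hpos : 0 < n := Nat.pos_of_dvd_of_pos hn (Nat.sub_pos_of_lt Fintype.one_lt_card)
  rw [Finset.card_eq_sum_card_image (fun x : F => x ^ n)]
  refine Finset.dvd_sum fun b hb => ?_
  obtain ⟨y, hy, rfl⟩ := Finset.mem_image.1 hb
  simp only [Finset.mem_filter, Finset.mem_univ, true_and] at hy
  apply dvd_of_eq
  conv_lhs => rw [← card_filter_pow_eq hn hy.1]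
  congr 1
  ext x
  simp only [Finset.mem_filter, Finset.mem_univ, true_and]
  refine ⟨fun h => ?_, fun h => h.2⟩
  have hx : x ≠ 0 := by
    rintro rfl
    rw [zero_pow hpos.ne'] at h
    exact pow_ne_zero n hy.1 h.symm
  refine ⟨⟨hx, ?_⟩, h⟩
  have := hP (x / y) y (by rw [div_pow, h, div_self (pow_ne_zero n hy.1)]) hy.2
  rwa [div_mul_cancel₀ _ hy.1] at this

theorem exists_pow_eq_of_pow_eq_one {F : Type} [Field F] [Fintype F] {n k : ℕ}
    (h : n * k ∣ Fintype.card F - 1) {u : F} (hu : u ^ k = 1) : ∃ w : F, w ^ n = u := by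
  classical
  have hF : 0 < Fintype.card F - 1 := Nat.sub_pos_of_lt Fintype.one_lt_card
  have hpos : 0 < n * k := Nat.pos_of_dvd_of_pos h hF
  have hk : 0 < k := Nat.pos_of_mul_pos_left hpos
  obtain ⟨ζ, hζ⟩ := exists_isPrimitiveRoot_of_dvd h
  have h2 := hζ.pow hpos rfl
  have : NeZero k := ⟨hk.ne'⟩
  obtain ⟨i, -, rfl⟩ := h2.eq_pow_of_pow_eq_one hu
  exact ⟨ζ ^ i, by rw [← pow_mul, ← pow_mul, mul_comm]⟩

theorem card_filter_pow_eq_self {F : Type} [Field F] [Fintype F] [DecidableEq F] {N : ℕ}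
    (hN : 2 ≤ N) (h : N - 1 ∣ Fintype.card F - 1) :
    (Finset.univ.filter fun x : F => x ^ N = x).card = N := by
  have h1 := card_filter_pow_eq h (one_ne_zero (α := F))
  have h2 : (Finset.univ.filter fun x : F => x ^ N = x)
      = insert 0 (Finset.univ.filter fun x : F => x ^ (N - 1) = 1 ^ (N - 1)) := by
    ext x
    obtain ⟨M, rfl⟩ : ∃ M, N = M + 2 := ⟨N - 2, by omega⟩
    by_cases hx : x = 0
    · simp [hx]
    · simp [hx, pow_succ (n := M + 1)]
  rw [h2, Finset.card_insert_of_notMem, h1]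
  · omega
  · simp only [Finset.mem_filter, Finset.mem_univ, true_and, one_pow]
    rw [zero_pow (by omega)]
    exact zero_ne_one

theorem card_filter_twisted_linear_le {F : Type} [Field F] [Fintype F] [DecidableEq F]
    (τ : F →+* F) {B C : F} (hB : B ≠ 0) :
    (Finset.univ.filter fun v : F => B * τ v = C * v).card
      ≤ (Finset.univ.filter fun v : F => τ v = v).card := by
  by_cases h : ∃ v0 : F, v0 ≠ 0 ∧ B * τ v0 = C * v0
  · obtain ⟨v0, hv0, h0⟩ := h
    refine Finset.card_le_card_of_injOn (fun v => v / v0) ?_ ?_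
    · intro v hv
      simp only [Finset.coe_filter, Finset.mem_univ, true_and, Set.mem_ofPred_eq] at hv ⊢
      have h1 : τ v0 ≠ 0 := (map_ne_zero τ).2 hv0
      rw [map_div₀, div_eq_div_iff h1 hv0]
      apply mul_left_cancel₀ hB
      linear_combination v0 * hv - v * h0
    · intro x _ y _ hxy
      exact (div_left_inj' hv0).1 hxy
  · push Not at h
    refine Finset.card_le_card fun v hv => ?_
    simp only [Finset.mem_filter, Finset.mem_univ, true_and] at hv ⊢
    by_cases hv0 : v = 0
    · simp [hv0]
    · exact absurd hv (h v hv0)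

theorem card_filter_twisted_quadratic_le {F : Type} [Field F] [Fintype F] [DecidableEq F]
    (τ : F →+* F) {A B C : F} (hB : B ≠ 0) :
    (Finset.univ.filter fun x : F => B * τ (τ x) + A * τ x + C * x = 0).card
      ≤ (Finset.univ.filter fun v : F => τ v = v).card ^ 2 := by
  set k := (Finset.univ.filter fun v : F => τ v = v).card with hk
  by_cases h : ∃ y : F, y ≠ 0 ∧ B * τ (τ y) + A * τ y + C * y = 0
  · obtain ⟨y, hy, h0⟩ := h
    have h1 : τ y ≠ 0 := (map_ne_zero τ).2 hy
    have h2 : τ (τ y) ≠ 0 := (map_ne_zero τ).2 h1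
    have key := Finset.card_le_mul_card_image_of_maps_to
      (s := Finset.univ.filter fun x : F => B * τ (τ x) + A * τ x + C * x = 0)
      (t := Finset.univ.filter fun v : F => (B * τ (τ y)) * τ v = (C * y) * v)
      (f := fun x => τ (x / y) - x / y) ?_ k ?_
    · refine key.trans ?_
      rw [sq]
      exact Nat.mul_le_mul_left _ (card_filter_twisted_linear_le τ (mul_ne_zero hB h2))
    · intro x hx
      simp only [Finset.mem_filter, Finset.mem_univ, true_and] at hx ⊢
      obtain ⟨u, rfl⟩ : ∃ u, x = u * y := ⟨x / y, (div_mul_cancel₀ x hy).symm⟩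
      rw [mul_div_cancel_right₀ _ hy]
      simp only [map_mul, map_sub] at hx ⊢
      linear_combination hx - τ u * h0
    · intro b _
      by_cases hb : ∃ x0 : F, τ (x0 / y) - x0 / y = b
      · obtain ⟨x0, hx0⟩ := hb
        refine Finset.card_le_card_of_injOn (fun x => x / y - x0 / y) ?_ ?_
        · intro x hx
          simp only [Finset.coe_filter, Finset.mem_filter, Finset.mem_univ, true_and,
            Set.mem_ofPred_eq] at hx ⊢
          rw [map_sub]
          linear_combination hx.2 - hx0
        · intro x _ z _ hxz
          exact (div_left_inj' hy).1 (sub_left_injective hxz)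
      · push Not at hb
        rw [Finset.filter_false_of_mem (fun x _ => hb x)]
        simp
  · push Not at h
    have h1 : 1 ≤ k := by
      rw [hk, Nat.one_le_iff_ne_zero, ← Nat.pos_iff_ne_zero, Finset.card_pos]
      exact ⟨0, by simp⟩
    refine le_trans (b := 1) ?_ (Nat.one_le_pow _ _ h1)
    rw [Finset.card_le_one]
    intro x hx z hz
    simp only [Finset.mem_filter, Finset.mem_univ, true_and] at hx hz
    have e : ∀ v : F, B * τ (τ v) + A * τ v + C * v = 0 → v = 0 := fun v hv => by
      by_contra hne
      exact h v hne hv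
    rw [e x hx, e z hz]

/-- The number of points at which `Q` takes the value `v`. -/
def fiberCard {p : ℕ} {F : Type} [Fintype F] (Q : F → ZMod p) (v : ZMod p) : ℕ :=
  (Finset.univ.filter fun x => Q x = v).card

/-- The common value of the exponential sums `∑ x, ψ (Q x)`, for nontrivial `ψ`, of a function
whose nonzero values are all taken equally often. -/
def gaussInt {p : ℕ} {F : Type} [Fintype F] (Q : F → ZMod p) : ℤ :=
  fiberCard Q 0 - fiberCard Q 1

set_option linter.unusedSectionVars false

section Scaling

variable {p : ℕ} [Fact p.Prime] {F : Type} [Field F] [Fintype F] {Q : F → ZMod p}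

theorem fiberCard_eq (hscale : ∀ u : ZMod p, u ≠ 0 → ∃ w : F, w ≠ 0 ∧ ∀ x, Q (w * x) = u * Q x)
    (v : ZMod p) : (fiberCard Q v : ℤ) = fiberCard Q 1 + if v = 0 then gaussInt Q else 0 := by
  split_ifs with hv
  · rw [hv, gaussInt]
    ring
  · rw [add_zero, Nat.cast_inj]
    obtain ⟨w, hw, h⟩ := hscale v hv
    refine (Finset.card_equiv (Equiv.mulLeft₀ w hw) fun x => ?_).symm
    simp [h, hv]

theorem sum_char_eq (hscale : ∀ u : ZMod p, u ≠ 0 → ∃ w : F, w ≠ 0 ∧ ∀ x, Q (w * x) = u * Q x)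
    {ψ : AddChar (ZMod p) ℂ} (hψ : ψ ≠ 1) : ∑ x, ψ (Q x) = gaussInt Q := by
  have h1 : ∀ v : ZMod p, ∑ x with Q x = v, ψ (Q x)
      = fiberCard Q 1 * ψ v + if v = 0 then (gaussInt Q : ℂ) else 0 := fun v => by
    have h2 : (fiberCard Q v : ℂ) = fiberCard Q 1 + if v = 0 then (gaussInt Q : ℂ) else 0 := by
      exact_mod_cast congrArg (Int.cast : ℤ → ℂ) (fiberCard_eq hscale v)
    rw [Finset.sum_congr rfl (g := fun _ => ψ v) fun x hx => by rw [(Finset.mem_filter.1 hx).2],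
      Finset.sum_const, nsmul_eq_mul]
    change (fiberCard Q v : ℂ) * _ = _
    rw [h2]
    split_ifs with hv
    · rw [hv, AddChar.map_zero_eq_one]
      ring
    · ring
  rw [← Finset.sum_fiberwise Finset.univ Q, Finset.sum_congr rfl fun v _ => h1 v,
    Finset.sum_add_distrib, ← Finset.mul_sum, AddChar.sum_eq_zero_of_ne_one hψ]
  simp

theorem card_eq_mul_fiberCard_add
    (hscale : ∀ u : ZMod p, u ≠ 0 → ∃ w : F, w ≠ 0 ∧ ∀ x, Q (w * x) = u * Q x) :
    (Fintype.card F : ℤ) = p * fiberCard Q 1 + gaussInt Q := by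
  have h1 : Fintype.card F = ∑ v : ZMod p, fiberCard Q v :=
    Finset.card_eq_sum_card_fiberwise fun _ _ => Finset.mem_coe.2 (Finset.mem_univ _)
  rw [h1, Nat.cast_sum, Finset.sum_congr rfl fun v _ => fiberCard_eq hscale v,
    Finset.sum_add_distrib]
  simp [ZMod.card]

end Scaling

section Quadratic

variable {p : ℕ} [Fact p.Prime] {F : Type} [Field F] [Fintype F] [DecidableEq F]
  [Algebra (ZMod p) F]

theorem sum_char_trace_mul {ψ : AddChar (ZMod p) ℂ} (hψ : ψ ≠ 1) (c : F) :
    ∑ y, ψ (Algebra.trace (ZMod p) F (y * c)) = if c = 0 then (Fintype.card F : ℂ) else 0 := by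
  have h1 : ψ.compAddMonoidHom (Algebra.trace (ZMod p) F).toAddMonoidHom ≠ 1 := by
    intro h
    apply hψ
    ext v
    obtain ⟨x, rfl⟩ := Algebra.trace_surjective (ZMod p) F v
    exact DFunLike.congr_fun h x
  have h2 := AddChar.sum_mulShift c (AddChar.IsPrimitive.of_ne_one h1)
  rw [Nat.cast_ite, Nat.cast_zero] at h2
  exact h2

theorem card_image_mul_card_ker (L : F →ₗ[ZMod p] F) :
    (Finset.univ.image L).card * (Finset.univ.filter fun x => L x = 0).card = Fintype.card F := by
  rw [← Finset.card_univ, Finset.card_eq_sum_card_image L Finset.univ, ← smul_eq_mul,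
    ← Finset.sum_const]
  refine Finset.sum_congr rfl fun b hb => ?_
  obtain ⟨y, -, rfl⟩ := Finset.mem_image.1 hb
  refine Finset.card_equiv (Equiv.addRight y) fun x => ?_
  simp

variable {Q : F → ZMod p} {L : F →ₗ[ZMod p] F}

theorem quadratic_eq_zero_of_mem_ker (hp : p ≠ 2)
    (hadd : ∀ x y, Q (x + y) = Q x + Q y + Algebra.trace (ZMod p) F (y * L x))
    (hneg : ∀ x, Q (-x) = Q x) {r : F} (hr : L r = 0) : Q r = 0 := by
  have h0 : Q 0 = 0 := by simpa using hadd 0 0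
  have h1 := hadd r (-r)
  rw [add_neg_cancel, hneg, hr, mul_zero, map_zero, h0, add_zero, ← two_mul] at h1
  refine (mul_eq_zero.1 h1.symm).resolve_left fun h2 => hp ?_
  have : (p : ℕ) ∣ 2 := (ZMod.natCast_eq_zero_iff 2 p).1 (by exact_mod_cast h2)
  exact (Nat.prime_dvd_prime_iff_eq Fact.out Nat.prime_two).1 this

theorem gaussInt_sq (hp : p ≠ 2)
    (hadd : ∀ x y, Q (x + y) = Q x + Q y + Algebra.trace (ZMod p) F (y * L x))
    (hneg : ∀ x, Q (-x) = Q x)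
    (hscale : ∀ u : ZMod p, u ≠ 0 → ∃ w : F, w ≠ 0 ∧ ∀ x, Q (w * x) = u * Q x) :
    gaussInt Q ^ 2 = Fintype.card F * (Finset.univ.filter fun x => L x = 0).card := by
  obtain ⟨ψ, hψ⟩ : ∃ ψ : AddChar (ZMod p) ℂ, ψ ≠ 1 :=
    ⟨ZMod.stdAddChar, by
      simpa using ZMod.isPrimitive_stdAddChar p (one_ne_zero (α := ZMod p))⟩
  have h1 := sum_char_eq hscale hψ
  have h2 := sum_char_eq hscale (inv_ne_one.2 hψ)
  have h3 : (gaussInt Q : ℂ) ^ 2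
      = Fintype.card F * (Finset.univ.filter fun x => L x = 0).card := by
    calc (gaussInt Q : ℂ) ^ 2 = (∑ y, ψ⁻¹ (Q y)) * ∑ x, ψ (Q x) := by rw [h1, h2, sq]
      _ = ∑ y, ∑ z, ψ (Q z) * ψ (Algebra.trace (ZMod p) F (y * L z)) := by
          rw [Finset.sum_mul]
          refine Finset.sum_congr rfl fun y _ => ?_
          rw [← Equiv.sum_comp (Equiv.addRight y), Finset.mul_sum]
          refine Finset.sum_congr rfl fun z _ => ?_
          rw [Equiv.coe_addRight, hadd, AddChar.inv_apply, ← AddChar.map_add_eq_mul,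
            ← AddChar.map_add_eq_mul]
          congr 1
          ring
      _ = ∑ z, if L z = 0 then (Fintype.card F : ℂ) else 0 := by
          rw [Finset.sum_comm]
          refine Finset.sum_congr rfl fun z _ => ?_
          rw [← Finset.mul_sum, sum_char_trace_mul hψ]
          split_ifs with hz
          · rw [quadratic_eq_zero_of_mem_ker hp hadd hneg hz, AddChar.map_zero_eq_one, one_mul]
          · rw [mul_zero]
      _ = _ := by
          rw [← Finset.sum_filter, Finset.sum_const, nsmul_eq_mul, mul_comm]
  exact_mod_cast h3

theorem trace_mul_map_comm
    (hadd : ∀ x y, Q (x + y) = Q x + Q y + Algebra.trace (ZMod p) F (y * L x)) (x y : F) :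
    Algebra.trace (ZMod p) F (y * L x) = Algebra.trace (ZMod p) F (x * L y) := by
  have h1 := hadd x y
  have h2 := hadd y x
  rw [add_comm y x] at h2
  linear_combination h2 - h1

theorem exists_ker_of_notMem_range
    (hadd : ∀ x y, Q (x + y) = Q x + Q y + Algebra.trace (ZMod p) F (y * L x))
    {c : F} (hc : ∀ x, L x ≠ c) : ∃ r, L r = 0 ∧ Algebra.trace (ZMod p) F (c * r) ≠ 0 := by
  by_contra! hcon
  have : FiniteDimensional (ZMod p) F := Module.Finite.of_finite
  let B := Algebra.traceForm (ZMod p) F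
  have h1 : LinearMap.range L ≤ B.orthogonal (LinearMap.ker L) := by
    rintro _ ⟨x, rfl⟩ r hr
    change Algebra.trace (ZMod p) F (r * L x) = 0
    rw [trace_mul_map_comm hadd, LinearMap.mem_ker.1 hr, mul_zero, map_zero]
  have h2 : LinearMap.range L = B.orthogonal (LinearMap.ker L) := by
    apply Submodule.eq_of_le_of_finrank_eq h1
    rw [LinearMap.BilinForm.finrank_orthogonal (traceForm_nondegenerate (ZMod p) F)]
    have := LinearMap.finrank_range_add_finrank_ker L
    omega
  have h3 : c ∈ LinearMap.range L := by
    rw [h2]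
    intro r hr
    change Algebra.trace (ZMod p) F (r * c) = 0
    rw [mul_comm]
    exact hcon r hr
  obtain ⟨x, hx⟩ := h3
  exact hc x hx

theorem card_zeros_of_notMem_range (hp : p ≠ 2)
    (hadd : ∀ x y, Q (x + y) = Q x + Q y + Algebra.trace (ZMod p) F (y * L x))
    (hneg : ∀ x, Q (-x) = Q x) {c : F} (hc : ∀ x, L x ≠ c) (h : ZMod p) :
    p * (Finset.univ.filter fun x => Q x + Algebra.trace (ZMod p) F (c * x) + h = 0).card
      = Fintype.card F := by
  obtain ⟨r, hr, hrc⟩ := exists_ker_of_notMem_range hadd hc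
  set f : F → ZMod p := fun x => Q x + Algebra.trace (ZMod p) F (c * x) + h with hf
  have h1 : ∀ v : ZMod p, (Finset.univ.filter fun x => f x = v).card
      = (Finset.univ.filter fun x => f x = 0).card := by
    intro v
    set k : ZMod p := v / Algebra.trace (ZMod p) F (c * r) with hk
    refine (Finset.card_equiv (Equiv.addLeft (k • r)) fun x => ?_).symm
    have hkr : L (k • r) = 0 := by rw [map_smul, hr, smul_zero]
    have : f (k • r + x) = f x + v := by
      simp only [hf]
      rw [hadd, hkr, quadratic_eq_zero_of_mem_ker hp hadd hneg hkr, mul_add, map_add,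
        mul_smul_comm, map_smul, mul_zero, map_zero, smul_eq_mul, hk, div_mul_cancel₀ _ hrc]
      ring
    simp [this]
  have h2 : Fintype.card F = ∑ v : ZMod p, (Finset.univ.filter fun x => f x = v).card :=
    Finset.card_eq_sum_card_fiberwise fun _ _ => Finset.mem_coe.2 (Finset.mem_univ _)
  rw [h2, Finset.sum_congr rfl fun v _ => h1 v, Finset.sum_const, Finset.card_univ, ZMod.card,
    smul_eq_mul]

theorem card_zeros_map
    (hadd : ∀ x y, Q (x + y) = Q x + Q y + Algebra.trace (ZMod p) F (y * L x)) (y : F)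
    (h : ZMod p) :
    (Finset.univ.filter fun x => Q x + Algebra.trace (ZMod p) F (L y * x) + h = 0).card
      = fiberCard Q (Q y - h) := by
  refine Finset.card_equiv (Equiv.addRight y) fun x => ?_
  simp only [Finset.mem_filter, Finset.mem_univ, true_and, Equiv.coe_addRight]
  rw [hadd, trace_mul_map_comm hadd, mul_comm (L y) x]
  constructor <;> intro h <;> linear_combination h

theorem card_pairs_eq (hp : p ≠ 2)
    (hadd : ∀ x y, Q (x + y) = Q x + Q y + Algebra.trace (ZMod p) F (y * L x))
    (hneg : ∀ x, Q (-x) = Q x)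
    (hscale : ∀ u : ZMod p, u ≠ 0 → ∃ w : F, w ≠ 0 ∧ ∀ x, Q (w * x) = u * Q x)
    {T : ℤ} (hT0 : T ≠ 0) (hT : gaussInt Q ≠ (p - 1) * T) :
    (Finset.univ.filter fun t : F × ZMod p =>
      (p : ℤ) * (Finset.univ.filter fun x =>
        Q x + Algebra.trace (ZMod p) F (t.1 * x) + t.2 = 0).card
        = Fintype.card F - (p - 1) * T).card
      = if gaussInt Q = -T then (Finset.univ.image L).card else 0 := by
  have hp1 : ((p : ℤ) - 1) ≠ 0 := by
    have := (Fact.out : p.Prime).one_lt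
    omega
  have hp0 : (p : ℤ) ≠ 0 := Nat.cast_ne_zero.2 (Fact.out : p.Prime).ne_zero
  have hcard := card_eq_mul_fiberCard_add hscale
  have key : ∀ (c : F) (h : ZMod p), ((p : ℤ) * (Finset.univ.filter fun x =>
        Q x + Algebra.trace (ZMod p) F (c * x) + h = 0).card
        = Fintype.card F - (p - 1) * T) ↔ gaussInt Q = -T ∧ ∃ y, L y = c ∧ Q y = h := by
    intro c h
    by_cases hc : ∃ y, L y = c
    · obtain ⟨y, rfl⟩ := hc
      rw [card_zeros_map hadd, fiberCard_eq hscale, hcard]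
      constructor
      · intro e
        split_ifs at e with hh
        · refine ⟨mul_left_cancel₀ hp1 ?_, y, rfl, sub_eq_zero.1 hh⟩
          linear_combination e
        · exact absurd (by linear_combination -e) hT
      · rintro ⟨e, z, hz, rfl⟩
        have : Q z = Q y := by
          have h1 := hadd (z - y) y
          have h2 : L (z - y) = 0 := by rw [map_sub, hz, sub_self]
          rw [h2, quadratic_eq_zero_of_mem_ker hp hadd hneg h2] at h1
          simpa using h1
        rw [if_pos (by rw [this, sub_self]), e]
        ring
    · push Not at hc
      have h1 := card_zeros_of_notMem_range hp hadd hneg hc h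
      constructor
      · intro e
        rw [← h1] at e
        push_cast at e
        have : ((p : ℤ) - 1) * T = 0 := by linear_combination e
        exact absurd this (mul_ne_zero hp1 hT0)
      · rintro ⟨-, y, hy, -⟩
        exact absurd hy (hc y)
  simp only [key]
  split_ifs with hS
  · simp only [hS, true_and]
    have : (Finset.univ.filter fun t : F × ZMod p => ∃ y, L y = t.1 ∧ Q y = t.2)
        = Finset.univ.image fun y => (L y, Q y) := by
      ext ⟨c, h⟩
      simp
    rw [this]
    have h2 : (Finset.univ.image fun y => (L y, Q y)).image Prod.fst = Finset.univ.image L := by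
      rw [Finset.image_image]
      rfl
    rw [← h2]
    refine (Finset.card_image_of_injOn ?_).symm
    rintro ⟨c, h⟩ hx ⟨c', h'⟩ hy (rfl : c = c')
    have hx' := (key c h).2 ⟨hS, by simpa using hx⟩
    simp only [Finset.coe_image, Finset.coe_univ, Set.image_univ, Set.mem_range,
      Prod.mk.injEq] at hx hy
    obtain ⟨y, rfl, rfl⟩ := hx
    obtain ⟨z, hz, rfl⟩ := hy
    have h1 := hadd (z - y) y
    have h2 : L (z - y) = 0 := by rw [map_sub, hz, sub_self]
    rw [h2, quadratic_eq_zero_of_mem_ker hp hadd hneg h2] at h1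
    simpa using h1.symm
  · simp [hS]

end Quadratic

section Frobenius

variable {p : ℕ} [Fact p.Prime] {F : Type} [Field F] [CharP F p]

theorem two_pow_char_pow (k : ℕ) : (2 : F) ^ p ^ k = 2 := by
  simpa [iterateFrobenius_def] using map_ofNat (iterateFrobenius F p k) 2

theorem pow_eq_of_fixed {d : ℕ} {x : F} (hx : x ^ p ^ (2 * d) = x) (i : ℕ) :
    x ^ p ^ (d * (2 * i + 1)) = x ^ p ^ d := by
  induction i with
  | zero => simp
  | succ i ih =>
    have : d * (2 * (i + 1) + 1) = 2 * d + d * (2 * i + 1) := by ring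
    rw [this, pow_add, pow_mul, hx, ih]

theorem fixed_of_pow_eq {d : ℕ} {w v : F} (hv : v ≠ 0) (hvd : v ^ p ^ d = v)
    (hw : w ^ (p ^ d + 1) = v) : w ^ p ^ (2 * d) = w := by
  have hw0 : w ^ p ^ d ≠ 0 := by
    intro h
    rw [pow_succ, h, zero_mul] at hw
    exact hv hw.symm
  apply mul_right_cancel₀ hw0
  rw [← pow_succ', hw]
  calc w ^ p ^ (2 * d) * w ^ p ^ d = (w ^ (p ^ d + 1)) ^ p ^ d := by
        rw [two_mul, pow_add, ← pow_mul, ← pow_add]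
        congr 1
        ring
    _ = v := by rw [hw, hvd]

theorem pow_add_one_eq {d : ℕ} {w v : F} (hv : v ≠ 0) (hvd : v ^ p ^ d = v)
    (hw : w ^ (p ^ d + 1) = v) (i : ℕ) : w ^ (p ^ (d * (2 * i + 1)) + 1) = v := by
  rw [pow_succ, pow_eq_of_fixed (fixed_of_pow_eq hv hvd hw), ← pow_succ, hw]

theorem fixed_gcd {m n : ℕ} {x : F} (hm : x ^ p ^ m = x) (hn : x ^ p ^ n = x) :
    x ^ p ^ m.gcd n = x := by
  have h1 : Function.IsPeriodicPt (frobenius F p) m x := by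
    rw [Function.IsPeriodicPt, Function.IsFixedPt, iterate_frobenius, hm]
  have h2 : Function.IsPeriodicPt (frobenius F p) n x := by
    rw [Function.IsPeriodicPt, Function.IsFixedPt, iterate_frobenius, hn]
  have h3 := h1.gcd h2
  rwa [Function.IsPeriodicPt, Function.IsFixedPt, iterate_frobenius] at h3

theorem algebraMap_pow_char_pow [Algebra (ZMod p) F] (u : ZMod p) (k : ℕ) :
    algebraMap (ZMod p) F u ^ p ^ k = algebraMap (ZMod p) F u := by
  rw [← map_pow, ZMod.pow_card_pow]

theorem trace_pow_char_pow [Finite F] [Algebra (ZMod p) F] (z : F) (k : ℕ) :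
    Algebra.trace (ZMod p) F (z ^ p ^ k) = Algebra.trace (ZMod p) F z := by
  induction k with
  | zero => simp
  | succ k ih =>
    rw [pow_succ, pow_mul, ← ih]
    have hinj : Function.Injective (FiniteField.frobeniusAlgHom (ZMod p) F) :=
      RingHom.injective _
    have := Algebra.trace_eq_of_algEquiv
      (AlgEquiv.ofBijective _ (Finite.injective_iff_bijective.1 hinj)) (z ^ p ^ k)
    simpa [ZMod.card] using this

end Frobenius

section HermitianForm

variable {p s l d i j : ℕ} [Fact p.Prime] {F : Type} [Field F] [CharP F p] [Algebra (ZMod p) F]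

/-- The quadratic form `x ↦ Tr_s (a x^(p^s+1)) + Tr_m (b x^(p^l+1))`, written with the trace
of `F` only. -/
noncomputable def hermForm (p s l : ℕ) {F : Type} [Field F] [Algebra (ZMod p) F] (a b : F) :
    F → ZMod p :=
  fun x => Algebra.trace (ZMod p) F (a / 2 * x ^ (p ^ s + 1) + b * x ^ (p ^ l + 1))

/-- The linear map representing the polar form of `hermForm` with respect to the trace form. -/
noncomputable def hermMap (p s l : ℕ) [Fact p.Prime] {F : Type} [Field F] [CharP F p]
    [Algebra (ZMod p) F] (a b : F) : F →ₗ[ZMod p] F :=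
  (AddMonoidHom.mk' (fun x : F => a * x ^ p ^ s + b * x ^ p ^ l + (b * x) ^ p ^ (2 * s - l))
    fun x y => by simp only [mul_add, add_pow_char_pow]; ring).toZModLinearMap p

theorem hermMap_apply (a b x : F) :
    hermMap p s l a b x = a * x ^ p ^ s + b * x ^ p ^ l + (b * x) ^ p ^ (2 * s - l) := rfl

theorem two_ne_zero_of_char (hp : p ≠ 2) : (2 : F) ≠ 0 := by
  have h : ((2 : ℕ) : F) ≠ 0 := by
    rw [Ne, CharP.cast_eq_zero_iff F p]
    exact fun h => hp ((Nat.prime_dvd_prime_iff_eq Fact.out Nat.prime_two).1 h)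
  exact_mod_cast h

theorem hermForm_add [Finite F] (hp : p ≠ 2) (hl : l ≤ 2 * s) (hq : ∀ x : F, x ^ p ^ (2 * s) = x)
    {a : F} (ha : a ^ p ^ s = a) (b x y : F) :
    hermForm p s l a b (x + y) = hermForm p s l a b x + hermForm p s l a b y
      + Algebra.trace (ZMod p) F (y * hermMap p s l a b x) := by
  have h2 := two_ne_zero_of_char (F := F) hp
  have e1 : Algebra.trace (ZMod p) F (a / 2 * (x * y ^ p ^ s))
      = Algebra.trace (ZMod p) F (a / 2 * (x ^ p ^ s * y)) := by
    rw [← trace_pow_char_pow _ s, mul_pow, div_pow, ha, two_pow_char_pow, mul_pow, ← pow_mul,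
      ← pow_add, ← two_mul, hq]
  have e2 : Algebra.trace (ZMod p) F (b * x * y ^ p ^ l)
      = Algebra.trace (ZMod p) F ((b * x) ^ p ^ (2 * s - l) * y) := by
    rw [← trace_pow_char_pow _ (2 * s - l), mul_pow, ← pow_mul, ← pow_add,
      Nat.add_sub_cancel' hl, hq]
  have e3 : Algebra.trace (ZMod p) F (y * hermMap p s l a b x)
      = Algebra.trace (ZMod p) F (a / 2 * (x ^ p ^ s * y))
        + Algebra.trace (ZMod p) F (a / 2 * (x * y ^ p ^ s))
        + Algebra.trace (ZMod p) F (b * x ^ p ^ l * y)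
        + Algebra.trace (ZMod p) F (b * x * y ^ p ^ l) := by
    rw [e1, e2, ← map_add, ← map_add, ← map_add, hermMap_apply]
    congr 1
    field_simp
    ring
  rw [e3]
  simp only [hermForm, ← map_add]
  congr 1
  simp only [pow_succ, add_pow_char_pow]
  ring

theorem hermForm_neg (hodd : Odd p) (a b x : F) :
    hermForm p s l a b (-x) = hermForm p s l a b x := by
  have h (k : ℕ) : (-x) ^ (p ^ k + 1) = x ^ (p ^ k + 1) := (hodd.pow.add_one).neg_pow x
  simp only [hermForm, h]

theorem hermForm_mul {a b w : F} {u : ZMod p} (hu : u ≠ 0)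
    (hw : w ^ (p ^ d + 1) = algebraMap (ZMod p) F u) (hs : s = d * (2 * i + 1))
    (hl : l = d * (2 * j + 1)) (x : F) :
    hermForm p s l a b (w * x) = u * hermForm p s l a b x := by
  have hv : algebraMap (ZMod p) F u ≠ 0 := (map_ne_zero _).2 hu
  have h1 := pow_add_one_eq hv (algebraMap_pow_char_pow u d) hw
  have hws : w ^ (p ^ s + 1) = algebraMap (ZMod p) F u := by rw [hs, h1]
  have hwl : w ^ (p ^ l + 1) = algebraMap (ZMod p) F u := by rw [hl, h1]
  simp only [hermForm]
  rw [← smul_eq_mul (a := u), ← map_smul, mul_pow, mul_pow, hws, hwl, Algebra.smul_def]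
  congr 1
  ring

theorem hermMap_mul {a b w : F} (hw : w ^ p ^ (2 * d) = w) (hs : s = d * (2 * i + 1))
    (hl : l = d * (2 * j + 1)) (hls : l ≤ 2 * s) (hd : 1 ≤ d) (x : F) :
    hermMap p s l a b (w * x) = w ^ p ^ d * hermMap p s l a b x := by
  have h1 := pow_eq_of_fixed hw
  have h2 : 2 * s - l = d * (2 * (2 * i - j) + 1) := by
    subst hs hl
    have : 2 * j + 1 ≤ 2 * (2 * i + 1) := by
      apply Nat.le_of_mul_le_mul_left (c := d) _ hd
      linarith
    obtain ⟨k, hk⟩ : ∃ k, 2 * i = j + k := ⟨2 * i - j, by omega⟩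
    rw [Nat.sub_eq_iff_eq_add hls, hk, Nat.add_sub_cancel_left, ← hk]
    linear_combination 2 * d * hk
  have e1 : w ^ p ^ s = w ^ p ^ d := by rw [hs, h1]
  have e2 : w ^ p ^ l = w ^ p ^ d := by rw [hl, h1]
  have e3 : w ^ p ^ (2 * s - l) = w ^ p ^ d := by rw [h2, h1]
  simp only [hermMap_apply, mul_pow, e1, e2, e3]
  ring

theorem pow_add_one_dvd (p d k : ℕ) : p ^ d + 1 ∣ p ^ (2 * (d * k)) - 1 := by
  refine dvd_trans ⟨p ^ d - 1, ?_⟩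
    (Nat.pow_sub_one_dvd_pow_sub_one p (m := 2 * d) (k := 2 * (d * k)) ⟨k, by ring⟩)
  have := Nat.sq_sub_sq (p ^ d) 1
  rwa [one_pow, ← pow_mul, mul_comm d] at this

theorem hermForm_scale [Fintype F] (hF : Fintype.card F = p ^ (2 * s)) (hs : s = d * (2 * i + 1))
    (hl : l = d * (2 * j + 1)) (a b : F) (u : ZMod p) (hu : u ≠ 0) :
    ∃ w : F, w ≠ 0 ∧ ∀ x, hermForm p s l a b (w * x) = u * hermForm p s l a b x := by
  have h1 : (p ^ d + 1) * (p - 1) ∣ Fintype.card F - 1 := by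
    rw [hF]
    refine dvd_trans ?_ (Nat.pow_sub_one_dvd_pow_sub_one p (m := 2 * d) (k := 2 * s)
      ⟨2 * i + 1, by rw [hs]; ring⟩)
    have := Nat.sq_sub_sq (p ^ d) 1
    rw [one_pow, ← pow_mul, mul_comm d] at this
    rw [this]
    refine Nat.mul_dvd_mul_left _ ?_
    simpa using Nat.sub_dvd_pow_sub_pow p 1 d
  obtain ⟨w, hw⟩ := exists_pow_eq_of_pow_eq_one h1 (u := algebraMap (ZMod p) F u)
    (by rw [← map_pow, ZMod.pow_card_sub_one_eq_one hu, map_one])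
  refine ⟨w, ?_, hermForm_mul hu hw hs hl⟩
  rintro rfl
  rw [zero_pow (Nat.succ_ne_zero _)] at hw
  exact (map_ne_zero _).2 hu hw.symm

theorem dvd_gaussInt_sub_one [Fintype F] (hF : Fintype.card F = p ^ (2 * s))
    (hs : s = d * (2 * i + 1)) (hl : l = d * (2 * j + 1)) (a b : F) :
    ((p ^ d + 1 : ℕ) : ℤ) ∣ gaussInt (hermForm p s l a b) - 1 := by
  classical
  have h0 : hermForm p s l a b 0 = 0 := by simp [hermForm]
  have hdvd : p ^ d + 1 ∣ Fintype.card F - 1 := by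
    rw [hF, hs]
    exact pow_add_one_dvd p d (2 * i + 1)
  have h1 (v : ZMod p) := dvd_card_of_invariant hdvd (fun x => hermForm p s l a b x = v)
    fun w x hw hx => by
      rw [hermForm_mul one_ne_zero (by rw [hw, map_one]) hs hl, one_mul, hx]
  have e1 : fiberCard (hermForm p s l a b) 1
      = (Finset.univ.filter fun x => x ≠ 0 ∧ hermForm p s l a b x = 1).card := by
    rw [fiberCard]
    congr 1
    ext x
    simp only [Finset.mem_filter, Finset.mem_univ, true_and]
    refine ⟨fun h => ⟨?_, h⟩, fun h => h.2⟩
    rintro rfl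
    exact zero_ne_one (h0.symm.trans h)
  have e0 : fiberCard (hermForm p s l a b) 0
      = (Finset.univ.filter fun x => x ≠ 0 ∧ hermForm p s l a b x = 0).card + 1 := by
    rw [fiberCard, ← Finset.card_insert_of_notMem (a := (0 : F)) (by simp)]
    congr 1
    ext x
    by_cases hx : x = 0 <;> simp [hx, h0]
  have e2 (A B : ℕ) : ((A + 1 : ℕ) : ℤ) - B - 1 = A - B := by
    push_cast
    ring
  rw [gaussInt, e0, e1, e2]
  exact dvd_sub (Int.natCast_dvd_natCast.2 (h1 0)) (Int.natCast_dvd_natCast.2 (h1 1))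

theorem dvd_card_ker_sub_one [Fintype F] [DecidableEq F] (hF : Fintype.card F = p ^ (2 * s))
    (hs : s = d * (2 * i + 1)) (hl : l = d * (2 * j + 1)) (hls : l ≤ 2 * s) (hd : 1 ≤ d)
    (a b : F) :
    p ^ (2 * d) - 1 ∣ (Finset.univ.filter fun x => hermMap p s l a b x = 0).card - 1 := by
  have hdvd : p ^ (2 * d) - 1 ∣ Fintype.card F - 1 := by
    rw [hF, hs]
    exact Nat.pow_sub_one_dvd_pow_sub_one p ⟨2 * i + 1, by ring⟩
  have h1 := dvd_card_of_invariant hdvd (fun x => hermMap p s l a b x = 0)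
    fun w x hw hx => by
      rw [hermMap_mul _ hs hl hls hd, hx, mul_zero]
      have hpos : 1 ≤ p ^ (2 * d) := Nat.one_le_pow _ _ (Fact.out : p.Prime).pos
      rw [← Nat.sub_add_cancel hpos, pow_succ, hw, one_mul]
  convert h1 using 1
  rw [Nat.sub_eq_iff_eq_add, ← Finset.card_insert_of_notMem (a := (0 : F)) (by simp)]
  · congr 1
    ext x
    by_cases hx : x = 0 <;> simp [hx]
  · exact Finset.card_pos.2 ⟨0, by simp⟩

theorem card_ker_le [Fintype F] [DecidableEq F] (hF : Fintype.card F = p ^ (2 * s))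
    (hq : ∀ x : F, x ^ p ^ (2 * s) = x) (hds : d ∣ s) (hgcd : (s + l).gcd (2 * l) = 2 * d)
    (hd : 1 ≤ d) (hls : l ≤ 2 * s) {a b : F} (hab : ¬(a = 0 ∧ b = 0)) :
    (Finset.univ.filter fun x => hermMap p s l a b x = 0).card ≤ p ^ (4 * d) := by
  have hp := (Fact.out : p.Prime)
  by_cases hb : b = 0
  · have ha : a ≠ 0 := fun ha => hab ⟨ha, hb⟩
    refine le_trans (b := 1) ?_ (Nat.one_le_pow _ _ hp.pos)
    rw [Finset.card_le_one]
    have e (x : F) (hx : hermMap p s l a b x = 0) : x = 0 := by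
      rw [hermMap_apply, hb, zero_mul, zero_mul, zero_pow (pow_ne_zero _ hp.ne_zero), add_zero,
        add_zero] at hx
      exact pow_eq_zero_iff (pow_ne_zero _ hp.ne_zero) |>.1 ((mul_eq_zero.1 hx).resolve_left ha)
    intro x hx y hy
    rw [e x (Finset.mem_filter.1 hx).2, e y (Finset.mem_filter.1 hy).2]
  · let τ := iterateFrobenius F p (s + l)
    have hτ (x : F) : τ x = x ^ p ^ (s + l) := iterateFrobenius_def p (s + l) x
    have hτ2 (x : F) : τ (τ x) = x ^ p ^ (2 * l) := by
      rw [hτ, hτ, ← pow_mul, ← pow_add]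
      have : s + l + (s + l) = 2 * s + 2 * l := by ring
      rw [this, pow_add, pow_mul, hq]
    have h1 : (Finset.univ.filter fun v : F => τ v = v).card ≤ p ^ (2 * d) := by
      rw [← card_filter_pow_eq_self (F := F) (N := p ^ (2 * d))
        (hp.two_le.trans (Nat.le_self_pow (by omega) p)) ?_]
      · refine Finset.card_le_card fun x hx => ?_
        simp only [Finset.mem_filter, Finset.mem_univ, true_and] at hx ⊢
        rw [← hgcd]
        refine fixed_gcd (by rw [← hτ, hx]) ?_
        rw [← hτ2, hx, hx]
      · rw [hF]
        exact Nat.pow_sub_one_dvd_pow_sub_one p (Nat.mul_dvd_mul_left 2 hds)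
    have h2 := card_filter_twisted_quadratic_le τ (A := a ^ p ^ l) (C := b)
      (pow_ne_zero (p ^ l) hb)
    calc _ ≤ _ := ?_
      _ ≤ _ := h2
      _ ≤ (p ^ (2 * d)) ^ 2 := Nat.pow_le_pow_left h1 2
      _ = p ^ (4 * d) := by rw [← pow_mul]; congr 1; ring
    refine Finset.card_le_card fun x hx => ?_
    simp only [Finset.mem_filter, Finset.mem_univ, true_and] at hx ⊢
    have h3 := congrArg (· ^ p ^ l) hx
    simp only [hermMap_apply, add_pow_char_pow] at h3
    rw [← pow_mul (b * x), ← pow_add, Nat.sub_add_cancel hls, hq,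
      zero_pow (pow_ne_zero _ hp.ne_zero), mul_pow, mul_pow, ← pow_mul, ← pow_mul, ← pow_add,
      ← pow_add, ← two_mul l] at h3
    rw [hτ2, hτ]
    linear_combination h3

end HermitianForm

theorem pow_half_values {p d i k : ℕ} {S : ℤ} (hp : p.Prime) (hp2 : p ≠ 2) (hd : 1 ≤ d)
    (hsq : S ^ 2 = (p : ℤ) ^ (2 * (d * (2 * i + 1))) * (p : ℤ) ^ k) (hk : k ≤ 4 * d)
    (hdvd : p ^ (2 * d) - 1 ∣ p ^ k - 1) (hS : ((p ^ d + 1 : ℕ) : ℤ) ∣ S - 1) :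
    S = -(p : ℤ) ^ (d * (2 * i + 1)) ∨ S = (p : ℤ) ^ (d * (2 * i + 1)) * (p : ℤ) ^ d
      ∨ S = -((p : ℤ) ^ (d * (2 * i + 1)) * (p : ℤ) ^ (2 * d)) := by
  have h2d : 2 * d ∣ k := by
    have h1 := Nat.gcd_eq_left hdvd
    rw [Nat.pow_sub_one_gcd_pow_sub_one] at h1
    have h2 : p ^ (2 * d).gcd k = p ^ (2 * d) := by
      have := Nat.one_le_pow ((2 * d).gcd k) p hp.pos
      have := Nat.one_le_pow (2 * d) p hp.pos
      omega
    rw [← Nat.pow_right_injective hp.two_le h2]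
    exact Nat.gcd_dvd_right _ _
  obtain ⟨c, rfl⟩ := h2d
  have hc : c ≤ 2 := by
    apply Nat.le_of_mul_le_mul_left (c := 2 * d) _ (by omega)
    linarith
  have h3 : 3 ≤ p := by
    have := hp.two_le
    omega
  have hbig : (3 : ℤ) < ((p ^ d + 1 : ℕ) : ℤ) := by
    have : p ^ 1 ≤ p ^ d := Nat.pow_le_pow_right hp.pos hd
    rw [pow_one] at this
    exact_mod_cast (by omega : 3 < p ^ d + 1)
  have hsq' : S ^ 2 = ((p : ℤ) ^ (d * (2 * i + 1)) * (p : ℤ) ^ (d * c)) ^ 2 := by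
    rw [hsq, mul_pow, ← pow_mul, ← pow_mul]
    congr 2 <;> ring
  have hQ : (p : ℤ) ^ d ≡ -1 [ZMOD ((p ^ d + 1 : ℕ) : ℤ)] := by
    rw [Int.modEq_iff_dvd]
    exact ⟨-1, by push_cast; ring⟩
  have hP : (p : ℤ) ^ (d * (2 * i + 1)) * (p : ℤ) ^ (d * c) ≡ (-1) ^ (c + 1)
      [ZMOD ((p ^ d + 1 : ℕ) : ℤ)] := by
    have h := hQ.pow (2 * i + 1 + c)
    rw [← pow_mul, mul_add, pow_add] at h
    refine h.trans (congrArg (· % _) ?_)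
    have : 2 * i + 1 + c = 2 * i + (c + 1) := by ring
    rw [this, pow_add, pow_mul]
    norm_num
  have hS1 : S ≡ 1 [ZMOD ((p ^ d + 1 : ℕ) : ℤ)] := (Int.modEq_iff_dvd.2 hS).symm
  have hno : ¬ (1 : ℤ) ≡ -1 [ZMOD ((p ^ d + 1 : ℕ) : ℤ)] := by
    intro h
    have := Int.le_of_dvd (by norm_num) (Int.modEq_iff_dvd.1 h.symm)
    omega
  rcases sq_eq_sq_iff_eq_or_eq_neg.1 hsq' with h | h <;> interval_cases c
  · exact absurd (hS1.symm.trans (h ▸ hP)) (by simpa using hno)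
  · right; left; rw [h, mul_one]
  · exact absurd (hS1.symm.trans (h ▸ hP)) (by simpa using hno)
  · left; rw [h]; simp
  · have := hS1.symm.trans (h ▸ hP.neg)
    exact absurd this (by simpa using hno)
  · right; right; rw [h, mul_comm 2 d]

section Moments

variable {p s l d i j : ℕ} [Fact p.Prime] {F : Type} [Field F] [Fintype F] [DecidableEq F]
  [CharP F p] [Algebra (ZMod p) F]

theorem sum_char_trace_half_mul (hp : p ≠ 2) (hF : Fintype.card F = p ^ (2 * s)) (hs : 1 ≤ s)
    {ψ : AddChar (ZMod p) ℂ} (hψ : ψ ≠ 1) {X : F} (hX : X ^ p ^ s = X) :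
    ∑ a with a ^ p ^ s = a, ψ (Algebra.trace (ZMod p) F (a / 2 * X))
      = if X = 0 then (p : ℂ) ^ s else 0 := by
  have hpp := (Fact.out : p.Prime)
  have h2 := two_ne_zero_of_char (F := F) hp
  split_ifs with hX0
  · subst hX0
    have hc : (Finset.univ.filter fun a : F => a ^ p ^ s = a).card = p ^ s :=
      card_filter_pow_eq_self (hpp.two_le.trans (Nat.le_self_pow (by omega) p))
        (by rw [hF]; exact Nat.pow_sub_one_dvd_pow_sub_one p (dvd_mul_left s 2))
    simp [hc]
  · obtain ⟨w, hw⟩ : ∃ w : F, ψ (Algebra.trace (ZMod p) F (w * X)) ≠ 1 := by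
      by_contra! hcon
      have h1 := sum_char_trace_mul hψ X
      rw [if_neg hX0, Finset.sum_congr rfl fun y _ => hcon y] at h1
      simp at h1
    have hq (x : F) : x ^ p ^ (2 * s) = x := by rw [← hF, FiniteField.pow_card]
    set a₀ : F := w + w ^ p ^ s with ha₀
    have ha : a₀ ^ p ^ s = a₀ := by
      rw [ha₀, add_pow_char_pow, ← pow_mul, ← pow_add, ← two_mul, hq, add_comm]
    have htr : Algebra.trace (ZMod p) F (a₀ / 2 * X) = Algebra.trace (ZMod p) F (w * X) := by
      have e : Algebra.trace (ZMod p) F (w ^ p ^ s / 2 * X)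
          = Algebra.trace (ZMod p) F (w / 2 * X) := by
        rw [← trace_pow_char_pow (w / 2 * X) s, mul_pow, div_pow, two_pow_char_pow, hX]
      rw [ha₀, add_div, add_mul, map_add, e, ← map_add]
      congr 1
      field_simp
      ring
    have h1 : ∑ a with a ^ p ^ s = a, ψ (Algebra.trace (ZMod p) F (a / 2 * X))
        = ψ (Algebra.trace (ZMod p) F (w * X))
          * ∑ a with a ^ p ^ s = a, ψ (Algebra.trace (ZMod p) F (a / 2 * X)) := by
      rw [Finset.mul_sum]
      symm
      refine Finset.sum_equiv (Equiv.addLeft a₀) (fun a => ?_) fun a _ => ?_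
      · simp [add_pow_char_pow, ha]
      · change _ = ψ (Algebra.trace (ZMod p) F ((a₀ + a) / 2 * X))
        rw [add_div a₀ a, add_mul, map_add, AddChar.map_add_eq_mul, htr]
    have h3 : (ψ (Algebra.trace (ZMod p) F (w * X)) - 1)
        * ∑ a with a ^ p ^ s = a, ψ (Algebra.trace (ZMod p) F (a / 2 * X)) = 0 := by
      linear_combination -h1
    exact (mul_eq_zero.1 h3).resolve_left (sub_ne_zero.2 hw)

theorem sum_sum_char_trace (hp : p ≠ 2) (hF : Fintype.card F = p ^ (2 * s)) (hs : 1 ≤ s)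
    {ψ : AddChar (ZMod p) ℂ} (hψ : ψ ≠ 1) {X : F} (hX : X ^ p ^ s = X) (Y : F) :
    ∑ a with a ^ p ^ s = a, ∑ b, ψ (Algebra.trace (ZMod p) F (a / 2 * X + b * Y))
      = if X = 0 ∧ Y = 0 then (p : ℂ) ^ (3 * s) else 0 := by
  simp only [map_add, AddChar.map_add_eq_mul]
  rw [← Finset.sum_mul_sum, sum_char_trace_half_mul hp hF hs hψ hX, sum_char_trace_mul hψ, hF]
  by_cases hX0 : X = 0 <;> by_cases hY0 : Y = 0 <;> simp [hX0, hY0]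
  rw [← pow_add]
  congr 1
  ring

theorem pow_add_one_pow_eq_self (hq : ∀ x : F, x ^ p ^ (2 * s) = x) (x : F) :
    (x ^ (p ^ s + 1)) ^ p ^ s = x ^ (p ^ s + 1) := by
  rw [pow_succ, mul_pow, ← pow_mul, ← pow_add p, ← two_mul, hq, mul_comm]

theorem sum_gaussInt (hp : p ≠ 2) (hF : Fintype.card F = p ^ (2 * s))
    (hs1 : 1 ≤ s) (hs : s = d * (2 * i + 1)) (hl : l = d * (2 * j + 1)) :
    ∑ a : F with a ^ p ^ s = a, ∑ b : F, gaussInt (hermForm p s l a b) = (p : ℤ) ^ (3 * s) := by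
  obtain ⟨ψ, hψ⟩ : ∃ ψ : AddChar (ZMod p) ℂ, ψ ≠ 1 :=
    ⟨ZMod.stdAddChar, by
      simpa using ZMod.isPrimitive_stdAddChar p (one_ne_zero (α := ZMod p))⟩
  have hq (x : F) : x ^ p ^ (2 * s) = x := by rw [← hF, FiniteField.pow_card]
  have h : ∑ a : F with a ^ p ^ s = a, ∑ b : F, (gaussInt (hermForm p s l a b) : ℂ)
      = (p : ℂ) ^ (3 * s) := by
    calc _ = ∑ a : F with a ^ p ^ s = a, ∑ b : F, ∑ x, ψ (hermForm p s l a b x) :=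
          Finset.sum_congr rfl fun a _ => Finset.sum_congr rfl fun b _ =>
            (sum_char_eq (hermForm_scale hF hs hl a b) hψ).symm
      _ = ∑ a : F with a ^ p ^ s = a, ∑ x, ∑ b : F, ψ (hermForm p s l a b x) :=
          Finset.sum_congr rfl fun a _ => Finset.sum_comm
      _ = ∑ x, ∑ a : F with a ^ p ^ s = a, ∑ b : F, ψ (hermForm p s l a b x) :=
          Finset.sum_comm
      _ = ∑ x : F, if x = 0 then (p : ℂ) ^ (3 * s) else 0 :=
          Finset.sum_congr rfl fun x _ => by
            refine (sum_sum_char_trace hp hF hs1 hψ (pow_add_one_pow_eq_self hq x)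
              (x ^ (p ^ l + 1))).trans ?_
            simp
      _ = _ := by simp
  exact_mod_cast h

theorem card_norm_pairs (hodd : Odd p) (hF : Fintype.card F = p ^ (2 * s))
    (hs : s = d * (2 * i + 1)) (hl : l = d * (2 * j + 1)) (hgcd : s.gcd l = d) :
    ∑ x : F, ∑ y : F, (if x ^ (p ^ s + 1) + y ^ (p ^ s + 1) = 0
        ∧ x ^ (p ^ l + 1) + y ^ (p ^ l + 1) = 0 then 1 else 0)
      = 1 + (p ^ (2 * s) - 1) * (p ^ d + 1) := by
  have hq (x : F) : x ^ p ^ (2 * s) = x := by rw [← hF, FiniteField.pow_card]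
  have hdvd : p ^ d + 1 ∣ Fintype.card F - 1 := by
    rw [hF, hs]
    exact pow_add_one_dvd p d (2 * i + 1)
  obtain ⟨w, hw⟩ : ∃ w : F, w ^ (p ^ d + 1) = -1 := by
    have h1 : (p ^ d + 1) * 2 ∣ Fintype.card F - 1 := by
      rw [hF]
      refine dvd_trans ?_ (Nat.pow_sub_one_dvd_pow_sub_one p (m := 2 * d) (k := 2 * s)
        ⟨2 * i + 1, by rw [hs]; ring⟩)
      have := Nat.sq_sub_sq (p ^ d) 1
      rw [one_pow, ← pow_mul, mul_comm d] at this
      rw [this]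
      refine Nat.mul_dvd_mul_left _ (Nat.Odd.sub_odd hodd.pow odd_one).two_dvd
    exact exists_pow_eq_of_pow_eq_one h1 (u := (-1 : F)) (by norm_num)
  have hw0 : w ≠ 0 := by
    rintro rfl
    rw [zero_pow (Nat.succ_ne_zero _)] at hw
    exact neg_ne_zero.2 one_ne_zero hw.symm
  have hm1 : (-1 : F) ^ p ^ d = -1 := hodd.pow.neg_one_pow
  have hws : w ^ (p ^ s + 1) = -1 := by
    rw [hs]
    exact pow_add_one_eq (neg_ne_zero.2 one_ne_zero) hm1 hw i
  have hwl : w ^ (p ^ l + 1) = -1 := by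
    rw [hl]
    exact pow_add_one_eq (neg_ne_zero.2 one_ne_zero) hm1 hw j
  have hone (t : F) : t ^ (p ^ s + 1) = 1 ∧ t ^ (p ^ l + 1) = 1 ↔ t ^ (p ^ d + 1) = 1 := by
    constructor
    · rintro ⟨-, h2⟩
      have e1 : t ^ p ^ (2 * l) = t := fixed_of_pow_eq one_ne_zero (one_pow _) h2
      have e2 := fixed_gcd (hq t) e1
      rw [Nat.gcd_mul_left, hgcd] at e2
      rw [pow_succ] at h2 ⊢
      rwa [hl, pow_eq_of_fixed e2] at h2
    · intro h
      rw [hs, hl]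
      exact ⟨pow_add_one_eq one_ne_zero (one_pow _) h i,
        pow_add_one_eq one_ne_zero (one_pow _) h j⟩
  have hy (y : F) : (∑ x : F, if x ^ (p ^ s + 1) + y ^ (p ^ s + 1) = 0
        ∧ x ^ (p ^ l + 1) + y ^ (p ^ l + 1) = 0 then 1 else 0)
      = if y = 0 then 1 else p ^ d + 1 := by
    split_ifs with hy
    · simp [hy]
    · have hwy := mul_ne_zero hw0 hy
      rw [← card_filter_pow_eq hdvd hwy, Finset.card_filter]
      refine Finset.sum_congr rfl fun x _ => ?_
      congr 1
      have e (k : ℕ) (hk : w ^ k = -1) : x ^ k + y ^ k = 0 ↔ (x / (w * y)) ^ k = 1 := by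
        rw [div_pow, div_eq_one_iff_eq (pow_ne_zero _ hwy), mul_pow, hk, neg_one_mul,
          add_eq_zero_iff_eq_neg]
      rw [e _ hws, e _ hwl, hone, div_pow, div_eq_one_iff_eq (pow_ne_zero _ hwy)]
  rw [Finset.sum_comm, Finset.sum_congr rfl fun y _ => hy y,
    ← Finset.add_sum_erase _ _ (Finset.mem_univ (0 : F)), if_pos rfl,
    Finset.sum_congr rfl fun y hy => if_neg (Finset.ne_of_mem_erase hy), Finset.sum_const,
    Finset.card_erase_of_mem (Finset.mem_univ _), Finset.card_univ, hF, smul_eq_mul]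

theorem sum_gaussInt_sq (hodd : Odd p) (hp : p ≠ 2) (hF : Fintype.card F = p ^ (2 * s))
    (hs1 : 1 ≤ s) (hs : s = d * (2 * i + 1)) (hl : l = d * (2 * j + 1)) (hgcd : s.gcd l = d) :
    ∑ a : F with a ^ p ^ s = a, ∑ b : F, gaussInt (hermForm p s l a b) ^ 2
      = (p : ℤ) ^ (3 * s) * (1 + ((p : ℤ) ^ (2 * s) - 1) * ((p : ℤ) ^ d + 1)) := by
  obtain ⟨ψ, hψ⟩ : ∃ ψ : AddChar (ZMod p) ℂ, ψ ≠ 1 :=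
    ⟨ZMod.stdAddChar, by
      simpa using ZMod.isPrimitive_stdAddChar p (one_ne_zero (α := ZMod p))⟩
  have hq (x : F) : x ^ p ^ (2 * s) = x := by rw [← hF, FiniteField.pow_card]
  have hpos : 1 ≤ p ^ (2 * s) := Nat.one_le_pow _ _ (Fact.out : p.Prime).pos
  have h : ∑ a : F with a ^ p ^ s = a, ∑ b : F, (gaussInt (hermForm p s l a b) : ℂ) ^ 2
      = (p : ℂ) ^ (3 * s) * (1 + ((p : ℂ) ^ (2 * s) - 1) * ((p : ℂ) ^ d + 1)) := by
    calc _ = ∑ a : F with a ^ p ^ s = a, ∑ b : F, ∑ t : F × F,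
            ψ (hermForm p s l a b t.1 + hermForm p s l a b t.2) :=
          Finset.sum_congr rfl fun a _ => Finset.sum_congr rfl fun b _ => by
            rw [← sum_char_eq (hermForm_scale hF hs hl a b) hψ, sq, Finset.sum_mul_sum,
              Fintype.sum_prod_type]
            simp only [AddChar.map_add_eq_mul]
      _ = ∑ a : F with a ^ p ^ s = a, ∑ t : F × F, ∑ b : F,
            ψ (hermForm p s l a b t.1 + hermForm p s l a b t.2) :=
          Finset.sum_congr rfl fun a _ => Finset.sum_comm
      _ = ∑ t : F × F, ∑ a : F with a ^ p ^ s = a, ∑ b : F,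
            ψ (hermForm p s l a b t.1 + hermForm p s l a b t.2) :=
          Finset.sum_comm
      _ = ∑ t : F × F, (p : ℂ) ^ (3 * s) * ((if t.1 ^ (p ^ s + 1) + t.2 ^ (p ^ s + 1) = 0
              ∧ t.1 ^ (p ^ l + 1) + t.2 ^ (p ^ l + 1) = 0 then 1 else 0 : ℕ) : ℂ) :=
          Finset.sum_congr rfl fun t _ => by
            have hX : (t.1 ^ (p ^ s + 1) + t.2 ^ (p ^ s + 1)) ^ p ^ s
                = t.1 ^ (p ^ s + 1) + t.2 ^ (p ^ s + 1) := by
              rw [add_pow_char_pow, pow_add_one_pow_eq_self hq, pow_add_one_pow_eq_self hq]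
            have h1 := sum_sum_char_trace hp hF hs1 hψ hX
              (t.1 ^ (p ^ l + 1) + t.2 ^ (p ^ l + 1))
            rw [Nat.cast_ite, Nat.cast_one, Nat.cast_zero, mul_ite, mul_one, mul_zero, ← h1]
            refine Finset.sum_congr rfl fun a _ => Finset.sum_congr rfl fun b _ => ?_
            rw [hermForm, hermForm, ← map_add]
            congr 2
            ring
      _ = _ := by
          rw [← Finset.mul_sum, ← Nat.cast_sum, Fintype.sum_prod_type,
            card_norm_pairs hodd hF hs hl hgcd]
          push_cast [Nat.cast_sub hpos]
          rfl
  exact_mod_cast h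

end Moments

section Weights

variable {p s l d i j : ℕ} [Fact p.Prime] {F : Type} [Field F] [Fintype F] [DecidableEq F]
  [CharP F p] [Algebra (ZMod p) F]

theorem exists_odd_multiples (hs : 2 ≤ s) (hl1 : 1 ≤ l) (hls : l ≠ s) (hl2 : l ≤ 2 * s - 1)
    (hd : s.gcd l = d) (hd' : (s + l).gcd (2 * l) = 2 * d) :
    ∃ i j, s = d * (2 * i + 1) ∧ l = d * (2 * j + 1) ∧ 1 ≤ i ∧ 1 ≤ d := by
  have hd1 : 1 ≤ d := by
    rw [← hd]
    exact Nat.gcd_pos_of_pos_right _ hl1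
  obtain ⟨s', l', hcop, e1, e2⟩ := Nat.exists_coprime s l
  rw [hd, mul_comm] at e1 e2
  have h2 : (s' + l').gcd (2 * l') = 2 := by
    have h : d * (s' + l').gcd (2 * l') = d * 2 := by
      rw [← Nat.gcd_mul_left, mul_comm d 2, ← hd', e1, e2]
      congr 1 <;> ring
    exact Nat.eq_of_mul_eq_mul_left hd1 h
  have heven : 2 ∣ s' + l' := by
    have := Nat.gcd_dvd_left (s' + l') (2 * l')
    rwa [h2] at this
  have hno : ¬(2 ∣ s' ∧ 2 ∣ l') := by
    rintro ⟨h1, h3⟩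
    have := Nat.dvd_gcd h1 h3
    rw [Nat.coprime_iff_gcd_eq_one.1 hcop] at this
    omega
  refine ⟨s' / 2, l' / 2, ?_, ?_, ?_, hd1⟩
  · rw [e1]
    congr 1
    omega
  · rw [e2]
    congr 1
    omega
  · by_contra hlt
    have hs' : s' = 1 := by omega
    rw [hs', mul_one] at e1
    have hl' : l' < 2 := by
      apply Nat.lt_of_mul_lt_mul_left (a := d)
      rw [← e2]
      omega
    have : l' = 1 := by omega
    rw [this, mul_one] at e2
    exact hls (e2.trans e1.symm)

theorem trp_eq_algebraMap_trace (hF : Fintype.card F = p ^ (2 * s)) (z : F) :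
    trp p (2 * s) z = algebraMap (ZMod p) F (Algebra.trace (ZMod p) F z) := by
  have h1 : Module.finrank (ZMod p) F = 2 * s := by
    have := Module.card_eq_pow_finrank (K := ZMod p) (V := F)
    rw [hF, ZMod.card] at this
    exact (Nat.pow_right_injective (Fact.out : p.Prime).two_le this).symm
  rw [FiniteField.algebraMap_trace_eq_sum_pow, h1, Nat.card_zmod, trp]

theorem trp_half (hp : p ≠ 2) {w : F} (hw : w ^ p ^ s = w) : trp p s w = trp p (2 * s) (w / 2) := by
  have h2 := two_ne_zero_of_char (F := F) hp
  have h1 (k : ℕ) : (w / 2) ^ p ^ (s + k) = (w / 2) ^ p ^ k := by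
    rw [pow_add, pow_mul, div_pow, hw, two_pow_char_pow]
  rw [trp, trp, two_mul, Finset.sum_range_add, Finset.sum_congr rfl fun k _ => h1 k, ← two_mul,
    Finset.mul_sum]
  refine Finset.sum_congr rfl fun k _ => ?_
  rw [div_pow, two_pow_char_pow, mul_div_cancel₀ _ h2]

theorem cword_eq_algebraMap (hp : p ≠ 2) (hF : Fintype.card F = p ^ (2 * s)) {a : F}
    (ha : a ^ p ^ s = a) (b c : F) (h : ZMod p) (x : F) :
    cword p s l a b c h x = algebraMap (ZMod p) F
      (hermForm p s l a b x + Algebra.trace (ZMod p) F (c * x) + h) := by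
  have hq (x : F) : x ^ p ^ (2 * s) = x := by rw [← hF, FiniteField.pow_card]
  have e1 : (ZMod.cast h : F) = algebraMap (ZMod p) F h := by
    exact RingHom.congr_fun
      (Subsingleton.elim (ZMod.castHom (dvd_refl p) F) (algebraMap (ZMod p) F)) h
  rw [cword, trp_half hp (by rw [mul_pow, ha, pow_add_one_pow_eq_self hq]),
    trp_eq_algebraMap_trace hF, trp_eq_algebraMap_trace hF, e1, ← map_add, ← map_add, ← map_add,
    hermForm, ← map_add]
  congr 3
  ring

theorem card_suppw_eq_iff (hp : p ≠ 2) (hF : Fintype.card F = p ^ (2 * s)) (hsd : 2 * d ≤ s)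
    (hs1 : 1 ≤ s) {a : F} (ha : a ^ p ^ s = a) (b c : F) (h : ZMod p) :
    (suppw p s l a b c h).card = p ^ (s + 2 * d - 1) * (p - 1) * (p ^ (s - 2 * d) + 1)
      ↔ (p : ℤ) * (Finset.univ.filter fun x =>
          hermForm p s l a b x + Algebra.trace (ZMod p) F (c * x) + h = 0).card
          = Fintype.card F - (p - 1) * (p : ℤ) ^ (s + 2 * d) := by
  have hpp := (Fact.out : p.Prime)
  have hp0 : (p : ℤ) ≠ 0 := Nat.cast_ne_zero.2 hpp.ne_zero
  have h1 : suppw p s l a b c h = Finset.univ.filter fun x =>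
      ¬(hermForm p s l a b x + Algebra.trace (ZMod p) F (c * x) + h = 0) := by
    ext x
    simp only [suppw, Finset.mem_filter, Finset.mem_univ, true_and]
    rw [cword_eq_algebraMap hp hF ha, map_ne_zero]
  have h2 := Finset.card_filter_add_card_filter_not (s := Finset.univ) fun x =>
    hermForm p s l a b x + Algebra.trace (ZMod p) F (c * x) + h = 0
  rw [← h1, Finset.card_univ] at h2
  have h3 : (p : ℤ) * ((p ^ (s + 2 * d - 1) * (p - 1) * (p ^ (s - 2 * d) + 1) : ℕ) : ℤ)
      = (p - 1) * (Fintype.card F + (p : ℤ) ^ (s + 2 * d)) := by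
    have e1 : (p : ℤ) ^ (s + 2 * d) = p * (p : ℤ) ^ (s + 2 * d - 1) := by
      rw [← pow_succ']
      congr 1
      omega
    have e2 : (Fintype.card F : ℤ) = (p : ℤ) ^ (s + 2 * d) * (p : ℤ) ^ (s - 2 * d) := by
      rw [hF, ← pow_add]
      push_cast
      congr 1
      omega
    rw [e2, e1]
    push_cast [Nat.cast_sub hpp.one_le]
    ring
  have h4 : ((suppw p s l a b c h).card : ℤ) = Fintype.card F - (Finset.univ.filter fun x =>
      hermForm p s l a b x + Algebra.trace (ZMod p) F (c * x) + h = 0).card := by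
    rw [← h2]
    push_cast
    ring
  rw [← Nat.cast_inj (R := ℤ), ← mul_right_inj' hp0, h3, h4]
  constructor <;> intro h <;> linear_combination -h

theorem exists_card_ker_eq_pow (hF : Fintype.card F = p ^ (2 * s)) (L : F →ₗ[ZMod p] F) :
    ∃ k, (Finset.univ.filter fun x => L x = 0).card = p ^ k := by
  have h1 : (Finset.univ.filter fun x => L x = 0).card ∣ p ^ (2 * s) := by
    rw [← hF, ← card_image_mul_card_ker L]
    exact dvd_mul_left _ _
  obtain ⟨k, -, hk⟩ := (Nat.dvd_prime_pow Fact.out).1 h1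
  exact ⟨k, hk⟩

theorem gaussInt_hermForm_zero (hF : Fintype.card F = p ^ (2 * s)) :
    gaussInt (hermForm p s l (0 : F) 0) = (p : ℤ) ^ (2 * s) := by
  simp [gaussInt, fiberCard, hermForm, hF]

theorem gaussInt_hermForm_sq (hodd : Odd p) (hp : p ≠ 2) (hF : Fintype.card F = p ^ (2 * s))
    (hs : s = d * (2 * i + 1)) (hl : l = d * (2 * j + 1)) (hls : l ≤ 2 * s)
    {a : F} (ha : a ^ p ^ s = a) (b : F) :
    gaussInt (hermForm p s l a b) ^ 2
      = (p : ℤ) ^ (2 * s) * (Finset.univ.filter fun x => hermMap p s l a b x = 0).card := by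
  have hq (x : F) : x ^ p ^ (2 * s) = x := by rw [← hF, FiniteField.pow_card]
  rw [gaussInt_sq hp (hermForm_add hp hls hq ha b) (hermForm_neg hodd a b)
    (hermForm_scale hF hs hl a b), hF, Nat.cast_pow]

theorem gaussInt_hermForm_values (hodd : Odd p) (hp : p ≠ 2) (hF : Fintype.card F = p ^ (2 * s))
    (hs : s = d * (2 * i + 1)) (hl : l = d * (2 * j + 1)) (hls : l ≤ 2 * s) (hd : 1 ≤ d)
    (hgcd : (s + l).gcd (2 * l) = 2 * d) {a b : F} (ha : a ^ p ^ s = a)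
    (hab : ¬(a = 0 ∧ b = 0)) :
    gaussInt (hermForm p s l a b) = -(p : ℤ) ^ s
      ∨ gaussInt (hermForm p s l a b) = (p : ℤ) ^ s * (p : ℤ) ^ d
      ∨ gaussInt (hermForm p s l a b) = -((p : ℤ) ^ s * (p : ℤ) ^ (2 * d)) := by
  have hq (x : F) : x ^ p ^ (2 * s) = x := by rw [← hF, FiniteField.pow_card]
  have hpp := (Fact.out : p.Prime)
  obtain ⟨k, hk⟩ := exists_card_ker_eq_pow hF (hermMap p s l a b)
  have h1 := gaussInt_hermForm_sq hodd hp hF hs hl hls ha b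
  have h2 := card_ker_le hF hq ⟨_, hs⟩ hgcd hd hls hab
  have h3 := dvd_card_ker_sub_one hF hs hl hls hd a b
  rw [hk] at h1 h2 h3
  have h4 := pow_half_values (i := i) hpp hp hd (by rw [← hs, h1, Nat.cast_pow])
    ((Nat.pow_le_pow_iff_right hpp.one_lt).1 h2) h3 (dvd_gaussInt_sub_one hF hs hl a b)
  rwa [← hs] at h4

theorem gaussInt_hermForm_ne (hodd : Odd p) (hp : p ≠ 2) (hF : Fintype.card F = p ^ (2 * s))
    (hs : s = d * (2 * i + 1)) (hl : l = d * (2 * j + 1)) (hls : l ≤ 2 * s)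
    {a : F} (ha : a ^ p ^ s = a) (b : F) (T : ℤ) :
    gaussInt (hermForm p s l a b) ≠ (p - 1) * T := by
  intro h
  have hpp := (Fact.out : p.Prime)
  obtain ⟨k, hk⟩ := exists_card_ker_eq_pow hF (hermMap p s l a b)
  have h1 := gaussInt_hermForm_sq hodd hp hF hs hl hls ha b
  rw [hk, Nat.cast_pow, ← pow_add, h] at h1
  have h2 : (p : ℤ) - 1 ∣ (p : ℤ) ^ (2 * s + k) := ⟨T * ((p - 1) * T), by rw [← h1]; ring⟩
  have h3 : IsCoprime ((p : ℤ) - 1) ((p : ℤ) ^ (2 * s + k)) :=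
    IsCoprime.pow_right ⟨-1, 1, by ring⟩
  have h4 := hpp.two_le
  rcases Int.isUnit_iff.1 (h3.isUnit_of_dvd h2) with h5 | h5 <;> omega

theorem card_pairs_hermForm (hodd : Odd p) (hp : p ≠ 2) (hF : Fintype.card F = p ^ (2 * s))
    (hs : s = d * (2 * i + 1)) (hl : l = d * (2 * j + 1)) (hls : l ≤ 2 * s) (hsd : 2 * d ≤ s)
    (hs1 : 1 ≤ s) {a : F} (ha : a ^ p ^ s = a) (b : F) :
    (Finset.univ.filter fun t : F × ZMod p => (suppw p s l a b t.1 t.2).card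
        = p ^ (s + 2 * d - 1) * (p - 1) * (p ^ (s - 2 * d) + 1)).card
      = if gaussInt (hermForm p s l a b) = -(p : ℤ) ^ (s + 2 * d)
        then p ^ (2 * s - 4 * d) else 0 := by
  have hq (x : F) : x ^ p ^ (2 * s) = x := by rw [← hF, FiniteField.pow_card]
  have hpp := (Fact.out : p.Prime)
  have hp0 : (p : ℤ) ≠ 0 := Nat.cast_ne_zero.2 hpp.ne_zero
  simp only [card_suppw_eq_iff hp hF hsd hs1 ha]
  rw [card_pairs_eq hp (hermForm_add hp hls hq ha b) (hermForm_neg hodd a b)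
    (hermForm_scale hF hs hl a b) (pow_ne_zero _ hp0)
    (gaussInt_hermForm_ne hodd hp hF hs hl hls ha b _)]
  split_ifs with hS
  · have h1 := gaussInt_hermForm_sq hodd hp hF hs hl hls ha b
    have h2 : ((Finset.univ.filter fun x => hermMap p s l a b x = 0).card : ℤ)
        = ((p ^ (4 * d) : ℕ) : ℤ) := by
      apply mul_left_cancel₀ (pow_ne_zero (2 * s) hp0)
      rw [← h1, hS]
      push_cast
      ring
    rw [Nat.cast_inj] at h2
    have h3 := card_image_mul_card_ker (hermMap p s l a b)
    rw [h2, hF] at h3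
    apply Nat.eq_of_mul_eq_mul_right (pow_pos hpp.pos (4 * d))
    rw [h3, ← pow_add]
    congr 1
    omega
  · rfl

theorem count_gaussInt (hodd : Odd p) (hp : p ≠ 2) (hF : Fintype.card F = p ^ (2 * s))
    (hs : s = d * (2 * i + 1)) (hl : l = d * (2 * j + 1)) (hls : l ≤ 2 * s) (hs1 : 1 ≤ s)
    (hd : 1 ≤ d) (hsl : s.gcd l = d) (hgcd : (s + l).gcd (2 * l) = 2 * d) :
    (∑ a : F with a ^ p ^ s = a, ∑ b : F,
        if gaussInt (hermForm p s l a b) = -(p : ℤ) ^ (s + 2 * d) then (1 : ℤ) else 0)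
      * (((p : ℤ) ^ s * (p : ℤ) ^ (2 * d) - (p : ℤ) ^ s)
        * ((p : ℤ) ^ s * (p : ℤ) ^ (2 * d) + (p : ℤ) ^ s * (p : ℤ) ^ d))
      = (p : ℤ) ^ (2 * s) * ((p : ℤ) ^ (2 * s) - 1) * ((p : ℤ) ^ s - (p : ℤ) ^ d) := by
  have hpp := (Fact.out : p.Prime)
  have hpos (k : ℕ) : 0 < (p : ℤ) ^ k := pow_pos (Nat.cast_pos.2 hpp.pos) k
  have hlt : (1 : ℤ) < (p : ℤ) ^ d := one_lt_pow₀ (by exact_mod_cast hpp.one_lt) (by omega)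
  set P : ℤ := (p : ℤ) ^ s with hP
  set Q : ℤ := (p : ℤ) ^ d with hQ
  have hP0 : 0 < P := hpos s
  have eQ : (p : ℤ) ^ (2 * d) = Q ^ 2 := by rw [hQ, ← pow_mul, mul_comm]
  have eP : (p : ℤ) ^ (2 * s) = P ^ 2 := by rw [hP, ← pow_mul, mul_comm]
  have eP3 : (p : ℤ) ^ (3 * s) = P ^ 3 := by rw [hP, ← pow_mul, mul_comm]
  have eT : (p : ℤ) ^ (s + 2 * d) = P * Q ^ 2 := by rw [pow_add, eQ]
  have hA : ((Finset.univ.filter fun a : F => a ^ p ^ s = a).card : ℤ) = P := by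
    rw [card_filter_pow_eq_self (hpp.two_le.trans (Nat.le_self_pow (by omega) p))
      (by rw [hF]; exact Nat.pow_sub_one_dvd_pow_sub_one p (dvd_mul_left s 2)), hP, Nat.cast_pow]
  have hC : (Fintype.card F : ℤ) = P ^ 2 := by rw [hF, Nat.cast_pow, eP]
  have M1 := sum_gaussInt hp hF hs1 hs hl
  have M2 := sum_gaussInt_sq hodd hp hF hs1 hs hl hsl
  rw [eP3] at M1 M2
  rw [eP] at M2
  rw [eQ, eP, eT]
  have hpt : ∀ a ∈ Finset.univ.filter (fun a : F => a ^ p ^ s = a), ∀ b : F,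
      gaussInt (hermForm p s l a b) ^ 2 + (P - P * Q) * gaussInt (hermForm p s l a b)
          - P ^ 2 * Q
        = (if gaussInt (hermForm p s l a b) = -(P * Q ^ 2) then (1 : ℤ) else 0)
            * ((P * Q ^ 2 - P) * (P * Q ^ 2 + P * Q))
          + if a = 0 then (if b = 0 then (P ^ 2 + P) * (P ^ 2 - P * Q) else 0) else 0 := by
    intro a ha b
    have ha := (Finset.mem_filter.1 ha).2
    by_cases hab : a = 0 ∧ b = 0
    · obtain ⟨rfl, rfl⟩ := hab
      rw [gaussInt_hermForm_zero hF, eP, if_pos rfl, if_pos rfl, if_neg]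
      · ring
      · have : 0 < P * Q ^ 2 := by positivity
        have : 0 < P ^ 2 := by positivity
        omega
    · have e0 : (if a = 0 then (if b = 0 then (P ^ 2 + P) * (P ^ 2 - P * Q) else 0) else 0)
          = (0 : ℤ) := by
        rw [← ite_and, if_neg hab]
      rw [e0]
      rcases gaussInt_hermForm_values hodd hp hF hs hl hls hd hgcd ha hab with h | h | h
      · rw [h, ← hP, if_neg]
        · ring
        · intro h
          have : P * 1 < P * Q ^ 2 := mul_lt_mul_of_pos_left (one_lt_pow₀ hlt two_ne_zero) hP0
          omega
      · rw [h, ← hP, ← hQ, if_neg]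
        · ring
        · have : 0 < P * Q ^ 2 := by positivity
          have : 0 < P * Q := by positivity
          omega
      · rw [h, ← hP, eQ, if_pos rfl]
        ring
  have hsum := Finset.sum_congr rfl fun a ha => Finset.sum_congr (s₁ := Finset.univ) rfl
    fun b _ => hpt a ha b
  have h0 : ∑ a : F with a ^ p ^ s = a,
      (if a = 0 then (P ^ 2 + P) * (P ^ 2 - P * Q) else 0) = (P ^ 2 + P) * (P ^ 2 - P * Q) := by
    rw [Finset.sum_ite_eq' (Finset.univ.filter fun a : F => a ^ p ^ s = a) 0 (fun _ => _),
      if_pos]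
    simp [hpp.ne_zero]
  simp only [Finset.sum_add_distrib, Finset.sum_sub_distrib, ← Finset.mul_sum, ← Finset.sum_mul,
    Finset.sum_const, Finset.card_univ, nsmul_eq_mul, hA, hC, M1, M2] at hsum
  have h1 (a : F) : (∑ b : F, if a = 0 then (if b = 0 then (P ^ 2 + P) * (P ^ 2 - P * Q) else 0)
      else 0) = if a = 0 then (P ^ 2 + P) * (P ^ 2 - P * Q) else 0 := by
    by_cases ha : a = 0 <;> simp [ha]
  simp only [h1, h0] at hsum
  linear_combination -hsum

end Weights

theorem stmt12 (p s l : ℕ) [Fact p.Prime] (F : Type) [Field F] [Fintype F] [DecidableEq F]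
    [CharP F p] (hodd : Odd p) (hs : 2 ≤ s) (hl1 : 1 ≤ l) (hls : l ≠ s)
    (hl2 : l ≤ 2 * s - 1) (hF : Fintype.card F = p ^ (2 * s)) (d : ℕ)
    (hd : Nat.gcd s l = d) (hd' : Nat.gcd (s + l) (2 * l) = 2 * d) :
    (((Finset.univ : Finset (F × F × F × ZMod p)).filter fun t =>
        t.1 ^ p ^ s = t.1 ∧ (suppw p s l t.1 t.2.1 t.2.2.1 t.2.2.2).card
          = p ^ (s + 2 * d - 1) * (p - 1) * (p ^ (s - 2 * d) + 1)).card : ℚ)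
      = (p : ℚ) ^ (2 * s - 4 * d) * ((p : ℚ) ^ (s - d) - 1) * ((p : ℚ) ^ (2 * s) - 1)
          / (((p : ℚ) ^ d + 1) * ((p : ℚ) ^ (2 * d) - 1)) := by
  let : Algebra (ZMod p) F := ZMod.algebra F p
  have hpp := (Fact.out : p.Prime)
  have hp : p ≠ 2 := by
    rintro rfl
    exact absurd hodd (by decide)
  obtain ⟨i, j, hsi, hlj, hi, hd1⟩ := exists_odd_multiples hs hl1 hls hl2 hd hd'
  have hs1 : 1 ≤ s := by omega
  have hsd : 3 * d ≤ s := by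
    rw [hsi, mul_comm]
    exact Nat.mul_le_mul_left d (by omega)
  have hcount := count_gaussInt hodd hp hF hsi hlj (by omega) hs1 hd1 hd hd'
  have hcard : (((Finset.univ : Finset (F × F × F × ZMod p)).filter fun t =>
        t.1 ^ p ^ s = t.1 ∧ (suppw p s l t.1 t.2.1 t.2.2.1 t.2.2.2).card
          = p ^ (s + 2 * d - 1) * (p - 1) * (p ^ (s - 2 * d) + 1)).card : ℤ)
      = p ^ (2 * s - 4 * d) * ∑ a : F with a ^ p ^ s = a, ∑ b : F,
        if gaussInt (hermForm p s l a b) = -(p : ℤ) ^ (s + 2 * d) then (1 : ℤ) else 0 := by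
    rw [Finset.card_filter, Fintype.sum_prod_type, Nat.cast_sum, Finset.sum_filter,
      Finset.mul_sum]
    refine Finset.sum_congr rfl fun a _ => ?_
    by_cases ha : a ^ p ^ s = a
    · simp only [ha, true_and, if_true]
      rw [Fintype.sum_prod_type, Nat.cast_sum, Finset.mul_sum]
      refine Finset.sum_congr rfl fun b _ => ?_
      rw [← Finset.card_filter,
        card_pairs_hermForm hodd hp hF hsi hlj (by omega) (by omega) hs1 ha b]
      push_cast
      rw [mul_ite, mul_one, mul_zero]
    · simp [ha]
  set n := ∑ a : F with a ^ p ^ s = a, ∑ b : F,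
    if gaussInt (hermForm p s l a b) = -(p : ℤ) ^ (s + 2 * d) then (1 : ℤ) else 0
  have hcard' := congrArg (Int.cast : ℤ → ℚ) hcard
  have hcount' := congrArg (Int.cast : ℤ → ℚ) hcount
  push_cast at hcard' hcount'
  rw [hcard']
  have hQ1 : (1 : ℚ) < (p : ℚ) ^ d := one_lt_pow₀ (by exact_mod_cast hpp.one_lt) (by omega)
  have hPQ : (p : ℚ) ^ s = (p : ℚ) ^ d * (p : ℚ) ^ (s - d) := by
    rw [← pow_add]
    congr 1
    omega
  have hP0 : (p : ℚ) ^ s ≠ 0 := pow_ne_zero _ (Nat.cast_ne_zero.2 hpp.ne_zero)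
  have e2d : (p : ℚ) ^ (2 * d) = ((p : ℚ) ^ d) ^ 2 := by rw [← pow_mul, mul_comm]
  have e2s : (p : ℚ) ^ (2 * s) = ((p : ℚ) ^ s) ^ 2 := by rw [← pow_mul, mul_comm]
  rw [e2d, e2s] at hcount' ⊢
  have hden : ((p : ℚ) ^ d + 1) * (((p : ℚ) ^ d) ^ 2 - 1) ≠ 0 := by
    have : 1 < ((p : ℚ) ^ d) ^ 2 := one_lt_pow₀ hQ1 two_ne_zero
    exact mul_ne_zero (by linarith) (by linarith)
  have hQ0 : (p : ℚ) ^ d ≠ 0 := by linarith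
  rw [eq_div_iff hden]
  generalize (p : ℚ) ^ d = Q at *
  generalize hPP : (p : ℚ) ^ s = P at *
  have key : (n : ℚ) * ((Q + 1) * (Q ^ 2 - 1)) = ((p : ℚ) ^ (s - d) - 1) * (P ^ 2 - 1) := by
    apply mul_left_cancel₀ (mul_ne_zero (pow_ne_zero 2 hP0) hQ0)
    linear_combination hcount' + P ^ 2 * (P ^ 2 - 1) * hPQ
  linear_combination (p : ℚ) ^ (2 * s - 4 * d) * key
end

section
/- Assume gcd(s+l,2l) = gcd(s,l) = d and d is odd. Let i = (p−1)(p^{m−1} − p^{s−1}) and λ = p^{s+d−1}·[(p−1)(p^{m−1} − p^{s−1}) − 1]·(p^m − 1)/(2(p^d + 1)). Then the distinct supports of the codewords of Hamming weight i in C form a 2-(p^m, i, λ) design on the point set F_q: each such support has exactly i elements, and every 2-element subset of F_q is contained in exactly λ of the distinct supports. -/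
set_option linter.unusedSectionVars false

section GaussSums

variable {p : ℕ} [Fact p.Prime] {ψ : AddChar (ZMod p) ℂ}

/-- The quadratic character of the prime field with complex values. -/
noncomputable def qchar (p : ℕ) [Fact p.Prime] : MulChar (ZMod p) ℂ :=
  (quadraticChar (ZMod p)).ringHomComp (Int.castRingHom ℂ)

theorem qchar_apply (x : ZMod p) : qchar p x = ((quadraticChar (ZMod p) x : ℤ) : ℂ) := rfl

theorem ringChar_ne_two (hp : Odd p) : ringChar (ZMod p) ≠ 2 := by
  rw [ZMod.ringChar_zmod_n]
  rintro rfl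
  exact absurd hp (by decide)

theorem qchar_ne_one (hp : Odd p) : qchar p ≠ 1 := by
  obtain ⟨a, ha⟩ := quadraticChar_exists_neg_one' (F := ZMod p) (ringChar_ne_two hp)
  intro h
  have h1 := qchar_apply (p := p) a
  rw [h, ha, MulChar.one_apply a.isUnit] at h1
  norm_num at h1

theorem qchar_sq {x : ZMod p} (hx : x ≠ 0) : qchar p x ^ 2 = 1 := by
  rw [qchar_apply]
  exact_mod_cast quadraticChar_sq_one hx

theorem gaussSum_qchar_sq (hp : Odd p) (hψ : ψ.IsPrimitive) :
    gaussSum (qchar p) ψ ^ 2 = qchar p (-1) * p := by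
  have hq : (qchar p).IsQuadratic := (quadraticChar_isQuadratic _).comp _
  have h : gaussSum (qchar p) ψ ^ 2 = qchar p (-1) * Fintype.card (ZMod p) :=
    gaussSum_sq (qchar_ne_one hp) hq hψ
  rw [h, ZMod.card]

theorem sum_addChar_mul (hψ : ψ.IsPrimitive) (w : ZMod p) :
    ∑ x, ψ (w * x) = if w = 0 then (p : ℂ) else 0 := by
  have h := AddChar.sum_mulShift w hψ
  simp only [mul_comm _ w, ZMod.card] at h
  rw [h]
  split_ifs <;> simp

theorem sum_qchar_mul {w : ZMod p} (hw : w ≠ 0) :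
    ∑ x, qchar p x * ψ (w * x) = qchar p w * gaussSum (qchar p) ψ := by
  have h := gaussSum_mulShift (qchar p) ψ (Units.mk0 w hw)
  simp only [Units.val_mk0] at h
  rw [← h, ← mul_assoc, ← sq, qchar_sq hw, one_mul, gaussSum]
  simp [AddChar.mulShift_apply]

/-- The one-variable quadratic Gauss sum. -/
theorem sum_addChar_mul_sq (hp : Odd p) (hψ : ψ.IsPrimitive) {w : ZMod p} (hw : w ≠ 0) :
    ∑ x, ψ (w * (x * x)) = qchar p w * gaussSum (qchar p) ψ := by
  have h : ∑ x, ψ (w * (x * x)) = ∑ a, (qchar p a + 1) * ψ (w * a) := by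
    rw [← Finset.sum_fiberwise (s := Finset.univ) (g := fun x : ZMod p => x * x)]
    refine Finset.sum_congr rfl fun a _ => ?_
    rw [Finset.sum_congr rfl (g := fun _ => ψ (w * a)), Finset.sum_const, nsmul_eq_mul]
    · congr 1
      have := quadraticChar_card_sqrts (ringChar_ne_two hp) a
      rw [qchar_apply, ← Int.cast_one, ← Int.cast_add, ← this, Int.cast_natCast]
      congr 2
      ext x
      simp [sq]
    · intro x hx
      simp only [Finset.mem_filter] at hx
      rw [hx.2]
  rw [h]
  simp only [add_mul, one_mul, Finset.sum_add_distrib]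
  rw [sum_addChar_mul hψ, sum_qchar_mul hw, if_neg hw, add_zero]

theorem addChar_sum_eq_prod {ι : Type} (s : Finset ι) (f : ι → ZMod p) :
    ψ (∑ i ∈ s, f i) = ∏ i ∈ s, ψ (f i) := by
  classical
  induction s using Finset.induction_on with
  | empty => simp
  | insert i s hi ih => rw [Finset.sum_insert hi, Finset.prod_insert hi, ψ.map_add_eq_mul, ih]

/-- Gauss sums of a diagonal quadratic form. -/
theorem gauss_weighted (hp : Odd p) (hψ : ψ.IsPrimitive) {ι : Type} [Fintype ι]
    [DecidableEq ι] (w : ι → ZMod p) :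
    ∃ r ≤ Fintype.card ι,
      (∑ x : ι → ZMod p, ψ (∑ i, w i * (x i * x i))) ^ 2
        = qchar p (-1) ^ r * (p : ℂ) ^ (2 * Fintype.card ι - r) ∧
      ∀ t ≠ 0, ∑ x : ι → ZMod p, ψ (t * ∑ i, w i * (x i * x i))
        = qchar p t ^ r * ∑ x : ι → ZMod p, ψ (∑ i, w i * (x i * x i)) := by
  have key : ∀ t : ZMod p, ∑ x : ι → ZMod p, ψ (t * ∑ i, w i * (x i * x i))
      = ∏ i, ∑ y, ψ (t * w i * (y * y)) := by
    intro t
    rw [Finset.prod_univ_sum, Fintype.piFinset_univ]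
    refine Finset.sum_congr rfl fun x _ => ?_
    rw [Finset.mul_sum, addChar_sum_eq_prod]
    simp [mul_assoc]
  have key1 := key 1
  simp only [one_mul] at key1
  let N := Finset.univ.filter fun i => w i ≠ 0
  have hN : N.card ≤ Fintype.card ι := Finset.card_le_univ _
  refine ⟨N.card, hN, ?_, fun t ht => ?_⟩
  · rw [key1, ← Finset.prod_pow]
    have h : ∀ i, (∑ y, ψ (w i * (y * y))) ^ 2
        = if w i ≠ 0 then qchar p (-1) * (p : ℂ) else (p : ℂ) ^ 2 := by
      intro i
      split_ifs with hi
      · rw [sum_addChar_mul_sq hp hψ hi, mul_pow, qchar_sq hi, gaussSum_qchar_sq hp hψ, one_mul]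
      · simp [not_not.1 hi]
    rw [Finset.prod_congr rfl fun i _ => h i, Finset.prod_ite, Finset.prod_const,
      Finset.prod_const, mul_pow, ← pow_mul, mul_assoc, ← pow_add]
    congr 2
    have := Finset.card_filter_add_card_filter_not (s := Finset.univ) fun i => w i ≠ 0
    rw [Finset.card_univ] at this
    change _ + 2 * _ = _ - (Finset.univ.filter fun i => w i ≠ 0).card
    omega
  · rw [key, key1]
    have h : ∀ i, ∑ y, ψ (t * w i * (y * y))
        = (if w i ≠ 0 then qchar p t else 1) * ∑ y, ψ (w i * (y * y)) := by
      intro i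
      split_ifs with hi
      · rw [sum_addChar_mul_sq hp hψ hi, sum_addChar_mul_sq hp hψ (mul_ne_zero ht hi), map_mul,
          mul_assoc]
      · simp [not_not.1 hi]
    rw [Finset.prod_congr rfl fun i _ => h i, Finset.prod_mul_distrib, Finset.prod_ite]
    simp [N]

/-- Gauss sums of a quadratic form over a prime field of odd order. -/
theorem gauss_quadraticForm (hp : Odd p) (hψ : ψ.IsPrimitive) {V : Type} [AddCommGroup V]
    [Module (ZMod p) V] [Fintype V] (Q : QuadraticForm (ZMod p) V) :
    ∃ r ≤ Module.finrank (ZMod p) V,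
      (∑ x, ψ (Q x)) ^ 2
        = qchar p (-1) ^ r * (p : ℂ) ^ (2 * Module.finrank (ZMod p) V - r) ∧
      ∀ t ≠ 0, ∑ x, ψ (t * Q x) = qchar p t ^ r * ∑ x, ψ (Q x) := by
  have : Invertible (2 : ZMod p) := invertibleOfNonzero (Ring.two_ne_zero (ringChar_ne_two hp))
  obtain ⟨w, ⟨e⟩⟩ := Q.equivalent_weightedSumSquares
  obtain ⟨r, hr, h1, h2⟩ := gauss_weighted hp hψ w
  have h : ∀ t, ∑ x, ψ (t * Q x)
      = ∑ x : Fin (Module.finrank (ZMod p) V) → ZMod p, ψ (t * ∑ i, w i * (x i * x i)) := by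
    intro t
    refine Fintype.sum_equiv e.toLinearEquiv.toEquiv _ _ fun x => ?_
    have := e.map_app x
    rw [← this, QuadraticMap.weightedSumSquares_apply]
    simp
  have h' := h 1
  simp only [one_mul] at h'
  rw [Fintype.card_fin] at hr h1
  refine ⟨r, hr, ?_, fun t ht => ?_⟩
  · rw [h', h1]
  · rw [h, h', h2 t ht]

end GaussSums

section FiniteField

variable {p s l : ℕ} [Fact p.Prime] {F : Type} [Field F] [CharP F p]

theorem add_pow_pow (x y : F) (n : ℕ) : (x + y) ^ p ^ n = x ^ p ^ n + y ^ p ^ n :=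
  add_pow_char_pow x y p n

theorem neg_pow_pow (x : F) (n : ℕ) : (-x) ^ p ^ n = -x ^ p ^ n := by
  have h := add_pow_pow (p := p) x (-x) n
  rw [add_neg_cancel, zero_pow (pow_ne_zero _ (Fact.out : p.Prime).ne_zero)] at h
  exact eq_neg_of_add_eq_zero_right h.symm

theorem sub_pow_pow (x y : F) (n : ℕ) : (x - y) ^ p ^ n = x ^ p ^ n - y ^ p ^ n := by
  rw [sub_eq_add_neg, add_pow_pow, neg_pow_pow, sub_eq_add_neg]

theorem two_ne_zero_of_odd (hp : Odd p) : (2 : F) ≠ 0 := by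
  refine Ring.two_ne_zero ?_
  rw [ringChar.eq F p]
  rintro rfl
  exact absurd hp (by decide)

theorem two_pow_pow (n : ℕ) : (2 : F) ^ p ^ n = 2 := by
  rw [← one_add_one_eq_two, add_pow_pow, one_pow]

theorem inv_two_pow_pow (n : ℕ) : (2⁻¹ : F) ^ p ^ n = 2⁻¹ := by
  rw [inv_pow, two_pow_pow]

theorem pow_pow_mul_left {x : F} {n : ℕ} (h : x ^ p ^ n = x) (j : ℕ) : x ^ p ^ (n * j) = x := by
  induction j with
  | zero => simp
  | succ j ih => rw [Nat.mul_succ, pow_add, pow_mul, ih, h]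

theorem pow_pow_of_dvd {x : F} {n m : ℕ} (h : x ^ p ^ n = x) (hnm : n ∣ m) : x ^ p ^ m = x := by
  obtain ⟨j, rfl⟩ := hnm
  exact pow_pow_mul_left h j

theorem pow_pow_gcd {x : F} {m n : ℕ} (hm : x ^ p ^ m = x) (hn : x ^ p ^ n = x) :
    x ^ p ^ Nat.gcd m n = x := by
  have h : ∀ j, Function.IsPeriodicPt (fun y : F => y ^ p) j x ↔ x ^ p ^ j = x := by
    intro j
    rw [Function.IsPeriodicPt, pow_iterate]
    rfl
  rw [← h] at *
  exact hm.gcd hn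

variable [Fintype F]

theorem pow_pow_card (hF : Fintype.card F = p ^ (2 * s)) (x : F) : x ^ p ^ (2 * s) = x := by
  rw [← hF, FiniteField.pow_card]

theorem pow_pow_pow_self (hF : Fintype.card F = p ^ (2 * s)) (x : F) :
    (x ^ p ^ s) ^ p ^ s = x := by
  rw [← pow_mul, ← pow_add, ← two_mul, pow_pow_card hF]

theorem pow_pow_sub (hF : Fintype.card F = p ^ (2 * s)) (hl : l ≤ 2 * s - 1) (x : F) :
    (x ^ p ^ l) ^ p ^ (2 * s - l) = x := by
  rw [← pow_mul, ← pow_add, show l + (2 * s - l) = 2 * s by omega, pow_pow_card hF]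

theorem pow_sub_pow_pow (hF : Fintype.card F = p ^ (2 * s)) (hl : l ≤ 2 * s - 1) (x : F) :
    (x ^ p ^ (2 * s - l)) ^ p ^ l = x := by
  rw [← pow_mul, ← pow_add, show (2 * s - l) + l = 2 * s by omega, pow_pow_card hF]

variable [DecidableEq F]

/-- The elements of `F` fixed by `x ↦ x ^ p ^ n`. -/
def fixedElts (p n : ℕ) (F : Type) [Field F] [Fintype F] [DecidableEq F] : Finset F :=
  Finset.univ.filter fun x => x ^ p ^ n = x

theorem mem_fixedElts {n : ℕ} {x : F} : x ∈ fixedElts p n F ↔ x ^ p ^ n = x := by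
  simp [fixedElts]

theorem card_fixedElts (hF : Fintype.card F = p ^ (2 * s)) {n : ℕ} (hn : n ∣ 2 * s) :
    (fixedElts p n F).card = p ^ n := by
  have hp1 : 1 < p := (Fact.out : p.Prime).one_lt
  have h1 : 1 ≤ p ^ n := Nat.one_le_pow _ _ (by omega)
  have hk := IsCyclic.card_powMonoidHom_ker Fˣ (p ^ n - 1)
  rw [Nat.card_eq_fintype_card (α := Fˣ), Fintype.card_units, hF,
    Nat.gcd_eq_right (Nat.pow_sub_one_dvd_pow_sub_one _ hn)] at hk
  have h0 : (0 : F) ∈ fixedElts p n F := by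
    rw [mem_fixedElts, zero_pow (by omega)]
  rw [← Finset.card_erase_add_one h0]
  have : ((fixedElts p n F).erase 0).card = p ^ n - 1 := by
    rw [← hk, ← Nat.card_eq_finsetCard]
    have hmap : ∀ x : (powMonoidHom (p ^ n - 1) : Fˣ →* Fˣ).ker,
        (x.1 : F) ∈ (fixedElts p n F).erase 0 := by
      intro x
      have hx : (x.1 : Fˣ) ^ (p ^ n - 1) = 1 := x.2
      refine Finset.mem_erase.2 ⟨x.1.ne_zero, mem_fixedElts.2 ?_⟩
      have : ((x.1 : Fˣ) : F) ^ (p ^ n - 1) = 1 := by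
        rw [← Units.val_pow_eq_pow_val, hx, Units.val_one]
      calc ((x.1 : Fˣ) : F) ^ p ^ n = ((x.1 : Fˣ) : F) ^ (p ^ n - 1 + 1) := by
            rw [Nat.sub_add_cancel h1]
        _ = _ := by rw [pow_succ, this, one_mul]
    refine (Nat.card_congr (Equiv.ofBijective
      (fun x => (⟨(x.1 : F), hmap x⟩ : ((fixedElts p n F).erase 0 : Finset F))) ⟨?_, ?_⟩)).symm
    · intro x y hxy
      exact Subtype.ext (Units.ext (congrArg Subtype.val hxy))
    · rintro ⟨y, hy⟩
      obtain ⟨hy0, hy⟩ := Finset.mem_erase.1 hy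
      rw [mem_fixedElts] at hy
      refine ⟨⟨Units.mk0 y hy0, ?_⟩, rfl⟩
      change (Units.mk0 y hy0) ^ (p ^ n - 1) = 1
      ext
      have : y ^ (p ^ n - 1) * y = 1 * y := by
        rw [← pow_succ, Nat.sub_add_cancel h1, hy, one_mul]
      simpa using mul_right_cancel₀ hy0 this
  omega

variable [Algebra (ZMod p) F]

theorem trace_pow_pow (x : F) (n : ℕ) :
    Algebra.trace (ZMod p) F (x ^ p ^ n) = Algebra.trace (ZMod p) F x := by
  have h : ∀ y : F, Algebra.trace (ZMod p) F (y ^ p) = Algebra.trace (ZMod p) F y := by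
    intro y
    have := Algebra.trace_eq_of_algEquiv (FiniteField.frobeniusAlgEquivOfAlgebraic (ZMod p) F) y
    rw [FiniteField.coe_frobeniusAlgEquivOfAlgebraic, ZMod.card] at this
    exact this
  induction n with
  | zero => simp
  | succ n ih => rw [pow_succ, pow_mul, h, ih]

/-- The canonical additive character of a finite field of characteristic `p`. -/
noncomputable def traceChar (p : ℕ) [Fact p.Prime] (F : Type) [Field F] [Algebra (ZMod p) F] :
    AddChar F ℂ :=
  (ZMod.stdAddChar (N := p)).compAddMonoidHom (Algebra.trace (ZMod p) F).toAddMonoidHom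

theorem traceChar_apply (x : F) :
    traceChar p F x = ZMod.stdAddChar (Algebra.trace (ZMod p) F x) := rfl

theorem traceChar_pow_pow (x : F) (n : ℕ) : traceChar p F (x ^ p ^ n) = traceChar p F x := by
  rw [traceChar_apply, trace_pow_pow, traceChar_apply]

theorem traceChar_eq_one_iff (x : F) :
    traceChar p F x = 1 ↔ Algebra.trace (ZMod p) F x = 0 := by
  rw [traceChar_apply, ← AddChar.map_zero_eq_one (ZMod.stdAddChar (N := p))]
  exact ZMod.injective_stdAddChar.eq_iff

theorem eq_zero_of_trace_mul {c : F} (h : ∀ x, Algebra.trace (ZMod p) F (c * x) = 0) : c = 0 :=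
  (traceForm_nondegenerate (ZMod p) F).1 c fun x => by rw [Algebra.traceForm_apply, h]

theorem sum_traceChar_mul (hF : Fintype.card F = p ^ (2 * s)) (c : F) :
    ∑ x, traceChar p F (c * x) = if c = 0 then (p : ℂ) ^ (2 * s) else 0 := by
  have hprim : (traceChar p F).IsPrimitive := by
    intro a ha h1
    refine ha (eq_zero_of_trace_mul (p := p) fun x => ?_)
    rw [← traceChar_eq_one_iff, ← AddChar.mulShift_apply, h1, AddChar.one_apply]
  have h := AddChar.sum_mulShift c hprim
  simp only [mul_comm _ c] at h
  rw [h, hF]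
  split_ifs <;> simp

/-- A nontrivial character has vanishing sum over an additively closed set. -/
theorem sum_eq_zero_of_mem {S : Finset F} (φ : AddChar F ℂ) {u : F} (hu : φ u ≠ 1)
    (hS : ∀ x ∈ S, x + u ∈ S) (hS' : ∀ x ∈ S, x - u ∈ S) : ∑ x ∈ S, φ x = 0 := by
  have h : ∑ x ∈ S, φ x = ∑ x ∈ S, φ (x + u) :=
    (Finset.sum_bij' (fun x _ => x + u) (fun x _ => x - u) hS hS' (by simp) (by simp)
      (by simp)).symm
  simp only [φ.map_add_eq_mul, ← Finset.sum_mul] at h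
  have h2 : (∑ x ∈ S, φ x) * (φ u - 1) = 0 := by rw [mul_sub, ← h]; ring
  exact (mul_eq_zero.1 h2).resolve_right (sub_ne_zero.2 hu)

theorem sum_fixedElts_eq_zero {n : ℕ} (β : F) {u : F} (hu : u ∈ fixedElts p n F)
    (h : traceChar p F (β * u) ≠ 1) : ∑ x ∈ fixedElts p n F, traceChar p F (β * x) = 0 := by
  have := sum_eq_zero_of_mem (S := fixedElts p n F) ((traceChar p F).mulShift β) (u := u)
    (by simpa [AddChar.mulShift_apply] using h)
    (fun x hx => by rw [mem_fixedElts] at *; rw [add_pow_pow, hx, hu])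
    (fun x hx => by rw [mem_fixedElts] at *; rw [sub_pow_pow, hx, hu])
  simpa [AddChar.mulShift_apply] using this

theorem sum_fixedElts_half (hp : Odd p) (hF : Fintype.card F = p ^ (2 * s)) {w : F}
    (hw : w ^ p ^ s = w) :
    ∑ x ∈ fixedElts p s F, traceChar p F (w * x) = if w = 0 then (p : ℂ) ^ s else 0 := by
  split_ifs with h0
  · simp [h0, card_fixedElts hF (Dvd.intro_left 2 rfl)]
  · by_cases h : ∃ u ∈ fixedElts p s F, traceChar p F (w * u) ≠ 1
    · obtain ⟨u, hu, h⟩ := h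
      exact sum_fixedElts_eq_zero w hu h
    · exfalso
      push Not at h
      refine one_ne_zero (α := F) (eq_zero_of_trace_mul (p := p) fun x => ?_)
      have h1 := h (w⁻¹ * (x + x ^ p ^ s)) (by
        rw [mem_fixedElts, mul_pow, inv_pow, hw, add_pow_pow, pow_pow_pow_self hF, add_comm x])
      rw [traceChar_eq_one_iff, mul_inv_cancel_left₀ h0, map_add, trace_pow_pow, ← two_mul] at h1
      rw [one_mul]
      exact (mul_eq_zero.1 h1).resolve_left (two_ne_zero_of_odd hp)

end FiniteField

section QuadraticForms

variable {p s l : ℕ} [Fact p.Prime] {F : Type} [Field F] [Fintype F] [DecidableEq F] [CharP F p]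
  [Algebra (ZMod p) F] {a b : F}

/-- The polynomial whose trace is the quadratic part of a codeword. -/
def quadPart (p s l : ℕ) {F : Type} [Field F] (a b x : F) : F :=
  2⁻¹ * a * x ^ (p ^ s + 1) + b * x ^ (p ^ l + 1)

/-- The linearized polynomial of the polar form of `quadPart`. -/
def polarMap (p s l : ℕ) {F : Type} [Field F] (a b x : F) : F :=
  a * x ^ p ^ s + b * x ^ p ^ l + (b * x) ^ p ^ (2 * s - l)

theorem polarMap_add (x y : F) :
    polarMap p s l a b (x + y) = polarMap p s l a b x + polarMap p s l a b y := by
  simp only [polarMap, mul_add, add_pow_pow]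
  ring

theorem smul_pow_pow (t : ZMod p) (x : F) (n : ℕ) : (t • x) ^ p ^ n = t • x ^ p ^ n := by
  rw [smul_pow, ZMod.pow_card_pow]

theorem polarMap_smul (t : ZMod p) (x : F) :
    polarMap p s l a b (t • x) = t • polarMap p s l a b x := by
  simp only [polarMap, mul_smul_comm, smul_pow_pow, smul_add]

theorem quadPart_smul (t : ZMod p) (x : F) :
    quadPart p s l a b (t • x) = (t * t) • quadPart p s l a b x := by
  simp only [quadPart, pow_succ _ (p ^ _), smul_pow_pow, smul_add, mul_smul_comm, smul_mul_assoc,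
    smul_smul]

theorem trace_quadPart_add (hp : Odd p) (hF : Fintype.card F = p ^ (2 * s))
    (hl : l ≤ 2 * s - 1) (ha : a ^ p ^ s = a) (x y : F) :
    Algebra.trace (ZMod p) F (quadPart p s l a b (x + y))
      = Algebra.trace (ZMod p) F (quadPart p s l a b x)
        + Algebra.trace (ZMod p) F (quadPart p s l a b y)
        + Algebra.trace (ZMod p) F (y * polarMap p s l a b x) := by
  have h1 : Algebra.trace (ZMod p) F (2⁻¹ * a * (x * y ^ p ^ s))
      = Algebra.trace (ZMod p) F (2⁻¹ * a * (x ^ p ^ s * y)) := by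
    rw [← trace_pow_pow _ s, mul_pow, mul_pow, mul_pow, inv_two_pow_pow, ha,
      pow_pow_pow_self hF]
  have h2 : Algebra.trace (ZMod p) F (b * (x * y ^ p ^ l))
      = Algebra.trace (ZMod p) F ((b * x) ^ p ^ (2 * s - l) * y) := by
    rw [← trace_pow_pow _ (2 * s - l), ← mul_assoc, mul_pow, pow_pow_sub hF hl]
  have e1 : quadPart p s l a b (x + y) = quadPart p s l a b x + quadPart p s l a b y
      + 2⁻¹ * a * (x ^ p ^ s * y) + 2⁻¹ * a * (x * y ^ p ^ s)
      + b * (x ^ p ^ l * y) + b * (x * y ^ p ^ l) := by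
    simp only [quadPart, pow_succ _ (p ^ _), add_pow_pow]
    ring
  have e2 : y * polarMap p s l a b x = 2⁻¹ * a * (x ^ p ^ s * y) + 2⁻¹ * a * (x ^ p ^ s * y)
      + b * (x ^ p ^ l * y) + (b * x) ^ p ^ (2 * s - l) * y := by
    have h2 := two_ne_zero_of_odd (F := F) hp
    rw [polarMap]
    field_simp
    ring
  rw [e1, e2]
  simp only [map_add, h1, h2]
  ring

/-- The quadratic part of a codeword as a quadratic form over the prime field. -/
noncomputable def quadForm (hp : Odd p) (hF : Fintype.card F = p ^ (2 * s))
    (hl : l ≤ 2 * s - 1) (ha : a ^ p ^ s = a) (b : F) : QuadraticForm (ZMod p) F :=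
  QuadraticMap.ofPolar (fun x => Algebra.trace (ZMod p) F (quadPart p s l a b x))
    (fun t x => by rw [quadPart_smul, map_smul])
    (fun x x' y => by
      simp only [QuadraticMap.polar, trace_quadPart_add hp hF hl ha _ y, polarMap_add, mul_add,
        map_add]
      ring)
    (fun t x y => by
      simp only [QuadraticMap.polar, trace_quadPart_add hp hF hl ha _ y, polarMap_smul,
        mul_smul_comm, map_smul, smul_eq_mul]
      ring)

/-- The exponential sum of the quadratic part of a codeword. -/
noncomputable def expSum (p s l : ℕ) [Fact p.Prime] {F : Type} [Field F] [Fintype F]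
    [Algebra (ZMod p) F] (a b : F) : ℂ :=
  ∑ x, traceChar p F (quadPart p s l a b x)

/-- The radical of the quadratic part of a codeword. -/
def radical (p s l : ℕ) {F : Type} [Field F] [Fintype F] [DecidableEq F] (a b : F) : Finset F :=
  Finset.univ.filter fun x => polarMap p s l a b x = 0

theorem trace_quadPart_radical (hp : Odd p) (hF : Fintype.card F = p ^ (2 * s))
    (hl : l ≤ 2 * s - 1) (ha : a ^ p ^ s = a) {u : F} (hu : polarMap p s l a b u = 0) :
    Algebra.trace (ZMod p) F (quadPart p s l a b u) = 0 := by
  have h := trace_quadPart_add hp hF hl ha (b := b) u u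
  have h4 := quadPart_smul (p := p) (s := s) (l := l) (a := a) (b := b) 2 u
  rw [two_smul] at h4
  rw [hu, h4, map_smul, mul_zero, map_zero, smul_eq_mul] at h
  have h2 : 2 * Algebra.trace (ZMod p) F (quadPart p s l a b u) = 0 := by linear_combination h
  exact (mul_eq_zero.1 h2).resolve_left (two_ne_zero_of_odd hp)

theorem expSum_mul_conj (hp : Odd p) (hF : Fintype.card F = p ^ (2 * s))
    (hl : l ≤ 2 * s - 1) (ha : a ^ p ^ s = a) :
    expSum p s l a b * ∑ x, traceChar p F (-quadPart p s l a b x)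
      = (p : ℂ) ^ (2 * s) * (radical p s l a b).card := by
  rw [expSum, Finset.sum_mul_sum, Finset.sum_comm]
  have h : ∀ y : F, ∑ x, traceChar p F (quadPart p s l a b x)
        * traceChar p F (-quadPart p s l a b y)
      = ∑ u, traceChar p F (quadPart p s l a b u) * traceChar p F (polarMap p s l a b u * y) := by
    intro y
    rw [← Equiv.sum_comp (Equiv.addRight y)]
    refine Finset.sum_congr rfl fun u _ => ?_
    rw [Equiv.coe_addRight, traceChar_apply (quadPart p s l a b (u + y)),
      trace_quadPart_add hp hF hl ha, AddChar.map_add_eq_mul, AddChar.map_add_eq_mul,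
      ← traceChar_apply, ← traceChar_apply, ← traceChar_apply, mul_comm y]
    have h1 : traceChar p F (quadPart p s l a b y) * traceChar p F (-quadPart p s l a b y) = 1 := by
      rw [← AddChar.map_add_eq_mul, add_neg_cancel, AddChar.map_zero_eq_one]
    linear_combination (traceChar p F (quadPart p s l a b u) *
      traceChar p F (polarMap p s l a b u * y)) * h1
  simp only [h]
  rw [Finset.sum_comm]
  simp only [← Finset.mul_sum, sum_traceChar_mul hF]
  rw [radical, ← Finset.sum_filter_add_sum_filter_not _ (fun u => polarMap p s l a b u = 0),
    Finset.sum_congr rfl (g := fun _ => (p : ℂ) ^ (2 * s)), Finset.sum_const, nsmul_eq_mul,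
    Finset.sum_eq_zero, add_zero, mul_comm]
  · intro u hu
    rw [if_neg (Finset.mem_filter.1 hu).2, mul_zero]
  · intro u hu
    have hu := (Finset.mem_filter.1 hu).2
    rw [if_pos hu, (traceChar_eq_one_iff _).2 (trace_quadPart_radical hp hF hl ha hu), one_mul]

theorem finrank_eq (hF : Fintype.card F = p ^ (2 * s)) : Module.finrank (ZMod p) F = 2 * s := by
  have h := Module.card_eq_pow_finrank (K := ZMod p) (V := F)
  rw [hF, ZMod.card] at h
  exact (Nat.pow_right_injective (Fact.out : p.Prime).two_le h).symm

/-- The exponential sums attached to `quadPart`, in terms of the rank `r`. -/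
theorem exists_rank (hp : Odd p) (hF : Fintype.card F = p ^ (2 * s))
    (hl : l ≤ 2 * s - 1) (ha : a ^ p ^ s = a) (b : F) :
    ∃ r ≤ 2 * s, expSum p s l a b ^ 2 = qchar p (-1) ^ r * (p : ℂ) ^ (4 * s - r) ∧
      (∀ t ≠ 0, ∑ x, ZMod.stdAddChar (t * Algebra.trace (ZMod p) F (quadPart p s l a b x))
        = qchar p t ^ r * expSum p s l a b) ∧
      (radical p s l a b).card = p ^ (2 * s - r) := by
  obtain ⟨r, hr, h1, h2⟩ := gauss_quadraticForm hp (ZMod.isPrimitive_stdAddChar p)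
    (quadForm hp hF hl ha b)
  rw [finrank_eq hF] at hr h1
  change expSum p s l a b ^ 2 = _ at h1
  change ∀ t ≠ 0, _ = qchar p t ^ r * expSum p s l a b at h2
  rw [← mul_assoc] at h1
  refine ⟨r, hr, h1, h2, ?_⟩
  have h3 := expSum_mul_conj hp hF hl ha (b := b)
  have h4 := h2 (-1) (neg_ne_zero.2 one_ne_zero)
  have h5 : ∑ x, traceChar p F (-quadPart p s l a b x)
      = ∑ x, ZMod.stdAddChar (-1 * quadForm hp hF hl ha b x) := by
    refine Finset.sum_congr rfl fun x _ => ?_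
    rw [traceChar_apply, map_neg, neg_one_mul]
    rfl
  rw [h5, h4, mul_left_comm, ← sq, h1, ← mul_assoc, ← mul_pow, ← sq,
    qchar_sq (neg_ne_zero.2 one_ne_zero), one_pow, one_mul,
    show 2 * 2 * s - r = 2 * s + (2 * s - r) by omega, pow_add] at h3
  have hp0 : (p : ℂ) ^ (2 * s) ≠ 0 :=
    pow_ne_zero _ (Nat.cast_ne_zero.2 (Fact.out : p.Prime).ne_zero)
  exact_mod_cast (mul_left_cancel₀ hp0 h3).symm

end QuadraticForms

section RadicalStructure

variable {p s l d : ℕ} [Fact p.Prime] {F : Type} [Field F] [Fintype F] [DecidableEq F] [CharP F p]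
  [Algebra (ZMod p) F] {a b : F}

theorem expSum_eq_or_eq_neg (hp : Odd p) (hF : Fintype.card F = p ^ (2 * s))
    (hl : l ≤ 2 * s - 1) (ha : a ^ p ^ s = a) (hr : (radical p s l a b).card = 1) :
    expSum p s l a b = (p : ℂ) ^ s ∨ expSum p s l a b = -(p : ℂ) ^ s := by
  obtain ⟨r, hr2, h1, -, h3⟩ := exists_rank hp hF hl ha b
  rw [hr] at h3
  have h0 : 2 * s - r = 0 := by
    by_contra h
    exact (Nat.one_lt_pow h (Fact.out : p.Prime).one_lt).ne h3
  have h4 : r = 2 * s := by omega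
  rw [h4, pow_mul, qchar_sq (neg_ne_zero.2 one_ne_zero), one_pow, one_mul,
    show 4 * s - 2 * s = s * 2 by omega, pow_mul] at h1
  exact sq_eq_sq_iff_eq_or_eq_neg.1 h1

theorem card_radical_of_expSum (hp : Odd p) (hF : Fintype.card F = p ^ (2 * s))
    (hl : l ≤ 2 * s - 1) (ha : a ^ p ^ s = a) (h : expSum p s l a b = (p : ℂ) ^ s) :
    (radical p s l a b).card = 1 := by
  obtain ⟨r, hr2, h1, -, h3⟩ := exists_rank hp hF hl ha b
  have h5 : ((p : ℂ) ^ s) ^ 4 = ((p : ℂ) ^ (4 * s - r)) ^ 2 := by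
    have := congrArg (fun z : ℂ => z ^ 2) h1
    simp only [mul_pow, ← pow_mul, mul_comm r 2] at this
    rw [pow_mul (qchar p (-1)) 2 r, qchar_sq (neg_ne_zero.2 one_ne_zero), one_pow, one_mul, h,
      ← pow_mul] at this
    rw [← pow_mul, ← pow_mul, ← this]
  rw [← pow_mul, ← pow_mul] at h5
  have h6 : p ^ (s * 4) = p ^ ((4 * s - r) * 2) := by exact_mod_cast h5
  have h7 := Nat.pow_right_injective (Fact.out : p.Prime).two_le h6
  rw [h3, show 2 * s - r = 0 by omega, pow_zero]

theorem expSum_norm (hp : Odd p) (hF : Fintype.card F = p ^ (2 * s))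
    (hl : l ≤ 2 * s - 1) (ha : a ^ p ^ s = a) (ha0 : a ≠ 0) :
    expSum p s l a 0 = -(p : ℂ) ^ s := by
  have hs : ∀ β ∈ (fixedElts p s F).erase 0,
      expSum p s l β 0 = (p : ℂ) ^ s ∨ expSum p s l β 0 = -(p : ℂ) ^ s := by
    intro β hβ
    obtain ⟨h0, hβ⟩ := Finset.mem_erase.1 hβ
    refine expSum_eq_or_eq_neg hp hF hl (mem_fixedElts.1 hβ) ?_
    have : radical p s l β 0 = {0} := by
      ext x
      simp [radical, polarMap, h0, (Fact.out : p.Prime).ne_zero]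
    rw [this, Finset.card_singleton]
  have hk : (0 : F) ∈ fixedElts p s F := by
    rw [mem_fixedElts, zero_pow (pow_ne_zero _ (Fact.out : p.Prime).ne_zero)]
  have hsum : ∑ β ∈ fixedElts p s F, expSum p s l β 0 = (p : ℂ) ^ s := by
    simp only [expSum]
    rw [Finset.sum_comm, Finset.sum_eq_single 0]
    · have h0 : p ^ s ≠ 0 := pow_ne_zero _ (Fact.out : p.Prime).ne_zero
      simp [quadPart, card_fixedElts hF (Dvd.intro_left 2 rfl)]
    · intro x _ hx
      have h1 := sum_fixedElts_half hp hF (w := 2⁻¹ * x ^ (p ^ s + 1)) (by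
        rw [mul_pow, inv_two_pow_pow, ← pow_mul, add_mul, one_mul, pow_add, pow_mul,
          pow_pow_pow_self hF, pow_succ, mul_comm x])
      rw [if_neg (mul_ne_zero (inv_ne_zero (two_ne_zero_of_odd hp)) (pow_ne_zero _ hx))] at h1
      rw [← h1]
      refine Finset.sum_congr rfl fun β _ => ?_
      rw [quadPart]
      congr 1
      ring
    · simp
  have hsum' : ∑ β ∈ (fixedElts p s F).erase 0, (expSum p s l β 0 + (p : ℂ) ^ s) = 0 := by
    rw [Finset.sum_erase_eq_sub hk, Finset.sum_add_distrib, hsum, Finset.sum_const,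
      card_fixedElts hF (Dvd.intro_left 2 rfl), nsmul_eq_mul]
    have : expSum p s l (0 : F) 0 = (p : ℂ) ^ (2 * s) := by
      simp [expSum, quadPart, hF]
    rw [this]
    push_cast
    ring
  have hpos : (0 : ℝ) < (p : ℝ) ^ s := pow_pos (Nat.cast_pos.2 (Fact.out : p.Prime).pos) _
  have hre := congrArg Complex.re hsum'
  rw [Complex.re_sum, Complex.zero_re, Finset.sum_eq_zero_iff_of_nonneg] at hre
  · have ham : a ∈ (fixedElts p s F).erase 0 := Finset.mem_erase.2 ⟨ha0, mem_fixedElts.2 ha⟩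
    refine (hs a ham).resolve_left fun h => ?_
    have := hre a ham
    rw [h, ← Complex.ofReal_natCast, ← Complex.ofReal_pow, ← Complex.ofReal_add,
      Complex.ofReal_re] at this
    linarith
  · intro β hβ
    rcases hs β hβ with h | h
    · rw [h, ← Complex.ofReal_natCast, ← Complex.ofReal_pow, ← Complex.ofReal_add,
        Complex.ofReal_re]
      linarith
    · rw [h]
      simp

theorem quadPart_scale (z x : F) :
    quadPart p s l (a * z ^ (p ^ s + 1)) (b * z ^ (p ^ l + 1)) x = quadPart p s l a b (z * x) := by
  simp only [quadPart, mul_pow]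
  ring

theorem polarMap_scale (hF : Fintype.card F = p ^ (2 * s)) (hl : l ≤ 2 * s - 1) (z x : F) :
    polarMap p s l (a * z ^ (p ^ s + 1)) (b * z ^ (p ^ l + 1)) x
      = z * polarMap p s l a b (z * x) := by
  simp only [polarMap, mul_pow, pow_succ z, pow_pow_sub hF hl]
  ring

theorem expSum_scale {z : F} (hz : z ≠ 0) :
    expSum p s l (a * z ^ (p ^ s + 1)) (b * z ^ (p ^ l + 1)) = expSum p s l a b := by
  simp only [expSum, quadPart_scale]
  exact Equiv.sum_comp (Equiv.mulLeft₀ z hz) fun x => traceChar p F (quadPart p s l a b x)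

theorem card_radical_scale (hF : Fintype.card F = p ^ (2 * s)) (hl : l ≤ 2 * s - 1) {z : F}
    (hz : z ≠ 0) :
    (radical p s l (a * z ^ (p ^ s + 1)) (b * z ^ (p ^ l + 1))).card
      = (radical p s l a b).card := by
  refine Finset.card_bijective (Equiv.mulLeft₀ z hz) (Equiv.bijective _) fun x => ?_
  simp [radical, polarMap_scale hF hl, hz]

theorem mem_fixedElts_of_pow (hF : Fintype.card F = p ^ (2 * s))
    (hd' : Nat.gcd (s + l) (2 * l) = d) {x : F} (hx : x ^ p ^ (s + l) = x) : x ^ p ^ d = x := by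
  refine pow_pow_of_dvd (pow_pow_gcd hx (pow_pow_card hF x)) ?_
  rw [← hd']
  refine Nat.dvd_gcd (Nat.gcd_dvd_left _ _) ?_
  have h1 : Nat.gcd (s + l) (2 * s) ∣ 2 * s + 2 * l := by
    rw [← mul_add]
    exact Dvd.dvd.mul_left (Nat.gcd_dvd_left _ _) 2
  exact (Nat.dvd_add_right (Nat.gcd_dvd_right _ _)).1 h1

/-- The coefficients of the quadratic parts whose radical contains `1`. -/
theorem polarMap_one_eq_zero (hp : Odd p) (hF : Fintype.card F = p ^ (2 * s))
    (hl : l ≤ 2 * s - 1) (hds : d ∣ s) (hd' : Nat.gcd (s + l) (2 * l) = d)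
    (ha : a ^ p ^ s = a) :
    polarMap p s l a b 1 = 0 ↔ b ^ p ^ s = b ∧ a = -(b + b ^ p ^ (2 * s - l)) := by
  simp only [polarMap, one_pow, mul_one]
  refine ⟨fun h => ?_, fun ⟨_, h⟩ => by rw [h]; ring⟩
  have ha' : a = -(b + b ^ p ^ (2 * s - l)) := by linear_combination h
  refine ⟨?_, ha'⟩
  set e := b - b ^ p ^ s with he
  have h1 : e ^ p ^ s = -e := by
    rw [he, sub_pow_pow, pow_pow_pow_self hF]
    ring
  have h2 : e + e ^ p ^ (2 * s - l) = 0 := by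
    rw [ha', neg_pow_pow, add_pow_pow, ← pow_mul, mul_comm, pow_mul] at ha
    rw [he, sub_pow_pow]
    linear_combination ha
  have h3 : e ^ p ^ l = -e := by
    have := congrArg (fun z => z ^ p ^ l) h2
    simp only [add_pow_pow, pow_sub_pow_pow hF hl] at this
    rw [zero_pow (pow_ne_zero _ (Fact.out : p.Prime).ne_zero)] at this
    linear_combination this
  have h4 : e ^ p ^ (s + l) = e := by
    rw [pow_add, pow_mul, h1, neg_pow_pow, h3, neg_neg]
  have h5 := pow_pow_of_dvd (mem_fixedElts_of_pow hF hd' h4) hds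
  rw [h1] at h5
  have h6 : 2 * e = 0 := by linear_combination -h5
  have h7 := (mul_eq_zero.1 h6).resolve_left (two_ne_zero_of_odd hp)
  exact (sub_eq_zero.1 h7).symm

/-- The kernel of the adjoint of `x ↦ x ^ p ^ l - x ^ p ^ s` is the field of order `p ^ d`. -/
theorem sum_comp_sub_pow (hF : Fintype.card F = p ^ (2 * s)) (hl : l ≤ 2 * s - 1)
    (hds : d ∣ s) (hdl : d ∣ l) (hd' : Nat.gcd (s + l) (2 * l) = d) (G : F → ℂ) :
    ∑ x, G (x ^ p ^ l - x ^ p ^ s)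
      = ∑ u ∈ fixedElts p d F, ∑ y, G y * traceChar p F (u * y) := by
  have hp0 : (p : ℂ) ^ (2 * s) ≠ 0 :=
    pow_ne_zero _ (Nat.cast_ne_zero.2 (Fact.out : p.Prime).ne_zero)
  refine mul_left_cancel₀ hp0 ?_
  have key : ∀ u : F, ∑ x, traceChar p F (-u * (x ^ p ^ l - x ^ p ^ s))
      = if u ∈ fixedElts p d F then (p : ℂ) ^ (2 * s) else 0 := by
    intro u
    have h1 : ∀ x : F, traceChar p F (-u * (x ^ p ^ l - x ^ p ^ s))
        = traceChar p F ((u ^ p ^ s - u ^ p ^ (2 * s - l)) * x) := by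
      intro x
      have e1 : traceChar p F (u * x ^ p ^ s) = traceChar p F (u ^ p ^ s * x) := by
        rw [← traceChar_pow_pow _ s, mul_pow, pow_pow_pow_self hF]
      have e2 : traceChar p F (-(u * x ^ p ^ l)) = traceChar p F (-(u ^ p ^ (2 * s - l) * x)) := by
        rw [← traceChar_pow_pow _ (2 * s - l), neg_pow_pow, mul_pow, pow_pow_sub hF hl]
      rw [show -u * (x ^ p ^ l - x ^ p ^ s) = -(u * x ^ p ^ l) + u * x ^ p ^ s by ring,
        AddChar.map_add_eq_mul, e1, e2, ← AddChar.map_add_eq_mul]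
      congr 1
      ring
    simp only [h1, sum_traceChar_mul hF]
    refine if_congr ?_ rfl rfl
    rw [mem_fixedElts, sub_eq_zero]
    constructor
    · intro h
      refine mem_fixedElts_of_pow hF hd' ?_
      rw [pow_add, pow_mul, h, pow_sub_pow_pow hF hl]
    · intro h
      rw [pow_pow_of_dvd h hds,
        pow_pow_of_dvd h (Nat.dvd_sub (Dvd.dvd.mul_left hds 2) hdl)]
  calc (p : ℂ) ^ (2 * s) * ∑ x, G (x ^ p ^ l - x ^ p ^ s)
      = ∑ x, ∑ y, G y * ∑ u, traceChar p F ((y - (x ^ p ^ l - x ^ p ^ s)) * u) := by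
        rw [Finset.mul_sum]
        refine Finset.sum_congr rfl fun x _ => ?_
        simp only [sum_traceChar_mul hF, sub_eq_zero]
        simp [mul_comm]
    _ = ∑ u, (∑ y, G y * traceChar p F (u * y))
          * ∑ x, traceChar p F (-u * (x ^ p ^ l - x ^ p ^ s)) := by
        simp only [Finset.sum_mul, Finset.mul_sum]
        rw [Finset.sum_comm]
        conv_lhs => enter [2, y]; rw [Finset.sum_comm]
        rw [Finset.sum_comm]
        refine Finset.sum_congr rfl fun u _ => ?_
        rw [Finset.sum_comm]
        refine Finset.sum_congr rfl fun y _ => Finset.sum_congr rfl fun x _ => ?_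
        rw [mul_assoc, ← AddChar.map_add_eq_mul]
        congr 2
        ring
    _ = _ := by
        simp only [key, mul_ite, mul_zero]
        rw [Finset.sum_ite_mem, Finset.univ_inter, Finset.mul_sum]
        exact Finset.sum_congr rfl fun u _ => mul_comm _ _

end RadicalStructure

section Counting

variable {p s l d : ℕ} [Fact p.Prime] {F : Type} [Field F] [Fintype F] [DecidableEq F] [CharP F p]
  [Algebra (ZMod p) F] {a b β : F}

/-- The quadratic exponential sum over the subfield of order `p ^ d`. -/
noncomputable def subfieldSum (p d : ℕ) [Fact p.Prime] {F : Type} [Field F] [Fintype F]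
    [DecidableEq F] [Algebra (ZMod p) F] (β : F) : ℂ :=
  ∑ u ∈ fixedElts p d F, traceChar p F (2⁻¹ * (u * u) * β)

theorem zero_mem_fixedElts (n : ℕ) : (0 : F) ∈ fixedElts p n F := by
  rw [mem_fixedElts, zero_pow (pow_ne_zero _ (Fact.out : p.Prime).ne_zero)]

theorem mul_mem_fixedElts {n : ℕ} {x y : F} (hx : x ∈ fixedElts p n F)
    (hy : y ∈ fixedElts p n F) : x * y ∈ fixedElts p n F := by
  rw [mem_fixedElts] at *
  rw [mul_pow, hx, hy]

theorem inv_mem_fixedElts {n : ℕ} {x : F} (hx : x ∈ fixedElts p n F) :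
    x⁻¹ ∈ fixedElts p n F := by
  rw [mem_fixedElts] at *
  rw [inv_pow, hx]

theorem add_mem_fixedElts {n : ℕ} {x y : F} (hx : x ∈ fixedElts p n F)
    (hy : y ∈ fixedElts p n F) : x + y ∈ fixedElts p n F := by
  rw [mem_fixedElts] at *
  rw [add_pow_pow, hx, hy]

theorem sub_mem_fixedElts {n : ℕ} {x y : F} (hx : x ∈ fixedElts p n F)
    (hy : y ∈ fixedElts p n F) : x - y ∈ fixedElts p n F := by
  rw [mem_fixedElts] at *
  rw [sub_pow_pow, hx, hy]

theorem inv_two_mem_fixedElts (n : ℕ) : (2⁻¹ : F) ∈ fixedElts p n F :=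
  mem_fixedElts.2 (inv_two_pow_pow n)

theorem fixedElts_subset {n m : ℕ} (h : n ∣ m) : fixedElts p n F ⊆ fixedElts p m F :=
  fun _ hx => mem_fixedElts.2 (pow_pow_of_dvd (mem_fixedElts.1 hx) h)

theorem expSum_of_polarMap_one (hp : Odd p) (hF : Fintype.card F = p ^ (2 * s))
    (hl : l ≤ 2 * s - 1) (hds : d ∣ s) (hdl : d ∣ l) (hd' : Nat.gcd (s + l) (2 * l) = d)
    (hb : b ^ p ^ s = b) (hb0 : b ≠ 0) :
    expSum p s l (-(b + b ^ p ^ (2 * s - l))) b = -(p : ℂ) ^ s * subfieldSum p d b⁻¹ := by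
  have h2 := two_ne_zero_of_odd (F := F) hp
  have hnb : (-b) ^ p ^ s = -b := by rw [neg_pow_pow, hb]
  have h1 : ∀ x : F, traceChar p F (quadPart p s l (-(b + b ^ p ^ (2 * s - l))) b x)
      = traceChar p F (quadPart p s l (-b) 0 (x ^ p ^ l - x ^ p ^ s)) := by
    intro x
    have e1 : Algebra.trace (ZMod p) F (2⁻¹ * b * (x ^ p ^ s * x) ^ p ^ l)
        = Algebra.trace (ZMod p) F (2⁻¹ * b ^ p ^ (2 * s - l) * (x ^ p ^ s * x)) := by
      rw [← trace_pow_pow _ (2 * s - l), mul_pow, mul_pow _ b, inv_two_pow_pow,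
        pow_pow_sub hF hl]
    have e2 : Algebra.trace (ZMod p) F (2⁻¹ * b * (x ^ p ^ l * x) ^ p ^ s)
        = Algebra.trace (ZMod p) F (2⁻¹ * b * (x ^ p ^ l * x)) := by
      rw [← trace_pow_pow (2⁻¹ * b * (x ^ p ^ l * x)) s, mul_pow (2⁻¹ * b),
        mul_pow 2⁻¹ b, inv_two_pow_pow, hb]
    have e3 : quadPart p s l (-b) 0 (x ^ p ^ l - x ^ p ^ s)
        = -(2⁻¹ * b * (x ^ p ^ s * x) ^ p ^ l) + 2⁻¹ * b * (x ^ p ^ l * x) ^ p ^ s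
          + 2⁻¹ * b * (x ^ p ^ l * x) - 2⁻¹ * b * (x ^ p ^ s * x) := by
      rw [quadPart, pow_succ, sub_pow_pow, pow_pow_pow_self hF, mul_pow, mul_pow,
        pow_right_comm x (p ^ s)]
      ring
    have e4 : quadPart p s l (-(b + b ^ p ^ (2 * s - l))) b x
        = -(2⁻¹ * b ^ p ^ (2 * s - l) * (x ^ p ^ s * x)) + 2⁻¹ * b * (x ^ p ^ l * x)
          + 2⁻¹ * b * (x ^ p ^ l * x) - 2⁻¹ * b * (x ^ p ^ s * x) := by
      rw [quadPart, pow_succ, pow_succ]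
      field_simp
      ring
    rw [traceChar_apply, traceChar_apply, e3, e4]
    simp only [map_sub, map_add, map_neg, e1, e2]
  have h3 : ∀ u ∈ fixedElts p d F, ∑ y, traceChar p F (quadPart p s l (-b) 0 y)
      * traceChar p F (u * y)
      = -(p : ℂ) ^ s * traceChar p F (2⁻¹ * (u * u) * b⁻¹) := by
    intro u hu
    have hu' := mem_fixedElts.1 (fixedElts_subset hds hu)
    rw [← expSum_norm hp hF hl hnb (neg_ne_zero.2 hb0), expSum, Finset.sum_mul,
      ← Equiv.sum_comp (Equiv.addLeft (u * b⁻¹))]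
    refine Finset.sum_congr rfl fun y _ => ?_
    have hv : (u * b⁻¹) ^ p ^ s = u * b⁻¹ := by rw [mul_pow, inv_pow, hu', hb]
    have e1 : polarMap p s l (-b) 0 (u * b⁻¹) = -u := by
      have h0 : p ^ (2 * s - l) ≠ 0 := pow_ne_zero _ (Fact.out : p.Prime).ne_zero
      rw [polarMap, hv, zero_mul, zero_mul, zero_pow h0]
      field_simp
      ring
    have e2 : quadPart p s l (-b) 0 (u * b⁻¹) = 2⁻¹ * (u * u) * b⁻¹ - u * (u * b⁻¹) := by
      rw [quadPart, pow_succ, hv]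
      field_simp
      ring
    rw [Equiv.coe_addLeft, ← AddChar.map_add_eq_mul, ← AddChar.map_add_eq_mul,
      traceChar_apply, traceChar_apply, map_add, trace_quadPart_add hp hF hl hnb, e1, e2,
      ← map_add, ← map_add, ← map_add]
    congr 2
    ring
  rw [expSum, Finset.sum_congr rfl fun x _ => h1 x,
    sum_comp_sub_pow hF hl hds hdl hd' fun y => traceChar p F (quadPart p s l (-b) 0 y),
    Finset.sum_congr rfl h3, ← Finset.mul_sum, subfieldSum]

theorem subfieldSum_of_forall (hF : Fintype.card F = p ^ (2 * s)) (hds : d ∣ s)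
    (h : ∀ u ∈ fixedElts p d F, traceChar p F (u * β) = 1) :
    subfieldSum p d β = (p : ℂ) ^ d := by
  rw [subfieldSum, Finset.sum_congr rfl (g := fun _ => (1 : ℂ)), Finset.sum_const,
    card_fixedElts hF (Dvd.dvd.mul_left hds 2)]
  · simp
  · exact fun u hu => h _ (mul_mem_fixedElts (inv_two_mem_fixedElts d) (mul_mem_fixedElts hu hu))

theorem sum_fixedElts_of_not_forall
    (h : ¬ ∀ u ∈ fixedElts p d F, traceChar p F (u * β) = 1) {w : F}
    (hw : w ∈ fixedElts p d F) (hw0 : w ≠ 0) :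
    ∑ u ∈ fixedElts p d F, traceChar p F (w * β * u) = 0 := by
  push Not at h
  obtain ⟨u, hu, h⟩ := h
  refine sum_fixedElts_eq_zero _ (mul_mem_fixedElts (inv_mem_fixedElts hw) hu) ?_
  convert h using 2
  field_simp

theorem subfieldSum_mul_neg (hp : Odd p) (hF : Fintype.card F = p ^ (2 * s)) (hds : d ∣ s)
    (h : ¬ ∀ u ∈ fixedElts p d F, traceChar p F (u * β) = 1) :
    subfieldSum p d β * subfieldSum p d (-β) = (p : ℂ) ^ d := by
  have h2 := two_ne_zero_of_odd (F := F) hp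
  have key : ∀ v ∈ fixedElts p d F, ∑ u ∈ fixedElts p d F,
      traceChar p F (2⁻¹ * (u * u) * β) * traceChar p F (2⁻¹ * (v * v) * -β)
      = ∑ w ∈ fixedElts p d F, traceChar p F (2⁻¹ * (w * w) * β) * traceChar p F (w * β * v) := by
    intro v hv
    refine Finset.sum_bij' (fun u _ => u - v) (fun w _ => w + v)
      (fun u hu => sub_mem_fixedElts hu hv) (fun w hw => add_mem_fixedElts hw hv)
      (fun u _ => sub_add_cancel u v) (fun w _ => add_sub_cancel_right w v) fun u _ => ?_
    rw [← AddChar.map_add_eq_mul, ← AddChar.map_add_eq_mul]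
    congr 1
    field_simp
    ring
  rw [subfieldSum, subfieldSum, Finset.sum_mul_sum, Finset.sum_comm, Finset.sum_congr rfl key,
    Finset.sum_comm, Finset.sum_eq_single 0]
  · simp [card_fixedElts hF (Dvd.dvd.mul_left hds 2)]
  · intro w hw hw0
    rw [← Finset.mul_sum, sum_fixedElts_of_not_forall h hw hw0, mul_zero]
  · exact fun h => absurd (zero_mem_fixedElts d) h

theorem card_radical_of_polarMap_one (hp : Odd p) (hF : Fintype.card F = p ^ (2 * s))
    (hl : l ≤ 2 * s - 1) (hds : d ∣ s) (hdl : d ∣ l) (hd' : Nat.gcd (s + l) (2 * l) = d)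
    (hb : b ^ p ^ s = b) (hb0 : b ≠ 0) :
    ((radical p s l (-(b + b ^ p ^ (2 * s - l))) b).card : ℂ)
      = subfieldSum p d b⁻¹ * subfieldSum p d (-b⁻¹) := by
  have ha : (-(b + b ^ p ^ (2 * s - l))) ^ p ^ s = -(b + b ^ p ^ (2 * s - l)) := by
    rw [neg_pow_pow, add_pow_pow, pow_right_comm, hb]
  have h1 := expSum_mul_conj hp hF hl ha (b := b)
  have h2 : ∑ x, traceChar p F (-quadPart p s l (-(b + b ^ p ^ (2 * s - l))) b x)
      = expSum p s l (-(-b + (-b) ^ p ^ (2 * s - l))) (-b) := by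
    refine Finset.sum_congr rfl fun x _ => ?_
    rw [neg_pow_pow, quadPart, quadPart]
    congr 1
    ring
  rw [h2, expSum_of_polarMap_one hp hF hl hds hdl hd' hb hb0,
    expSum_of_polarMap_one hp hF hl hds hdl hd' (by rw [neg_pow_pow, hb]) (neg_ne_zero.2 hb0)] at h1
  have hp0 : (p : ℂ) ^ (2 * s) ≠ 0 :=
    pow_ne_zero _ (Nat.cast_ne_zero.2 (Fact.out : p.Prime).ne_zero)
  refine mul_left_cancel₀ hp0 ?_
  rw [← h1, inv_neg]
  ring

end Counting

section CountPositive

variable {p s l d : ℕ} [Fact p.Prime] {F : Type} [Field F] [Fintype F] [DecidableEq F] [CharP F p]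
  [Algebra (ZMod p) F] {a b β : F}

theorem sum_sum_fixedElts (hp : Odd p) (hF : Fintype.card F = p ^ (2 * s))
    {f : F → F} (hf : ∀ u ∈ fixedElts p d F, f u ∈ fixedElts p s F)
    (hf0 : ∀ u, f u = 0 ↔ u = 0) :
    ∑ β ∈ fixedElts p s F, ∑ u ∈ fixedElts p d F, traceChar p F (f u * β) = (p : ℂ) ^ s := by
  rw [Finset.sum_comm, Finset.sum_congr rfl (g := fun u => if u = 0 then (p : ℂ) ^ s else 0)]
  · rw [Finset.sum_ite_eq', if_pos (zero_mem_fixedElts d)]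
  · intro u hu
    rw [sum_fixedElts_half hp hF (mem_fixedElts.1 (hf u hu))]
    exact if_congr (hf0 u) rfl rfl

theorem sum_ratio (hp : Odd p) (hF : Fintype.card F = p ^ (2 * s))
    (hl : l ≤ 2 * s - 1) (hd0 : 0 < d) (hds : d ∣ s) (hdl : d ∣ l)
    (hd' : Nat.gcd (s + l) (2 * l) = d) :
    ((p : ℂ) ^ d + 1) * ∑ b ∈ (fixedElts p s F).erase 0,
      (expSum p s l (-(b + b ^ p ^ (2 * s - l))) b + (p : ℂ) ^ s)
        / ((radical p s l (-(b + b ^ p ^ (2 * s - l))) b).card - 1)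
      = (p : ℂ) ^ s * ((p : ℂ) ^ s + 1) := by
  have h2 := two_ne_zero_of_odd (F := F) hp
  have hP : (p : ℂ) ^ d - 1 ≠ 0 := by
    have := Nat.one_lt_pow hd0.ne' (Fact.out : p.Prime).one_lt
    rw [sub_ne_zero]
    exact_mod_cast this.ne'
  have hP' : (p : ℂ) ^ d + 1 ≠ 0 := by exact_mod_cast (p ^ d).succ_ne_zero
  set X : F → ℂ := fun β => (p : ℂ) ^ s * ((p : ℂ) ^ d + 1) * (1 - subfieldSum p d β)
    + (p : ℂ) ^ s * ((p : ℂ) ^ d - 1) * ∑ u ∈ fixedElts p d F, traceChar p F (u * β) with hX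
  have hT : ∀ β : F, (∀ u ∈ fixedElts p d F, traceChar p F (u * β) = 1) →
      ∑ u ∈ fixedElts p d F, traceChar p F (u * β) = (p : ℂ) ^ d := by
    intro β h
    rw [Finset.sum_congr rfl h, Finset.sum_const, card_fixedElts hF (Dvd.dvd.mul_left hds 2)]
    simp
  have hX0 : X 0 = -((p : ℂ) ^ s * ((p : ℂ) ^ d - 1)) := by
    have h : ∀ u ∈ fixedElts p d F, traceChar p F (u * 0) = 1 := by simp
    simp only [hX, hT 0 h, subfieldSum_of_forall hF hds h]
    ring
  have hXs : ∑ β ∈ fixedElts p s F, X β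
      = (p : ℂ) ^ s * ((p : ℂ) ^ d - 1) * (p : ℂ) ^ s := by
    have h1 := sum_sum_fixedElts (d := d) hp hF (f := fun u => u)
      (fun u hu => fixedElts_subset hds hu)
      fun u => Iff.rfl
    have h3 : ∑ β ∈ fixedElts p s F, subfieldSum p d β = (p : ℂ) ^ s :=
      sum_sum_fixedElts (d := d) hp hF (f := fun u => 2⁻¹ * (u * u))
        (fun u hu => mul_mem_fixedElts (inv_two_mem_fixedElts s)
          (mul_mem_fixedElts (fixedElts_subset hds hu) (fixedElts_subset hds hu)))
        fun u => by simp [h2]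
    simp only [hX, Finset.sum_add_distrib, ← Finset.mul_sum, Finset.sum_sub_distrib]
    rw [h1, h3, Finset.sum_const, card_fixedElts hF (Dvd.intro_left 2 rfl)]
    simp
  have hg : ∀ b ∈ (fixedElts p s F).erase 0,
      (expSum p s l (-(b + b ^ p ^ (2 * s - l))) b + (p : ℂ) ^ s)
        / ((radical p s l (-(b + b ^ p ^ (2 * s - l))) b).card - 1)
      = X b⁻¹ / (((p : ℂ) ^ d + 1) * ((p : ℂ) ^ d - 1)) := by
    intro b hb
    obtain ⟨hb0, hb⟩ := Finset.mem_erase.1 hb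
    have hb := mem_fixedElts.1 hb
    rw [expSum_of_polarMap_one hp hF hl hds hdl hd' hb hb0,
      card_radical_of_polarMap_one hp hF hl hds hdl hd' hb hb0]
    by_cases h : ∀ u ∈ fixedElts p d F, traceChar p F (u * b⁻¹) = 1
    · have h' : ∀ u ∈ fixedElts p d F, traceChar p F (u * -b⁻¹) = 1 := by
        intro u hu
        rw [mul_neg, AddChar.map_neg_eq_inv, h u hu, inv_one]
      simp only [hX]
      rw [subfieldSum_of_forall hF hds h, subfieldSum_of_forall hF hds h', hT _ h,
        show (p : ℂ) ^ d * (p : ℂ) ^ d - 1 = ((p : ℂ) ^ d + 1) * ((p : ℂ) ^ d - 1) by ring]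
      congr 1
      ring
    · have h1 := sum_fixedElts_of_not_forall h
        (mem_fixedElts.2 (one_pow (p ^ d))) (one_ne_zero (α := F))
      simp only [one_mul, mul_comm b⁻¹] at h1
      simp only [hX]
      rw [subfieldSum_mul_neg hp hF hds h, h1]
      field_simp
      ring
  have hinv : ∑ b ∈ (fixedElts p s F).erase 0, X b⁻¹ = ∑ b ∈ (fixedElts p s F).erase 0, X b := by
    have hi : ∀ b ∈ (fixedElts p s F).erase 0, b⁻¹ ∈ (fixedElts p s F).erase 0 := by
      intro b hb
      obtain ⟨hb0, hb⟩ := Finset.mem_erase.1 hb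
      exact Finset.mem_erase.2 ⟨inv_ne_zero hb0, inv_mem_fixedElts hb⟩
    exact Finset.sum_bij' (fun b _ => b⁻¹) (fun b _ => b⁻¹) hi hi (fun b _ => inv_inv b)
      (fun b _ => inv_inv b) fun b _ => rfl
  rw [Finset.sum_congr rfl hg, ← Finset.sum_div, hinv,
    Finset.sum_erase_eq_sub (zero_mem_fixedElts s), hXs, hX0]
  field_simp
  ring

theorem sum_expSum (hF : Fintype.card F = p ^ (2 * s)) :
    ∑ t ∈ fixedElts p s F ×ˢ Finset.univ, expSum p s l t.1 t.2 = (p : ℂ) ^ (3 * s) := by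
  simp only [expSum]
  rw [Finset.sum_comm, Finset.sum_eq_single 0]
  · simp only [quadPart, zero_pow (Nat.succ_ne_zero _), mul_zero, add_zero,
      AddChar.map_zero_eq_one, Finset.sum_const, Finset.card_product,
      card_fixedElts hF (Dvd.intro_left 2 rfl), Finset.card_univ, hF]
    simp
    ring
  · intro x _ hx
    rw [Finset.sum_product]
    refine Finset.sum_eq_zero fun a _ => ?_
    simp only [quadPart, AddChar.map_add_eq_mul, ← Finset.mul_sum, mul_comm _ (x ^ (p ^ l + 1)),
      sum_traceChar_mul hF, if_neg (pow_ne_zero (p ^ l + 1) hx), mul_zero]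
  · simp

/-- The quadratic parts with a nontrivial radical, weighted by `expSum + p ^ s`. -/
theorem sum_degenerate (hp : Odd p) (hF : Fintype.card F = p ^ (2 * s))
    (hl : l ≤ 2 * s - 1) (hd0 : 0 < d) (hds : d ∣ s) (hdl : d ∣ l)
    (hd' : Nat.gcd (s + l) (2 * l) = d) :
    ((p : ℂ) ^ d + 1) * ∑ t ∈ (fixedElts p s F ×ˢ Finset.univ).erase 0 with
        (radical p s l t.1 t.2).card ≠ 1, (expSum p s l t.1 t.2 + (p : ℂ) ^ s)
      = ((p : ℂ) ^ (2 * s) - 1) * ((p : ℂ) ^ s * ((p : ℂ) ^ s + 1)) := by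
  set T := (fixedElts p s F ×ˢ (Finset.univ : Finset F)).erase 0 with hT
  set g : F × F → ℂ := fun t => (expSum p s l t.1 t.2 + (p : ℂ) ^ s)
        / ((radical p s l t.1 t.2).card - 1) with hg
  have hmem : ∀ t : F × F, t ∈ T ↔ t ≠ 0 ∧ t.1 ^ p ^ s = t.1 := by
    intro t
    simp [hT, mem_fixedElts]
  have hzero : ∀ t : F × F, (0 : F) ∈ radical p s l t.1 t.2 := by
    intro t
    have h0 := fun n : ℕ => pow_ne_zero n (Fact.out : p.Prime).ne_zero
    refine Finset.mem_filter.2 ⟨Finset.mem_univ _, ?_⟩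
    rw [polarMap, mul_zero, zero_pow (h0 s), zero_pow (h0 l), zero_pow (h0 _)]
    ring
  have h1 : ∑ t ∈ T with (radical p s l t.1 t.2).card ≠ 1, (expSum p s l t.1 t.2 + (p : ℂ) ^ s)
      = ∑ t ∈ T, ∑ z ∈ (Finset.univ : Finset F).erase 0,
          if polarMap p s l t.1 t.2 z = 0 then g t else 0 := by
    rw [Finset.sum_filter]
    refine Finset.sum_congr rfl fun t _ => ?_
    have hc : ∑ z ∈ (Finset.univ : Finset F).erase 0,
          (if polarMap p s l t.1 t.2 z = 0 then g t else 0)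
        = ((radical p s l t.1 t.2).card - 1) * g t := by
      have e1 : (Finset.univ.erase 0).filter (fun z => polarMap p s l t.1 t.2 z = 0)
          = (radical p s l t.1 t.2).erase 0 := by
        rw [radical, Finset.filter_erase]
      rw [← Finset.sum_filter, e1, Finset.sum_const, Finset.card_erase_of_mem (hzero t),
        nsmul_eq_mul, Nat.cast_sub (Finset.card_pos.2 ⟨0, hzero t⟩), Nat.cast_one]
    rw [hc]
    split_ifs with h
    · have h' : ((radical p s l t.1 t.2).card : ℂ) - 1 ≠ 0 := by
        rw [sub_ne_zero]
        exact_mod_cast h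
      rw [hg, mul_div_cancel₀ _ h']
    · rw [not_not.1 h]
      simp
  have h2 : ∀ z ∈ (Finset.univ : Finset F).erase 0,
      ∑ t ∈ T, (if polarMap p s l t.1 t.2 z = 0 then g t else 0)
      = ∑ t ∈ T, if polarMap p s l t.1 t.2 1 = 0 then g t else 0 := by
    intro z hz
    have hz := (Finset.mem_erase.1 hz).1
    have hw : (z ^ (p ^ s + 1)) ^ p ^ s = z ^ (p ^ s + 1) := by
      rw [pow_succ, mul_pow, pow_pow_pow_self hF, mul_comm]
    refine Finset.sum_bij' (fun t _ => (t.1 * z ^ (p ^ s + 1), t.2 * z ^ (p ^ l + 1)))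
      (fun t _ => (t.1 * (z ^ (p ^ s + 1))⁻¹, t.2 * (z ^ (p ^ l + 1))⁻¹)) ?_ ?_ ?_ ?_ ?_
    · intro t ht
      obtain ⟨h0, ht⟩ := (hmem t).1 ht
      refine (hmem _).2 ⟨fun h => h0 ?_, by rw [mul_pow, ht, hw]⟩
      obtain ⟨e1, e2⟩ := Prod.mk_eq_zero.1 h
      exact Prod.ext ((mul_eq_zero.1 e1).resolve_right (pow_ne_zero _ hz))
        ((mul_eq_zero.1 e2).resolve_right (pow_ne_zero _ hz))
    · intro t ht
      obtain ⟨h0, ht⟩ := (hmem t).1 ht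
      refine (hmem _).2 ⟨fun h => h0 ?_, by rw [mul_pow, ht, inv_pow, hw]⟩
      obtain ⟨e1, e2⟩ := Prod.mk_eq_zero.1 h
      exact Prod.ext ((mul_eq_zero.1 e1).resolve_right (inv_ne_zero (pow_ne_zero _ hz)))
        ((mul_eq_zero.1 e2).resolve_right (inv_ne_zero (pow_ne_zero _ hz)))
    · intro t _
      simp [hz]
    · intro t _
      simp [hz]
    · intro t _
      simp only [hg, expSum_scale hz, card_radical_scale hF hl hz, polarMap_scale hF hl, mul_one,
        mul_eq_zero, hz, false_or]
  have h3 : ∑ t ∈ T, (if polarMap p s l t.1 t.2 1 = 0 then g t else 0)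
      = ∑ b ∈ (fixedElts p s F).erase 0, g (-(b + b ^ p ^ (2 * s - l)), b) := by
    have hz0 : p ^ (2 * s - l) ≠ 0 := pow_ne_zero _ (Fact.out : p.Prime).ne_zero
    rw [← Finset.sum_filter]
    refine Finset.sum_bij' (fun t _ => t.2) (fun b _ => (-(b + b ^ p ^ (2 * s - l)), b))
      ?_ ?_ ?_ ?_ ?_
    · intro t ht
      obtain ⟨ht, hp1⟩ := Finset.mem_filter.1 ht
      obtain ⟨h0, ht⟩ := (hmem t).1 ht
      obtain ⟨e1, e2⟩ := (polarMap_one_eq_zero hp hF hl hds hd' ht).1 hp1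
      refine Finset.mem_erase.2 ⟨fun h => h0 (Prod.ext ?_ h), mem_fixedElts.2 e1⟩
      rw [e2, h, zero_pow hz0, add_zero, neg_zero, Prod.fst_zero]
    · intro b hb
      obtain ⟨h0, hb⟩ := Finset.mem_erase.1 hb
      have hb := mem_fixedElts.1 hb
      have ha : (-(b + b ^ p ^ (2 * s - l))) ^ p ^ s = -(b + b ^ p ^ (2 * s - l)) := by
        rw [neg_pow_pow, add_pow_pow, pow_right_comm, hb]
      refine Finset.mem_filter.2 ⟨(hmem _).2 ⟨fun h => h0 (Prod.mk_eq_zero.1 h).2, ha⟩, ?_⟩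
      exact (polarMap_one_eq_zero hp hF hl hds hd' ha).2 ⟨hb, rfl⟩
    · intro t ht
      obtain ⟨ht, hp1⟩ := Finset.mem_filter.1 ht
      obtain ⟨h0, ht⟩ := (hmem t).1 ht
      obtain ⟨e1, e2⟩ := (polarMap_one_eq_zero hp hF hl hds hd' ht).1 hp1
      exact Prod.ext e2.symm rfl
    · intro b _
      rfl
    · intro t ht
      obtain ⟨ht, hp1⟩ := Finset.mem_filter.1 ht
      obtain ⟨h0, ht⟩ := (hmem t).1 ht
      obtain ⟨e1, e2⟩ := (polarMap_one_eq_zero hp hF hl hds hd' ht).1 hp1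
      exact congrArg g (Prod.ext e2 rfl)
  rw [h1, Finset.sum_comm, Finset.sum_congr rfl h2, Finset.sum_const,
    Finset.card_erase_of_mem (Finset.mem_univ _), Finset.card_univ, hF, nsmul_eq_mul,
    Nat.cast_sub (Nat.one_le_pow _ _ (Fact.out : p.Prime).pos), h3,
    ← sum_ratio hp hF hl hd0 hds hdl hd']
  push_cast
  ring

theorem card_expSum_eq (hp : Odd p) (hF : Fintype.card F = p ^ (2 * s))
    (hl : l ≤ 2 * s - 1) (hd0 : 0 < d) (hds : d ∣ s) (hdl : d ∣ l)
    (hd' : Nat.gcd (s + l) (2 * l) = d) (hs : s ≠ 0) {N : Finset (F × F)}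
    (hN : ∀ t, t ∈ N ↔ t.1 ^ p ^ s = t.1 ∧ expSum p s l t.1 t.2 = (p : ℂ) ^ s) :
    (N.card : ℂ) * (2 * ((p : ℂ) ^ d + 1))
      = (p : ℂ) ^ d * ((p : ℂ) ^ s + 1) * ((p : ℂ) ^ (2 * s) - 1) := by
  classical
  have hps : (p : ℂ) ^ s ≠ 0 := pow_ne_zero _ (Nat.cast_ne_zero.2 (Fact.out : p.Prime).ne_zero)
  have hr0 : (radical p s l (0 : F) 0).card ≠ 1 := by
    have h1 : radical p s l (0 : F) 0 = Finset.univ := by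
      ext x
      simp [radical, polarMap, (Fact.out : p.Prime).ne_zero]
    rw [h1, Finset.card_univ, hF]
    exact (Nat.one_lt_pow (by omega) (Fact.out : p.Prime).one_lt).ne'
  have h00 : expSum p s l (0 : F) 0 = (p : ℂ) ^ (2 * s) := by
    simp [expSum, quadPart, hF]
  set T := fixedElts p s F ×ˢ (Finset.univ : Finset F) with hT
  have h1 : ∑ t ∈ T, (expSum p s l t.1 t.2 + (p : ℂ) ^ s)
      = (p : ℂ) ^ (3 * s) + (p : ℂ) ^ (4 * s) := by
    rw [Finset.sum_add_distrib, sum_expSum hF, Finset.sum_const, hT, Finset.card_product,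
      card_fixedElts hF (Dvd.intro_left 2 rfl), Finset.card_univ, hF, nsmul_eq_mul]
    push_cast
    ring
  have h2 := Finset.sum_filter_add_sum_filter_not T (fun t => (radical p s l t.1 t.2).card ≠ 1)
    fun t => expSum p s l t.1 t.2 + (p : ℂ) ^ s
  have h3 : ∑ t ∈ T with ¬ (radical p s l t.1 t.2).card ≠ 1, (expSum p s l t.1 t.2 + (p : ℂ) ^ s)
      = N.card * (2 * (p : ℂ) ^ s) := by
    have hsub : N ⊆ T.filter fun t => ¬ (radical p s l t.1 t.2).card ≠ 1 := by
      intro t ht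
      obtain ⟨ha, he⟩ := (hN t).1 ht
      simp only [hT, Finset.mem_filter, Finset.mem_product, mem_fixedElts, Finset.mem_univ,
        and_true, not_not]
      exact ⟨ha, card_radical_of_expSum hp hF hl ha he⟩
    rw [← Finset.sum_subset hsub, Finset.sum_congr rfl (g := fun _ => 2 * (p : ℂ) ^ s),
      Finset.sum_const, nsmul_eq_mul]
    · intro t ht
      rw [((hN t).1 ht).2]
      ring
    · intro t ht hn
      simp only [hT, Finset.mem_filter, Finset.mem_product, mem_fixedElts, Finset.mem_univ,
        and_true, not_not] at ht
      rcases expSum_eq_or_eq_neg hp hF hl ht.1 ht.2 with h | h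
      · exact absurd ((hN t).2 ⟨ht.1, h⟩) hn
      · rw [h]
        ring
  have h4 : ∑ t ∈ T with (radical p s l t.1 t.2).card ≠ 1, (expSum p s l t.1 t.2 + (p : ℂ) ^ s)
      = ((p : ℂ) ^ (2 * s) + (p : ℂ) ^ s) + ∑ t ∈ T.erase 0 with
        (radical p s l t.1 t.2).card ≠ 1, (expSum p s l t.1 t.2 + (p : ℂ) ^ s) := by
    rw [Finset.filter_erase, Finset.sum_erase_eq_sub]
    · rw [Prod.fst_zero, Prod.snd_zero, h00]
      ring
    · refine Finset.mem_filter.2 ⟨?_, hr0⟩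
      exact Finset.mem_product.2 ⟨zero_mem_fixedElts s, Finset.mem_univ _⟩
  have h5 := sum_degenerate hp hF hl hd0 hds hdl hd'
  rw [h1, h3, h4] at h2
  refine mul_right_cancel₀ hps ?_
  have e3 : (p : ℂ) ^ (3 * s) = ((p : ℂ) ^ s) ^ 3 := by rw [← pow_mul, mul_comm]
  have e4 : (p : ℂ) ^ (4 * s) = ((p : ℂ) ^ s) ^ 4 := by rw [← pow_mul, mul_comm]
  have e2 : (p : ℂ) ^ (2 * s) = ((p : ℂ) ^ s) ^ 2 := by rw [← pow_mul, mul_comm]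
  rw [e2, e3, e4] at h2
  rw [e2] at h5 ⊢
  linear_combination ((p : ℂ) ^ d + 1) * h2 - h5

end CountPositive

section Codewords

variable {p s l d : ℕ} [Fact p.Prime] {F : Type} [Field F] [Fintype F] [DecidableEq F] [CharP F p]
  [Algebra (ZMod p) F] {a b c : F} {h : ZMod p}

/-- The codeword `c(a,b,c,h)` with values in the prime field. -/
noncomputable def codeFun (p s l : ℕ) [Fact p.Prime] {F : Type} [Field F] [Algebra (ZMod p) F]
    (a b c : F) (h : ZMod p) (x : F) : ZMod p :=
  Algebra.trace (ZMod p) F (quadPart p s l a b x) + Algebra.trace (ZMod p) F (c * x) + h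

theorem polarMap_injective (hr : (radical p s l a b).card = 1) :
    Function.Injective (polarMap p s l a b) := by
  obtain ⟨z, hz⟩ := Finset.card_eq_one.1 hr
  have h0 : (0 : F) ∈ radical p s l a b := by
    have := polarMap_smul (p := p) (s := s) (l := l) (a := a) (b := b) 0 (0 : F)
    rw [zero_smul, zero_smul] at this
    exact Finset.mem_filter.2 ⟨Finset.mem_univ _, this⟩
  intro x y hxy
  have h1 : x - y ∈ radical p s l a b := by
    refine Finset.mem_filter.2 ⟨Finset.mem_univ _, ?_⟩
    have := polarMap_add (p := p) (s := s) (l := l) (a := a) (b := b) (x - y) y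
    rw [sub_add_cancel, hxy] at this
    simpa using this
  rw [hz, Finset.mem_singleton] at h0 h1
  rw [← sub_eq_zero, h1, h0]

theorem trace_polarMap_comm (hp : Odd p) (hF : Fintype.card F = p ^ (2 * s))
    (hl : l ≤ 2 * s - 1) (ha : a ^ p ^ s = a) (x y : F) :
    Algebra.trace (ZMod p) F (y * polarMap p s l a b x)
      = Algebra.trace (ZMod p) F (x * polarMap p s l a b y) := by
  have h1 := trace_quadPart_add hp hF hl ha (b := b) x y
  have h2 := trace_quadPart_add hp hF hl ha (b := b) y x
  rw [add_comm y x, h1] at h2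
  linear_combination h2

theorem exists_polarMap_eq (hp : Odd p) (hF : Fintype.card F = p ^ (2 * s))
    (hl : l ≤ 2 * s - 1) (ha : a ^ p ^ s = a)
    (h : ∀ u, polarMap p s l a b u = 0 → Algebra.trace (ZMod p) F (c * u) = 0) :
    ∃ w, polarMap p s l a b w = c := by
  by_contra! hc
  have hp0 : (p : ℂ) ^ (2 * s) ≠ 0 :=
    pow_ne_zero _ (Nat.cast_ne_zero.2 (Fact.out : p.Prime).ne_zero)
  have h1 : ∑ w, ∑ y, traceChar p F ((polarMap p s l a b w - c) * y) = 0 := by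
    simp only [sum_traceChar_mul hF, sub_eq_zero, hc, if_false, Finset.sum_const_zero]
  have h2 : ∀ y, ∑ w, traceChar p F ((polarMap p s l a b w - c) * y)
      = if polarMap p s l a b y = 0 then (p : ℂ) ^ (2 * s) else 0 := by
    intro y
    have h3 : ∀ w, traceChar p F ((polarMap p s l a b w - c) * y)
        = traceChar p F (-(c * y)) * traceChar p F (polarMap p s l a b y * w) := by
      intro w
      rw [sub_mul, sub_eq_neg_add, AddChar.map_add_eq_mul, mul_comm (polarMap p s l a b w),
        traceChar_apply (y * _), trace_polarMap_comm hp hF hl ha, ← traceChar_apply, mul_comm w]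
    simp only [h3, ← Finset.mul_sum, sum_traceChar_mul hF]
    split_ifs with hy
    · rw [AddChar.map_neg_eq_inv, (traceChar_eq_one_iff _).2 (h y hy), inv_one, one_mul]
    · rw [mul_zero]
  rw [Finset.sum_comm, Finset.sum_congr rfl fun y _ => h2 y, ← Finset.sum_filter, Finset.sum_const,
    nsmul_eq_mul, mul_eq_zero, or_iff_left hp0, Nat.cast_eq_zero, Finset.card_eq_zero] at h1
  have hmem : (0 : F) ∈ Finset.univ.filter fun y => polarMap p s l a b y = 0 := by
    have := polarMap_smul (p := p) (s := s) (l := l) (a := a) (b := b) 0 (0 : F)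
    rw [zero_smul, zero_smul] at this
    exact Finset.mem_filter.2 ⟨Finset.mem_univ _, this⟩
  rw [h1] at hmem
  exact absurd hmem (Finset.notMem_empty _)

theorem codeFun_add (hp : Odd p) (hF : Fintype.card F = p ^ (2 * s))
    (hl : l ≤ 2 * s - 1) (ha : a ^ p ^ s = a) (x y : F) :
    codeFun p s l a b c h (x + y) = codeFun p s l a b c h x
      + Algebra.trace (ZMod p) F (y * (polarMap p s l a b x + c))
      + Algebra.trace (ZMod p) F (quadPart p s l a b y) := by
  rw [codeFun, codeFun, trace_quadPart_add hp hF hl ha, mul_add, mul_add, map_add, map_add,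
    mul_comm c y]
  ring

/-- The zeros of a function with values in the prime field, counted by exponential sums. -/
theorem card_zeros {X : Type} [Fintype X] (f : X → ZMod p) :
    ((Finset.univ.filter fun x => f x = 0).card : ℂ) * p
      = Fintype.card X + ∑ t ∈ (Finset.univ : Finset (ZMod p)).erase 0,
          ∑ x, ZMod.stdAddChar (t * f x) := by
  have h1 : ∑ x, ∑ t, ZMod.stdAddChar (N := p) (t * f x)
      = (Finset.univ.filter fun x => f x = 0).card * (p : ℂ) := by
    simp only [mul_comm _ (f _), sum_addChar_mul (ZMod.isPrimitive_stdAddChar p)]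
    rw [← Finset.sum_filter, Finset.sum_const, nsmul_eq_mul]
  rw [← h1, Finset.sum_comm, ← Finset.add_sum_erase _ _ (Finset.mem_univ (0 : ZMod p))]
  simp

theorem sum_codeFun_of_trace_ne (hp : Odd p) (hF : Fintype.card F = p ^ (2 * s))
    (hl : l ≤ 2 * s - 1) (ha : a ^ p ^ s = a) {u : F} (hu : polarMap p s l a b u = 0)
    (hc : Algebra.trace (ZMod p) F (c * u) ≠ 0) {t : ZMod p} (ht : t ≠ 0) :
    ∑ x, ZMod.stdAddChar (t * codeFun p s l a b c h x) = 0 := by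
  have h1 : ∑ x, ZMod.stdAddChar (t * codeFun p s l a b c h x)
      = ZMod.stdAddChar (t * Algebra.trace (ZMod p) F (c * u))
        * ∑ x, ZMod.stdAddChar (t * codeFun p s l a b c h x) := by
    conv_lhs => rw [← Equiv.sum_comp (Equiv.addRight u)]
    rw [Finset.mul_sum]
    refine Finset.sum_congr rfl fun x _ => ?_
    rw [Equiv.coe_addRight, codeFun_add hp hF hl ha, mul_add u,
      map_add (Algebra.trace (ZMod p) F), trace_polarMap_comm hp hF hl ha, hu,
      trace_quadPart_radical hp hF hl ha hu,
      ← AddChar.map_add_eq_mul, mul_zero, map_zero, mul_comm u]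
    congr 1
    ring
  have h2 : ZMod.stdAddChar (t * Algebra.trace (ZMod p) F (c * u)) ≠ 1 := by
    rw [← AddChar.map_zero_eq_one (ZMod.stdAddChar (N := p)), ZMod.injective_stdAddChar.ne_iff]
    exact mul_ne_zero ht hc
  have h3 : (ZMod.stdAddChar (t * Algebra.trace (ZMod p) F (c * u)) - 1)
      * ∑ x, ZMod.stdAddChar (t * codeFun p s l a b c h x) = 0 := by
    rw [sub_mul, ← h1, one_mul, sub_self]
  exact (mul_eq_zero.1 h3).resolve_left (sub_ne_zero.2 h2)

theorem sum_codeFun_polarMap (hp : Odd p) (hF : Fintype.card F = p ^ (2 * s))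
    (hl : l ≤ 2 * s - 1) (ha : a ^ p ^ s = a) (w : F) (t : ZMod p) :
    ∑ x, ZMod.stdAddChar (t * codeFun p s l a b (polarMap p s l a b w) h x)
      = ZMod.stdAddChar ((h - Algebra.trace (ZMod p) F (quadPart p s l a b w)) * t)
        * ∑ x, ZMod.stdAddChar (t * Algebra.trace (ZMod p) F (quadPart p s l a b x)) := by
  conv_rhs => rw [← Equiv.sum_comp (Equiv.addLeft w)]
  rw [Finset.mul_sum]
  refine Finset.sum_congr rfl fun x _ => ?_
  rw [Equiv.coe_addLeft, trace_quadPart_add hp hF hl ha, ← AddChar.map_add_eq_mul, codeFun,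
    mul_comm x]
  congr 1
  ring

theorem not_pow_of_sq {e : ℂ} {k : ℕ} (hp : Odd p) (hk : 2 * s ≤ k) (he : e ^ 2 = (p : ℂ) ^ k) :
    e ≠ ((p : ℂ) - 1) * (p : ℂ) ^ s := by
  rintro rfl
  have hpp := (Fact.out : p.Prime)
  have h3 : 3 ≤ p := by
    have := hpp.two_le
    have : p ≠ 2 := by
      rintro rfl
      exact absurd hp (by decide)
    omega
  rw [mul_pow, ← pow_mul, mul_comm s 2, ← Nat.add_sub_cancel' hk, pow_add,
    mul_comm ((p : ℂ) ^ (2 * s))] at he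
  have hp0 : (p : ℂ) ^ (2 * s) ≠ 0 := pow_ne_zero _ (Nat.cast_ne_zero.2 hpp.ne_zero)
  have h1 := mul_right_cancel₀ hp0 he
  rw [← Nat.cast_one, ← Nat.cast_sub hpp.one_le] at h1
  have h2 : (p - 1) ^ 2 = p ^ (k - 2 * s) := by exact_mod_cast h1
  rcases Nat.eq_zero_or_pos (k - 2 * s) with h0 | h0
  · rw [h0, pow_zero] at h2
    have := Nat.one_lt_pow two_ne_zero (show 1 < p - 1 by omega)
    omega
  · have h4 : p ∣ (p - 1) ^ 2 := by
      rw [h2]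
      exact dvd_pow_self p h0.ne'
    have := Nat.le_of_dvd (by omega) (hpp.dvd_of_dvd_pow h4)
    omega

theorem sum_sum_codeFun_iff (hp : Odd p) (hF : Fintype.card F = p ^ (2 * s))
    (hl : l ≤ 2 * s - 1) (ha : a ^ p ^ s = a) :
    ∑ t ∈ (Finset.univ : Finset (ZMod p)).erase 0,
        ∑ x, ZMod.stdAddChar (t * codeFun p s l a b c h x) = ((p : ℂ) - 1) * (p : ℂ) ^ s
      ↔ expSum p s l a b = (p : ℂ) ^ s ∧ ∃ w, polarMap p s l a b w = c ∧
        Algebra.trace (ZMod p) F (quadPart p s l a b w) = h := by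
  have hpp := (Fact.out : p.Prime)
  have hps : (p : ℂ) ^ s ≠ 0 := pow_ne_zero _ (Nat.cast_ne_zero.2 hpp.ne_zero)
  have hp1 : (p : ℂ) - 1 ≠ 0 := by
    rw [sub_ne_zero]
    exact_mod_cast hpp.one_lt.ne'
  by_cases hc : ∀ u, polarMap p s l a b u = 0 → Algebra.trace (ZMod p) F (c * u) = 0
  swap
  · push Not at hc
    obtain ⟨u, hu, hc⟩ := hc
    rw [Finset.sum_eq_zero fun t ht =>
      sum_codeFun_of_trace_ne hp hF hl ha hu hc (Finset.mem_erase.1 ht).1]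
    refine iff_of_false (mul_ne_zero hp1 hps).symm ?_
    rintro ⟨-, w, rfl, -⟩
    rw [mul_comm, trace_polarMap_comm hp hF hl ha, hu, mul_zero, map_zero] at hc
    exact hc rfl
  obtain ⟨w, rfl⟩ := exists_polarMap_eq hp hF hl ha hc
  obtain ⟨r, hr, h1, h2, h3⟩ := exists_rank hp hF hl ha b
  set e := h - Algebra.trace (ZMod p) F (quadPart p s l a b w) with he
  have hE : ∑ t ∈ (Finset.univ : Finset (ZMod p)).erase 0,
        ∑ x, ZMod.stdAddChar (t * codeFun p s l a b (polarMap p s l a b w) h x)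
      = expSum p s l a b * ∑ t ∈ (Finset.univ : Finset (ZMod p)).erase 0,
          qchar p t ^ r * ZMod.stdAddChar (e * t) := by
    rw [Finset.mul_sum]
    refine Finset.sum_congr rfl fun t ht => ?_
    rw [sum_codeFun_polarMap hp hF hl ha, h2 t (Finset.mem_erase.1 ht).1]
    ring
  have hqe : Even r → ∀ t : ZMod p, t ≠ 0 → qchar p t ^ r = 1 := by
    rintro ⟨k, rfl⟩ t ht
    rw [← two_mul, pow_mul, qchar_sq ht, one_pow]
  have hqo : Odd r → ∀ t : ZMod p, qchar p t ^ r = qchar p t := by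
    rintro ⟨k, rfl⟩ t
    rcases eq_or_ne t 0 with rfl | ht
    · rw [MulChar.map_zero, zero_pow (by omega)]
    · rw [pow_succ, pow_mul, qchar_sq ht, one_pow, one_mul]
  have hn1 : (-1 : ZMod p) ≠ 0 := neg_ne_zero.2 one_ne_zero
  rw [hE]
  constructor
  · intro hEq
    rcases Nat.even_or_odd r with hre | hro
    · have hS : ∑ t ∈ (Finset.univ : Finset (ZMod p)).erase 0,
          qchar p t ^ r * ZMod.stdAddChar (e * t) = (if e = 0 then (p : ℂ) else 0) - 1 := by
        rw [← sum_addChar_mul (ZMod.isPrimitive_stdAddChar p),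
          ← Finset.add_sum_erase _ _ (Finset.mem_univ (0 : ZMod p)), mul_zero,
          AddChar.map_zero_eq_one, add_sub_cancel_left]
        exact Finset.sum_congr rfl fun t ht => by
          rw [hqe hre t (Finset.mem_erase.1 ht).1, one_mul]
      rw [hS] at hEq
      rw [hqe hre _ hn1, one_mul] at h1
      split_ifs at hEq with h0
      · rw [mul_comm] at hEq
        exact ⟨mul_left_cancel₀ hp1 hEq, w, rfl, (sub_eq_zero.1 h0).symm⟩
      · refine absurd hEq (not_pow_of_sq (k := 4 * s - r) hp (by omega) ?_)
        rw [← h1]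
        ring
    · have hS : ∑ t ∈ (Finset.univ : Finset (ZMod p)).erase 0,
          qchar p t ^ r * ZMod.stdAddChar (e * t) = ∑ t, qchar p t * ZMod.stdAddChar (e * t) := by
        rw [← Finset.add_sum_erase _ _ (Finset.mem_univ (0 : ZMod p)), MulChar.map_zero, zero_mul,
          zero_add]
        exact Finset.sum_congr rfl fun t _ => by rw [hqo hro]
      rw [hS] at hEq
      rcases eq_or_ne e 0 with h0 | h0
      · have : ∑ t, qchar p t * ZMod.stdAddChar (e * t) = 0 := by
          simp only [h0, zero_mul, AddChar.map_zero_eq_one, mul_one]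
          exact MulChar.sum_eq_zero_of_ne_one (qchar_ne_one hp)
        rw [this, mul_zero] at hEq
        exact absurd hEq.symm (mul_ne_zero hp1 hps)
      · refine absurd hEq (not_pow_of_sq (k := 4 * s - r + 1) hp (by omega) ?_)
        rw [sum_qchar_mul h0, mul_pow, mul_pow, h1, qchar_sq h0,
          gaussSum_qchar_sq hp (ZMod.isPrimitive_stdAddChar p), hqo hro]
        have := qchar_sq hn1
        linear_combination (p : ℂ) ^ (4 * s - r + 1) * this
  · rintro ⟨hx, w', hw, hq⟩
    have hr1 := card_radical_of_expSum hp hF hl ha hx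
    have hww : w' = w := polarMap_injective hr1 hw
    have h0 : e = 0 := by rw [he, ← hq, hww, sub_self]
    have hre : Even r := by
      rw [h3] at hr1
      have : 2 * s - r = 0 := by
        by_contra hn
        exact (Nat.one_lt_pow hn hpp.one_lt).ne' hr1
      exact ⟨s, by omega⟩
    rw [hx, mul_comm, Finset.sum_congr rfl (g := fun _ => (1 : ℂ)), Finset.sum_const,
      Finset.card_erase_of_mem (Finset.mem_univ _), Finset.card_univ, ZMod.card]
    · simp [Nat.cast_sub hpp.one_le]
    · intro t ht
      rw [hqe hre t (Finset.mem_erase.1 ht).1, h0, zero_mul, AddChar.map_zero_eq_one, one_mul]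

theorem weight_codeFun_iff (hp : Odd p) (hF : Fintype.card F = p ^ (2 * s)) (hs : 1 ≤ s)
    (hl : l ≤ 2 * s - 1) (ha : a ^ p ^ s = a) :
    (Finset.univ.filter fun x => codeFun p s l a b c h x ≠ 0).card
        = (p - 1) * (p ^ (2 * s - 1) - p ^ (s - 1))
      ↔ expSum p s l a b = (p : ℂ) ^ s ∧ ∃ w, polarMap p s l a b w = c ∧
        Algebra.trace (ZMod p) F (quadPart p s l a b w) = h := by
  have hpp := (Fact.out : p.Prime)
  rw [← sum_sum_codeFun_iff hp hF hl ha]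
  have h1 := card_zeros fun x => codeFun p s l a b c h x
  have h2 := Finset.card_filter_add_card_filter_not (s := (Finset.univ : Finset F))
    fun x => codeFun p s l a b c h x = 0
  rw [Finset.card_univ, hF] at h2
  rw [hF, Nat.cast_pow] at h1
  have h2' := congrArg (fun n : ℕ => (n : ℂ)) h2
  have hpc : (p : ℂ) ≠ 0 := Nat.cast_ne_zero.2 hpp.ne_zero
  rw [← Nat.cast_inj (R := ℂ), Nat.cast_mul, Nat.cast_sub hpp.one_le,
    Nat.cast_sub (Nat.pow_le_pow_right hpp.pos (by omega)), ← mul_left_inj' hpc]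
  push_cast at h2' ⊢
  have e1 : (p : ℂ) ^ (2 * s - 1) * p = (p : ℂ) ^ (2 * s) := by
    rw [← pow_succ]
    congr 1
    omega
  have e2 : (p : ℂ) ^ (s - 1) * p = (p : ℂ) ^ s := by
    rw [← pow_succ]
    congr 1
    omega
  constructor
  · intro h
    linear_combination -h1 + (p : ℂ) * h2' - h - ((p : ℂ) - 1) * (e1 - e2)
  · intro h
    linear_combination -h1 + (p : ℂ) * h2' - h - ((p : ℂ) - 1) * (e1 - e2)

end Codewords

section CodeStructure

variable {p s l d : ℕ} [Fact p.Prime] {F : Type} [Field F] [Fintype F] [DecidableEq F] [CharP F p]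
  [Algebra (ZMod p) F] {a b c : F} {h : ZMod p}

theorem codeFun_sub_smul (a b c a' b' c' : F) (h h' t : ZMod p) (x : F) :
    codeFun p s l (a - t • a') (b - t • b') (c - t • c') (h - t * h') x
      = codeFun p s l a b c h x - t * codeFun p s l a' b' c' h' x := by
  have e1 : quadPart p s l (a - t • a') (b - t • b') x
      = quadPart p s l a b x - t • quadPart p s l a' b' x := by
    simp only [quadPart, Algebra.smul_def]
    ring
  rw [codeFun, codeFun, codeFun, e1, sub_mul, smul_mul_assoc, map_sub, map_sub, map_smul, map_smul,
    smul_eq_mul, smul_eq_mul]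
  ring

theorem card_quadratic_zeros_le {α β γ : ZMod p} (hne : ¬ (α = 0 ∧ β = 0 ∧ γ = 0)) :
    (Finset.univ.filter fun t : ZMod p => α * t ^ 2 + β * t + γ = 0).card ≤ 2 := by
  open Polynomial in
  set P : (ZMod p)[X] := C α * X ^ 2 + C β * X + C γ with hP
  have hP0 : P ≠ 0 := by
    intro h0
    refine hne ⟨?_, ?_, ?_⟩
    · simpa [hP, coeff_X, coeff_C] using congrArg (fun Q => coeff Q 2) h0
    · simpa [hP, coeff_X, coeff_C] using congrArg (fun Q => coeff Q 1) h0
    · simpa [hP, coeff_X, coeff_C] using congrArg (fun Q => coeff Q 0) h0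
  have hsub : (Finset.univ.filter fun t : ZMod p => α * t ^ 2 + β * t + γ = 0)
      ⊆ P.roots.toFinset := by
    intro t ht
    rw [Multiset.mem_toFinset, mem_roots hP0, IsRoot.def]
    simpa [hP] using ht
  calc _ ≤ P.roots.toFinset.card := Finset.card_le_card hsub
    _ ≤ P.roots.card := Multiset.toFinset_card_le _
    _ ≤ P.natDegree := card_roots' P
    _ ≤ 2 := natDegree_quadratic_le

theorem polarMap_eq_zero_of_trace (hp : Odd p) (hF : Fintype.card F = p ^ (2 * s))
    (hl : l ≤ 2 * s - 1) (ha : a ^ p ^ s = a)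
    (h : ∀ x, Algebra.trace (ZMod p) F (quadPart p s l a b x) = 0) (x : F) :
    polarMap p s l a b x = 0 := by
  refine eq_zero_of_trace_mul (p := p) fun y => ?_
  have := trace_quadPart_add hp hF hl ha (b := b) x y
  rw [h, h, h, zero_add, zero_add] at this
  rw [mul_comm, ← this]

theorem card_codeFun_zeros_le (hp : Odd p) (hF : Fintype.card F = p ^ (2 * s))
    (hl : l ≤ 2 * s - 1) (ha : a ^ p ^ s = a) (hne : ∃ x, codeFun p s l a b c h x ≠ 0) :
    p * (Finset.univ.filter fun x => codeFun p s l a b c h x = 0).card ≤ 2 * p ^ (2 * s) := by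
  have hdir : ∃ u, ∀ x, ¬ (Algebra.trace (ZMod p) F (quadPart p s l a b u) = 0 ∧
      Algebra.trace (ZMod p) F (u * (polarMap p s l a b x + c)) = 0 ∧
      codeFun p s l a b c h x = 0) := by
    by_cases h1 : ∀ x, Algebra.trace (ZMod p) F (quadPart p s l a b x) = 0
    · have h2 := polarMap_eq_zero_of_trace hp hF hl ha h1
      by_cases h3 : ∀ x, Algebra.trace (ZMod p) F (c * x) = 0
      · obtain ⟨y, hy⟩ := hne
        refine ⟨0, fun x => fun hx => hy ?_⟩
        have hx := hx.2.2
        rw [codeFun, h1, h3] at hx ⊢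
        exact hx
      · push Not at h3
        obtain ⟨u, hu⟩ := h3
        refine ⟨u, fun x => fun hx => hu ?_⟩
        rw [h2, zero_add, mul_comm] at hx
        exact hx.2.1
    · push Not at h1
      obtain ⟨u, hu⟩ := h1
      exact ⟨u, fun x hx => hu hx.1⟩
  obtain ⟨u, hu⟩ := hdir
  have hline : ∀ x, (Finset.univ.filter fun t : ZMod p =>
      codeFun p s l a b c h (x + t • u) = 0).card ≤ 2 := by
    intro x
    refine le_trans (le_of_eq ?_) (card_quadratic_zeros_le (hu x))
    congr 1
    refine Finset.filter_congr fun t _ => ?_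
    rw [codeFun_add hp hF hl ha, quadPart_smul, smul_mul_assoc, map_smul, map_smul, smul_eq_mul,
      smul_eq_mul]
    refine Eq.congr ?_ rfl
    ring
  have hcount : ∑ x : F, (Finset.univ.filter fun t : ZMod p =>
      codeFun p s l a b c h (x + t • u) = 0).card
      = p * (Finset.univ.filter fun x => codeFun p s l a b c h x = 0).card := by
    simp only [Finset.card_filter]
    rw [Finset.sum_comm]
    have : ∀ t : ZMod p, ∑ x, (if codeFun p s l a b c h (x + t • u) = 0 then 1 else 0)
        = ∑ x, if codeFun p s l a b c h x = 0 then 1 else 0 := fun t =>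
      Equiv.sum_comp (Equiv.addRight (t • u))
        fun x => if codeFun p s l a b c h x = 0 then 1 else 0
    rw [Finset.sum_congr rfl fun t _ => this t, Finset.sum_const, Finset.card_univ, ZMod.card,
      smul_eq_mul]
  rw [← hcount, mul_comm, ← hF, ← Finset.card_univ, ← smul_eq_mul, ← Finset.sum_const]
  exact Finset.sum_le_sum fun x _ => hline x

theorem eq_zero_of_codeFun (hp : Odd p) (hF : Fintype.card F = p ^ (2 * s))
    (hl : l ≤ 2 * s - 1) (hds : d ∣ s) (hdl : d ∣ l) (hd' : Nat.gcd (s + l) (2 * l) = d)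
    (hlt : d < s) (ha : a ^ p ^ s = a) (h0 : ∀ x, codeFun p s l a b c h x = 0) :
    a = 0 ∧ b = 0 ∧ c = 0 ∧ h = 0 := by
  have hpp := (Fact.out : p.Prime)
  have hh : h = 0 := by
    have := h0 0
    simpa [codeFun, quadPart] using this
  have hneg : ∀ x : F, quadPart p s l a b (-x) = quadPart p s l a b x := by
    intro x
    simp only [quadPart, pow_succ _ (p ^ _), neg_pow_pow]
    ring
  have h2 : (2 : ZMod p) ≠ 0 := two_ne_zero_of_odd hp
  have hq : ∀ x, Algebra.trace (ZMod p) F (quadPart p s l a b x) = 0 := by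
    intro x
    have e1 := h0 x
    have e2 := h0 (-x)
    rw [codeFun, hh] at e1 e2
    rw [hneg, mul_neg, map_neg] at e2
    have : 2 * Algebra.trace (ZMod p) F (quadPart p s l a b x) = 0 := by linear_combination e1 + e2
    exact (mul_eq_zero.1 this).resolve_left h2
  have hc : c = 0 := by
    refine eq_zero_of_trace_mul (p := p) fun x => ?_
    have e1 := h0 x
    rw [codeFun, hh, hq] at e1
    simpa using e1
  have hpm := polarMap_eq_zero_of_trace hp hF hl ha hq
  obtain ⟨hb, hab⟩ := (polarMap_one_eq_zero hp hF hl hds hd' ha).1 (hpm 1)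
  have hb0 : b = 0 := by
    by_contra hb0
    have hcard := card_radical_of_polarMap_one hp hF hl hds hdl hd' hb hb0
    rw [← hab] at hcard
    have hrad : radical p s l a b = Finset.univ := by
      ext x
      simp [radical, hpm]
    rw [hrad, Finset.card_univ, hF] at hcard
    by_cases hA : ∀ u ∈ fixedElts p d F, traceChar p F (u * b⁻¹) = 1
    · have hA' : ∀ u ∈ fixedElts p d F, traceChar p F (u * -b⁻¹) = 1 := by
        intro u hu
        rw [mul_neg, AddChar.map_neg_eq_inv, hA u hu, inv_one]
      rw [subfieldSum_of_forall hF hds hA, subfieldSum_of_forall hF hds hA', ← pow_add] at hcard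
      have : p ^ (2 * s) = p ^ (d + d) := by exact_mod_cast hcard
      have := Nat.pow_right_injective hpp.two_le this
      omega
    · rw [subfieldSum_mul_neg hp hF hds hA] at hcard
      have : p ^ (2 * s) = p ^ d := by exact_mod_cast hcard
      have := Nat.pow_right_injective hpp.two_le this
      omega
  refine ⟨?_, hb0, hc, hh⟩
  rw [hab, hb0, zero_pow (pow_ne_zero _ hpp.ne_zero), add_zero, neg_zero]

/-- Two functions with the same small support have a combination with few zeros. -/
theorem exists_mul_of_support {X : Type} [Fintype X] (f g : X → ZMod p) {n i : ℕ} (hp : 2 < p)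
    (hX : Fintype.card X = p * n) (hsupp : ∀ x, f x ≠ 0 ↔ g x ≠ 0)
    (hi : (Finset.univ.filter fun x => f x ≠ 0).card = i) (hin : i < (p - 1) * n)
    (hz : ∀ t : ZMod p, t ≠ 0 → (∃ x, f x - t * g x ≠ 0) →
      p * (Finset.univ.filter fun x => f x - t * g x = 0).card ≤ 2 * (p * n)) :
    ∃ t : ZMod p, t ≠ 0 ∧ ∀ x, f x = t * g x := by
  by_contra! hcon
  have h1 : ∀ t ∈ (Finset.univ : Finset (ZMod p)).erase 0,
      (Finset.univ.filter fun x => f x - t * g x = 0).card ≤ 2 * n := by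
    intro t ht
    have ht := (Finset.mem_erase.1 ht).1
    obtain ⟨x, hx⟩ := hcon t ht
    have := hz t ht ⟨x, sub_ne_zero.2 hx⟩
    rw [mul_left_comm] at this
    exact Nat.le_of_mul_le_mul_left this (by omega)
  have h2 := Finset.sum_le_sum h1
  rw [Finset.sum_const, Finset.card_erase_of_mem (Finset.mem_univ _), Finset.card_univ, ZMod.card,
    smul_eq_mul] at h2
  have h3 : ∀ x, ((Finset.univ : Finset (ZMod p)).erase 0 |>.filter
      fun t => f x - t * g x = 0).card = if f x ≠ 0 then 1 else p - 1 := by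
    intro x
    split_ifs with hx
    · have hg := (hsupp x).1 hx
      rw [Finset.card_eq_one]
      refine ⟨f x / g x, Finset.ext fun t => ?_⟩
      rw [Finset.mem_filter, Finset.mem_erase, Finset.mem_singleton, eq_div_iff hg, sub_eq_zero]
      constructor
      · exact fun ht => ht.2.symm
      · intro ht
        refine ⟨⟨?_, Finset.mem_univ _⟩, ht.symm⟩
        rintro rfl
        exact hx (by rw [← ht, zero_mul])
    · have hg : g x = 0 := by
        by_contra hg
        exact hx ((hsupp x).2 hg)
      rw [Finset.filter_true_of_mem, Finset.card_erase_of_mem (Finset.mem_univ _),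
        Finset.card_univ, ZMod.card]
      intro t _
      rw [hg, mul_zero, sub_zero, not_not.1 hx]
  have h4 : ∑ t ∈ (Finset.univ : Finset (ZMod p)).erase 0,
      (Finset.univ.filter fun x => f x - t * g x = 0).card
      = ∑ x, if f x ≠ 0 then 1 else p - 1 := by
    rw [← Finset.sum_congr rfl fun x _ => h3 x]
    simp only [Finset.card_filter]
    exact Finset.sum_comm
  have h5 := Finset.card_filter_add_card_filter_not (s := (Finset.univ : Finset X))
    fun x => f x ≠ 0
  rw [h4, Finset.sum_ite, Finset.sum_const, Finset.sum_const, smul_eq_mul, smul_eq_mul, hi] at h2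
  rw [hi, Finset.card_univ, hX] at h5
  obtain ⟨k, rfl⟩ : ∃ k, p = k + 3 := ⟨p - 3, by omega⟩
  simp only [show k + 3 - 1 = k + 2 by omega] at *
  set j := (Finset.univ.filter fun x => ¬ f x ≠ 0).card
  have h6 : (k + 1) * i < (k + 1) * ((k + 2) * n) := Nat.mul_lt_mul_of_pos_left hin (by omega)
  zify at *
  have h7 : (j : ℤ) = (k + 3) * n - i := by linarith
  rw [h7] at h2
  nlinarith

end CodeStructure

section Design

variable {p s l d i : ℕ} [Fact p.Prime] {F : Type} [Field F] [Fintype F] [DecidableEq F] [CharP F p]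
  [Algebra (ZMod p) F]

/-- The support of the codeword with parameters `t = (a,b,c,h)`. -/
noncomputable def codeSupp (p s l : ℕ) [Fact p.Prime] {F : Type} [Field F] [Fintype F]
    [Algebra (ZMod p) F] (t : F × F × F × ZMod p) : Finset F :=
  Finset.univ.filter fun x => codeFun p s l t.1 t.2.1 t.2.2.1 t.2.2.2 x ≠ 0

/-- The parameters of the codewords of weight `i`. -/
noncomputable def weightSet (p s l i : ℕ) [Fact p.Prime] {F : Type} [Field F] [Fintype F]
    [DecidableEq F] [Algebra (ZMod p) F] : Finset (F × F × F × ZMod p) :=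
  Finset.univ.filter fun t => t.1 ^ p ^ s = t.1 ∧ (codeSupp p s l t).card = i

theorem mem_codeSupp {t : F × F × F × ZMod p} {x : F} :
    x ∈ codeSupp p s l t ↔ codeFun p s l t.1 t.2.1 t.2.2.1 t.2.2.2 x ≠ 0 := by
  simp [codeSupp]

theorem mem_weightSet {t : F × F × F × ZMod p} :
    t ∈ weightSet p s l i ↔ t.1 ^ p ^ s = t.1 ∧ (codeSupp p s l t).card = i := by
  simp [weightSet]

theorem cword_eq (hp : Odd p) (hF : Fintype.card F = p ^ (2 * s)) {a b c : F} {h : ZMod p}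
    (ha : a ^ p ^ s = a) (x : F) :
    cword p s l a b c h x = algebraMap (ZMod p) F (codeFun p s l a b c h x) := by
  have h1 : ∀ z : F, trp p (2 * s) z = algebraMap (ZMod p) F (Algebra.trace (ZMod p) F z) := by
    intro z
    rw [FiniteField.algebraMap_trace_eq_sum_pow, finrank_eq hF, Nat.card_zmod, trp]
  have h2 : ∀ w : F, w ^ p ^ s = w → trp p s w = trp p (2 * s) (2⁻¹ * w) := by
    intro w hw
    have h2 := two_ne_zero_of_odd (F := F) hp
    rw [trp, trp, two_mul, Finset.sum_range_add, ← Finset.sum_add_distrib]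
    refine Finset.sum_congr rfl fun j _ => ?_
    rw [mul_pow, mul_pow, inv_two_pow_pow, inv_two_pow_pow, pow_add, pow_mul, hw]
    field_simp
    ring
  have hw : (a * x ^ (p ^ s + 1)) ^ p ^ s = a * x ^ (p ^ s + 1) := by
    rw [mul_pow, ha, pow_succ, mul_pow, pow_pow_pow_self hF, mul_comm x]
  have hcast : ∀ h : ZMod p, (ZMod.cast h : F) = algebraMap (ZMod p) F h := fun h =>
    congrArg (fun g : ZMod p →+* F => g h)
      (Subsingleton.elim (ZMod.castHom dvd_rfl F) (algebraMap (ZMod p) F))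
  rw [cword, h2 _ hw, h1, h1, hcast, codeFun, quadPart, map_add (algebraMap (ZMod p) F),
    map_add (algebraMap (ZMod p) F), map_add (Algebra.trace (ZMod p) F),
    map_add (algebraMap (ZMod p) F), map_add (Algebra.trace (ZMod p) F),
    map_add (algebraMap (ZMod p) F), ← mul_assoc]
  ring

theorem suppw_eq (hp : Odd p) (hF : Fintype.card F = p ^ (2 * s)) {t : F × F × F × ZMod p}
    (ht : t.1 ^ p ^ s = t.1) :
    suppw p s l t.1 t.2.1 t.2.2.1 t.2.2.2 = codeSupp p s l t := by
  refine Finset.filter_congr fun x _ => ?_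
  rw [cword_eq hp hF ht, map_ne_zero]

theorem codeFun_smul (a b c : F) (h t : ZMod p) (x : F) :
    codeFun p s l (t • a) (t • b) (t • c) (t * h) x = t * codeFun p s l a b c h x := by
  have e := codeFun_sub_smul (p := p) (s := s) (l := l) 0 0 0 a b c 0 h (-t) x
  simp only [neg_smul, neg_mul, sub_neg_eq_add, zero_add] at e
  rw [e]
  simp [codeFun, quadPart]

theorem card_weightSet (hp : Odd p) (hF : Fintype.card F = p ^ (2 * s)) (hs : 1 ≤ s)
    (hl : l ≤ 2 * s - 1) (hi : i = (p - 1) * (p ^ (2 * s - 1) - p ^ (s - 1))) {N : Finset (F × F)}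
    (hN : ∀ t, t ∈ N ↔ t.1 ^ p ^ s = t.1 ∧ expSum p s l t.1 t.2 = (p : ℂ) ^ s) :
    (weightSet p s l i (F := F)).card = N.card * p ^ (2 * s) := by
  rw [← hF, ← Finset.card_univ, ← Finset.card_product]
  refine (Finset.card_bij (fun (n : (F × F) × F) _ => ((n.1.1, n.1.2,
    polarMap p s l n.1.1 n.1.2 n.2,
      Algebra.trace (ZMod p) F (quadPart p s l n.1.1 n.1.2 n.2)) : F × F × F × ZMod p))
    ?_ ?_ ?_).symm
  · intro n hn
    obtain ⟨ha, he⟩ := (hN n.1).1 (Finset.mem_product.1 hn).1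
    refine mem_weightSet.2 ⟨ha, ?_⟩
    rw [hi]
    exact (weight_codeFun_iff hp hF hs hl ha).2 ⟨he, n.2, rfl, rfl⟩
  · rintro ⟨⟨a, b⟩, w⟩ hn ⟨⟨a', b'⟩, w'⟩ - heq
    simp only [Prod.mk.injEq] at heq
    obtain ⟨rfl, rfl, hw, -⟩ := heq
    obtain ⟨ha, he⟩ := (hN _).1 (Finset.mem_product.1 hn).1
    rw [polarMap_injective (card_radical_of_expSum hp hF hl ha he) hw]
  · rintro ⟨a, b, c, h⟩ ht
    obtain ⟨ha, hw⟩ := mem_weightSet.1 ht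
    rw [hi] at hw
    obtain ⟨he, w, hc, hh⟩ := (weight_codeFun_iff hp hF hs hl ha).1 hw
    exact ⟨((a, b), w), Finset.mem_product.2 ⟨(hN (a, b)).2 ⟨ha, he⟩, Finset.mem_univ w⟩,
      Prod.ext rfl (Prod.ext rfl (Prod.ext hc hh))⟩

theorem eq_of_codeFun (hp : Odd p) (hF : Fintype.card F = p ^ (2 * s))
    (hl : l ≤ 2 * s - 1) (hds : d ∣ s) (hdl : d ∣ l) (hd' : Nat.gcd (s + l) (2 * l) = d)
    (hlt : d < s) {t u : F × F × F × ZMod p} (r : ZMod p) (ht : t.1 ^ p ^ s = t.1)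
    (hu : u.1 ^ p ^ s = u.1)
    (h : ∀ x, codeFun p s l t.1 t.2.1 t.2.2.1 t.2.2.2 x
      = r * codeFun p s l u.1 u.2.1 u.2.2.1 u.2.2.2 x) : t = r • u := by
  have hz := fun x => codeFun_sub_smul (p := p) (s := s) (l := l) t.1 t.2.1 t.2.2.1 u.1 u.2.1
    u.2.2.1 t.2.2.2 u.2.2.2 r x
  simp only [h, sub_self] at hz
  have hsub : (t.1 - r • u.1) ^ p ^ s = t.1 - r • u.1 := by
    rw [sub_pow_pow, smul_pow_pow, ht, hu]
  obtain ⟨e1, e2, e3, e4⟩ := eq_zero_of_codeFun hp hF hl hds hdl hd' hlt hsub hz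
  exact Prod.ext (sub_eq_zero.1 e1) (Prod.ext (sub_eq_zero.1 e2)
    (Prod.ext (sub_eq_zero.1 e3) (sub_eq_zero.1 e4)))

theorem card_fiber_codeSupp (hp : Odd p) (hF : Fintype.card F = p ^ (2 * s)) (hs : 1 ≤ s)
    (hl : l ≤ 2 * s - 1) (hds : d ∣ s) (hdl : d ∣ l) (hd' : Nat.gcd (s + l) (2 * l) = d)
    (hlt : d < s) (hi0 : 0 < i) (hi : i < (p - 1) * p ^ (2 * s - 1)) {u : F × F × F × ZMod p}
    (hu : u ∈ weightSet p s l i) :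
    ((weightSet p s l i).filter fun t => codeSupp p s l t = codeSupp p s l u).card = p - 1 := by
  have hpp := (Fact.out : p.Prime)
  obtain ⟨hua, huw⟩ := mem_weightSet.1 hu
  have hp2 : 2 < p := by
    have := hpp.two_le
    have : p ≠ 2 := by
      rintro rfl
      exact absurd hp (by decide)
    omega
  have hpq : p * p ^ (2 * s - 1) = p ^ (2 * s) := by
    rw [← pow_succ']
    congr 1
    omega
  have hfun : ∀ (r : ZMod p) x, codeFun p s l (r • u).1 (r • u).2.1 (r • u).2.2.1 (r • u).2.2.2 x
      = r * codeFun p s l u.1 u.2.1 u.2.2.1 u.2.2.2 x := fun r x => codeFun_smul _ _ _ _ r x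
  have himage : (weightSet p s l i).filter (fun t => codeSupp p s l t = codeSupp p s l u)
      = ((Finset.univ : Finset (ZMod p)).erase 0).image fun r => r • u := by
    ext t
    rw [Finset.mem_filter, Finset.mem_image]
    constructor
    · rintro ⟨ht, hsupp⟩
      obtain ⟨hta, htw⟩ := mem_weightSet.1 ht
      have hsupp' : ∀ x, codeFun p s l t.1 t.2.1 t.2.2.1 t.2.2.2 x ≠ 0
          ↔ codeFun p s l u.1 u.2.1 u.2.2.1 u.2.2.2 x ≠ 0 := fun x => by
        rw [← mem_codeSupp, ← mem_codeSupp, hsupp]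
      obtain ⟨r, hr, h⟩ := exists_mul_of_support _ _ hp2 (hF.trans hpq.symm) hsupp' htw hi
        fun r _ hne => by
          simp only [← codeFun_sub_smul] at hne ⊢
          rw [hpq]
          exact card_codeFun_zeros_le hp hF hl (by rw [sub_pow_pow, smul_pow_pow, hta, hua]) hne
      exact ⟨r, Finset.mem_erase.2 ⟨hr, Finset.mem_univ _⟩,
        (eq_of_codeFun hp hF hl hds hdl hd' hlt r hta hua h).symm⟩
    · rintro ⟨r, hr, rfl⟩
      have hr := (Finset.mem_erase.1 hr).1
      have hsupp : codeSupp p s l (r • u) = codeSupp p s l u := by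
        ext x
        rw [mem_codeSupp, mem_codeSupp, hfun, mul_ne_zero_iff, and_iff_right hr]
      refine ⟨mem_weightSet.2 ⟨?_, by rw [hsupp, huw]⟩, hsupp⟩
      rw [Prod.smul_fst, smul_pow_pow, hua]
  rw [himage, Finset.card_image_of_injective, Finset.card_erase_of_mem (Finset.mem_univ _),
    Finset.card_univ, ZMod.card]
  intro r r' hrr
  obtain ⟨x, hx⟩ := Finset.card_pos.1 (huw ▸ hi0)
  have e1 := hfun r x
  have e2 := hfun r' x
  simp only at hrr
  rw [hrr, e2] at e1
  exact (mul_right_cancel₀ (mem_codeSupp.1 hx) e1).symm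

theorem card_filter_weightSet (hp : Odd p) (hF : Fintype.card F = p ^ (2 * s)) (hs : 1 ≤ s)
    (hl : l ≤ 2 * s - 1) (hds : d ∣ s) (hdl : d ∣ l) (hd' : Nat.gcd (s + l) (2 * l) = d)
    (hlt : d < s) (hi0 : 0 < i) (hi : i < (p - 1) * p ^ (2 * s - 1))
    (P : Finset F → Prop) [DecidablePred P] :
    ((weightSet p s l i).filter fun t => P (codeSupp p s l t)).card
      = (((weightSet p s l i).image (codeSupp p s l)).filter P).card * (p - 1) := by
  rw [Finset.card_eq_sum_card_fiberwise (f := codeSupp p s l)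
    (t := ((weightSet p s l i).image (codeSupp p s l)).filter P), Finset.sum_congr rfl
    (g := fun _ => p - 1), Finset.sum_const, smul_eq_mul]
  · intro S hS
    obtain ⟨hS, hPS⟩ := Finset.mem_filter.1 hS
    obtain ⟨u, hu, rfl⟩ := Finset.mem_image.1 hS
    rw [← card_fiber_codeSupp hp hF hs hl hds hdl hd' hlt hi0 hi hu, Finset.filter_filter]
    congr 1
    refine Finset.filter_congr fun t _ => ?_
    constructor
    · exact fun h => h.2
    · exact fun h => ⟨h ▸ hPS, h⟩
  · intro t ht
    obtain ⟨ht, hPt⟩ := Finset.mem_filter.1 (Finset.mem_coe.1 ht)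
    exact Finset.mem_coe.2 (Finset.mem_filter.2 ⟨Finset.mem_image_of_mem _ ht, hPt⟩)

theorem codeFun_affine (hp : Odd p) (hF : Fintype.card F = p ^ (2 * s))
    (hl : l ≤ 2 * s - 1) {a b c : F} {h : ZMod p} (ha : a ^ p ^ s = a) (u v x : F) :
    codeFun p s l (a * u ^ (p ^ s + 1)) (b * u ^ (p ^ l + 1)) (u * (polarMap p s l a b v + c))
      (codeFun p s l a b c h v) x = codeFun p s l a b c h (v + u * x) := by
  rw [codeFun_add hp hF hl ha, codeFun, quadPart_scale, mul_right_comm]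
  ring

/-- The number of codewords of weight `i` whose support contains two given points. -/
noncomputable def pairCount (p s l i : ℕ) [Fact p.Prime] {F : Type} [Field F] [Fintype F]
    [DecidableEq F] [Algebra (ZMod p) F] (x y : F) : ℕ :=
  ((weightSet p s l i).filter fun t => x ∈ codeSupp p s l t ∧ y ∈ codeSupp p s l t).card

theorem pairCount_affine_le (hp : Odd p) (hF : Fintype.card F = p ^ (2 * s))
    (hl : l ≤ 2 * s - 1) (hds : d ∣ s) (hdl : d ∣ l) (hd' : Nat.gcd (s + l) (2 * l) = d)
    (hlt : d < s) {u : F} (hu : u ≠ 0) (v x y : F) :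
    pairCount p s l i (v + u * x) (v + u * y) ≤ pairCount p s l i x y := by
  set T : F × F × F × ZMod p → F × F × F × ZMod p := fun t =>
    (t.1 * u ^ (p ^ s + 1), t.2.1 * u ^ (p ^ l + 1), u * (polarMap p s l t.1 t.2.1 v + t.2.2.1),
      codeFun p s l t.1 t.2.1 t.2.2.1 t.2.2.2 v) with hT
  have hTf : ∀ t : F × F × F × ZMod p, t.1 ^ p ^ s = t.1 → ∀ z,
      codeFun p s l (T t).1 (T t).2.1 (T t).2.2.1 (T t).2.2.2 z
        = codeFun p s l t.1 t.2.1 t.2.2.1 t.2.2.2 (v + u * z) :=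
    fun t ht z => codeFun_affine hp hF hl ht u v z
  have hTs : ∀ t : F × F × F × ZMod p, t.1 ^ p ^ s = t.1 → ∀ z,
      z ∈ codeSupp p s l (T t) ↔ v + u * z ∈ codeSupp p s l t := fun t ht z => by
    rw [mem_codeSupp, mem_codeSupp, hTf t ht]
  refine Finset.card_le_card_of_injOn T ?_ ?_
  · intro t ht
    obtain ⟨ht, hx, hy⟩ := Finset.mem_filter.1 (Finset.mem_coe.1 ht)
    obtain ⟨hta, htw⟩ := mem_weightSet.1 ht
    refine Finset.mem_coe.2 (Finset.mem_filter.2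
      ⟨mem_weightSet.2 ⟨?_, ?_⟩, (hTs t hta x).2 hx, (hTs t hta y).2 hy⟩)
    · rw [hT, mul_pow, hta, pow_succ u, mul_pow, pow_pow_pow_self hF, mul_comm u]
    · rw [← htw]
      exact Finset.card_bijective ((Equiv.mulLeft₀ u hu).trans (Equiv.addLeft v))
        (Equiv.bijective _) fun z => hTs t hta z
  · intro t ht t' ht' heq
    have hta := (mem_weightSet.1 (Finset.mem_filter.1 (Finset.mem_coe.1 ht)).1).1
    have hta' := (mem_weightSet.1 (Finset.mem_filter.1 (Finset.mem_coe.1 ht')).1).1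
    rw [← one_smul (ZMod p) t']
    refine eq_of_codeFun hp hF hl hds hdl hd' hlt 1 hta hta' fun z => ?_
    have e1 := hTf t hta (u⁻¹ * (z - v))
    rw [heq, hTf t' hta', mul_inv_cancel_left₀ hu, add_sub_cancel] at e1
    rw [one_mul, e1]

theorem pairCount_le (hp : Odd p) (hF : Fintype.card F = p ^ (2 * s))
    (hl : l ≤ 2 * s - 1) (hds : d ∣ s) (hdl : d ∣ l) (hd' : Nat.gcd (s + l) (2 * l) = d)
    (hlt : d < s) {x y x' y' : F} (hxy : x ≠ y) (hxy' : x' ≠ y') :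
    pairCount p s l i x' y' ≤ pairCount p s l i x y := by
  have h0 : x - y ≠ 0 := sub_ne_zero.2 hxy
  have h := pairCount_affine_le (i := i) hp hF hl hds hdl hd' hlt
    (u := (x' - y') / (x - y)) (div_ne_zero (sub_ne_zero.2 hxy') h0)
    (x' - (x' - y') / (x - y) * x) x y
  convert h using 2
  · ring
  · field_simp
    ring

theorem sum_pairCount :
    ∑ z ∈ (Finset.univ : Finset F).offDiag, pairCount p s l i z.1 z.2
      = (weightSet p s l i (F := F)).card * (i * i - i) := by
  simp only [pairCount, Finset.card_filter]
  rw [Finset.sum_comm, Finset.sum_congr rfl (g := fun _ => i * i - i), Finset.sum_const,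
    smul_eq_mul]
  intro t ht
  rw [← (mem_weightSet.1 ht).2, ← Finset.offDiag_card, ← Finset.card_filter]
  congr 1
  ext z
  simp only [Finset.mem_filter, Finset.mem_offDiag, Finset.mem_univ, true_and]
  tauto

end Design

/-- The arithmetic that turns the double count of flags into the value of `λ`. -/
theorem card_of_double_count {p s d i n L : ℕ} (hp : 1 < p) (hs : 1 ≤ s)
    (hi : i = (p - 1) * (p ^ (2 * s - 1) - p ^ (s - 1)))
    (hsum : (p ^ (2 * s) * p ^ (2 * s) - p ^ (2 * s)) * (L * (p - 1))
      = n * p ^ (2 * s) * (i * i - i))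
    (hn : (n : ℚ) * (2 * ((p : ℚ) ^ d + 1))
      = (p : ℚ) ^ d * ((p : ℚ) ^ s + 1) * ((p : ℚ) ^ (2 * s) - 1)) :
    (L : ℚ) = (p : ℚ) ^ (s + d - 1)
      * (((p : ℚ) - 1) * ((p : ℚ) ^ (2 * s - 1) - (p : ℚ) ^ (s - 1)) - 1)
      * ((p : ℚ) ^ (2 * s) - 1) / (2 * ((p : ℚ) ^ d + 1)) := by
  obtain ⟨k, rfl⟩ : ∃ k, s = k + 1 := ⟨s - 1, by omega⟩
  have e1 : 2 * (k + 1) - 1 = k + (k + 1) := by omega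
  have e2 : k + 1 + d - 1 = k + d := by omega
  have hle : p ^ k ≤ p ^ (k + (k + 1)) := Nat.pow_le_pow_right (by omega) (by omega)
  have hq : p ^ (2 * (k + 1)) ≤ p ^ (2 * (k + 1)) * p ^ (2 * (k + 1)) :=
    Nat.le_mul_self _
  rw [e1, Nat.add_sub_cancel] at hi ⊢
  rw [e2]
  have hiQ : (i : ℚ) = ((p : ℚ) - 1) * ((p : ℚ) ^ (k + (k + 1)) - (p : ℚ) ^ k) := by
    rw [hi]
    push_cast [Nat.cast_sub hp.le, Nat.cast_sub hle]
    rfl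
  have hsumQ : ((p : ℚ) ^ (2 * (k + 1)) * (p : ℚ) ^ (2 * (k + 1)) - (p : ℚ) ^ (2 * (k + 1)))
      * (L * ((p : ℚ) - 1)) = n * (p : ℚ) ^ (2 * (k + 1)) * (i * i - i) := by
    have h := congrArg (Nat.cast : ℕ → ℚ) hsum
    push_cast [Nat.cast_sub hp.le, Nat.cast_sub hq, Nat.cast_sub (Nat.le_mul_self i)] at h
    exact h
  have hpQ : (1 : ℚ) < p := by exact_mod_cast hp
  have hqQ : (1 : ℚ) < (p : ℚ) ^ (2 * (k + 1)) := one_lt_pow₀ hpQ (by omega)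
  have hd0 : (0 : ℚ) < 2 * ((p : ℚ) ^ d + 1) := by positivity
  rw [← hiQ, eq_div_iff hd0.ne']
  have hc : (p : ℚ) ^ (2 * (k + 1)) * ((p : ℚ) ^ (2 * (k + 1)) - 1) * ((p : ℚ) - 1) ≠ 0 :=
    mul_ne_zero (mul_ne_zero (by positivity) (sub_ne_zero.2 hqQ.ne')) (sub_ne_zero.2 hpQ.ne')
  refine mul_left_cancel₀ hc ?_
  have hiQ' : (i : ℚ) * ((p : ℚ) ^ (k + 1) + 1)
      = ((p : ℚ) - 1) * (p : ℚ) ^ k * ((p : ℚ) ^ (2 * (k + 1)) - 1) := by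
    rw [hiQ]
    ring
  rw [pow_add (p : ℚ) k d]
  linear_combination (2 * ((p : ℚ) ^ d + 1)) * hsumQ
    + (p : ℚ) ^ (2 * (k + 1)) * (i * i - i) * hn
    + (p : ℚ) ^ (2 * (k + 1)) * (i - 1) * (p : ℚ) ^ d * ((p : ℚ) ^ (2 * (k + 1)) - 1) * hiQ'

theorem stmt13 (p s l : ℕ) [Fact p.Prime] (F : Type) [Field F] [Fintype F] [DecidableEq F]
    [CharP F p] (hodd : Odd p) (hs : 2 ≤ s) (hl1 : 1 ≤ l) (hls : l ≠ s)
    (hl2 : l ≤ 2 * s - 1) (hF : Fintype.card F = p ^ (2 * s)) (d : ℕ)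
    (hd : Nat.gcd s l = d) (hd' : Nat.gcd (s + l) (2 * l) = d) (hdodd : Odd d) :
    (∀ S ∈ (((Finset.univ : Finset (F × F × F × ZMod p)).filter fun t =>
        t.1 ^ p ^ s = t.1 ∧ (suppw p s l t.1 t.2.1 t.2.2.1 t.2.2.2).card
            = (p - 1) * (p ^ (2 * s - 1) - p ^ (s - 1))).image
        fun t => suppw p s l t.1 t.2.1 t.2.2.1 t.2.2.2),
      S.card = (p - 1) * (p ^ (2 * s - 1) - p ^ (s - 1))) ∧
    ∀ x y : F, x ≠ y →
      (((((Finset.univ : Finset (F × F × F × ZMod p)).filter fun t =>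
        t.1 ^ p ^ s = t.1 ∧ (suppw p s l t.1 t.2.1 t.2.2.1 t.2.2.2).card
            = (p - 1) * (p ^ (2 * s - 1) - p ^ (s - 1))).image
        fun t => suppw p s l t.1 t.2.1 t.2.2.1 t.2.2.2).filter
        fun S => x ∈ S ∧ y ∈ S).card : ℚ)
        = (p : ℚ) ^ (s + d - 1) * (((p : ℚ) - 1) * ((p : ℚ) ^ (2 * s - 1) - (p : ℚ) ^ (s - 1)) - 1)
          * ((p : ℚ) ^ (2 * s) - 1) / (2 * ((p : ℚ) ^ d + 1)) := by
  classical
  let _ := ZMod.algebra F p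
  have hds : d ∣ s := hd ▸ Nat.gcd_dvd_left s l
  have hdl : d ∣ l := hd ▸ Nat.gcd_dvd_right s l
  have hd0 : 0 < d := hdodd.pos
  have hlt : d < s := by
    refine lt_of_le_of_ne (Nat.le_of_dvd (by omega) hds) ?_
    rintro rfl
    obtain ⟨k, rfl⟩ := hdl
    have h1 : k ≠ 1 := fun h => hls (by rw [h, mul_one])
    have h0 : k ≠ 0 := fun h => by simp [h] at hl1
    have : d * 2 ≤ d * k := Nat.mul_le_mul_left d (by omega)
    omega
  refine ⟨fun S hS => ?_, fun x y hxy => ?_⟩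
  · obtain ⟨t, ht, rfl⟩ := Finset.mem_image.1 hS
    exact (Finset.mem_filter.1 ht).2.2
  obtain ⟨i, hi⟩ : ∃ i, i = (p - 1) * (p ^ (2 * s - 1) - p ^ (s - 1)) := ⟨_, rfl⟩
  rw [← hi]
  have hweight : ((Finset.univ : Finset (F × F × F × ZMod p)).filter fun t =>
      t.1 ^ p ^ s = t.1 ∧ (suppw p s l t.1 t.2.1 t.2.2.1 t.2.2.2).card = i)
      = weightSet p s l i := by
    refine Finset.filter_congr fun t _ => and_congr_right fun ht => ?_
    rw [suppw_eq hodd hF ht]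
  rw [hweight, Finset.image_congr (g := codeSupp p s l) fun t ht =>
    suppw_eq hodd hF (mem_weightSet.1 (Finset.mem_coe.1 ht)).1]
  have hp1 : 1 < p := (Fact.out : p.Prime).one_lt
  have hpow : p ^ (s - 1) < p ^ (2 * s - 1) := Nat.pow_lt_pow_right hp1 (by omega)
  have hpow0 : 0 < p ^ (s - 1) := by positivity
  have hi0 : 0 < i := hi ▸ Nat.mul_pos (by omega) (by omega)
  have hilt : i < (p - 1) * p ^ (2 * s - 1) :=
    hi ▸ Nat.mul_lt_mul_of_pos_left (by omega) (by omega)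
  have hcount := card_filter_weightSet hodd hF (by omega) hl2 hds hdl hd' hlt hi0 hilt
    fun S => x ∈ S ∧ y ∈ S
  set L := (((weightSet p s l i).image (codeSupp p s l)).filter fun S => x ∈ S ∧ y ∈ S).card
  have hsum := sum_pairCount (p := p) (s := s) (l := l) (i := i) (F := F)
  rw [Finset.sum_congr rfl (g := fun _ => pairCount p s l i x y) fun z hz =>
      le_antisymm (pairCount_le hodd hF hl2 hds hdl hd' hlt hxy (Finset.mem_offDiag.1 hz).2.2)
        (pairCount_le hodd hF hl2 hds hdl hd' hlt (Finset.mem_offDiag.1 hz).2.2 hxy),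
    Finset.sum_const, smul_eq_mul, Finset.offDiag_card, Finset.card_univ, hF] at hsum
  obtain ⟨N, hN⟩ : ∃ N : Finset (F × F), ∀ t, t ∈ N ↔
      t.1 ^ p ^ s = t.1 ∧ expSum p s l t.1 t.2 = (p : ℂ) ^ s :=
    ⟨Finset.univ.filter fun t => t.1 ^ p ^ s = t.1 ∧ expSum p s l t.1 t.2 = (p : ℂ) ^ s,
      fun t => by simp⟩
  have hNcard := card_expSum_eq hodd hF hl2 hd0 hds hdl hd' (by omega) hN
  rw [card_weightSet hodd hF (by omega) hl2 hi hN, pairCount, hcount] at hsum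
  have hNQ : (N.card : ℚ) * (2 * ((p : ℚ) ^ d + 1))
      = (p : ℚ) ^ d * ((p : ℚ) ^ s + 1) * ((p : ℚ) ^ (2 * s) - 1) := by
    exact_mod_cast hNcard
  exact card_of_double_count hp1 (by omega) hi hsum hNQ
end
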